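/- Let Γ be a non-elementary hyperbolic group with two finitely supported symmetric probability measures μ and μ̂ whose supports generate Γ, with random walks (Z_n) and (Ẑ_n), Green functions G and Ĝ, asymptotic entropies h and ĥ, and harmonic measures ν and ν̂ (seen from the neutral element e). Then the following are equivalent: (i) ĥ = lim_n −(1/n) log G(e,Ẑ_n) in L¹ and almost surely; (ii) h = lim_n −(1/n) log Ĝ(e,Z_n) in L¹ and almost surely; (iii) ν and ν̂ are equivalent; (iv) there is a constant C with (1/C) ≤ G(x,y)/Ĝ(x,y) ≤ C for all x,y ∈ Γ. -/

import Mathlib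

open Filter MeasureTheory Topology Metric Set
open scoped ENNReal

noncomputable section

namespace GHM

/-! ### Coarse geometry of distance functions -/

/-- The Gromov product `(x|y)_w` of `x` and `y` seen from `w`, for a distance function `d`. -/
def gromov {X : Type*} (d : X → X → ℝ) (w x y : X) : ℝ :=
  (d x w + d y w - d x y) / 2

/-- `d` is `δ`-hyperbolic (four point condition on Gromov products). -/
def IsHyperbolicWith {X : Type*} (d : X → X → ℝ) (δ : ℝ) : Prop :=
  ∀ w x y z : X, min (gromov d w x y) (gromov d w x z) - δ ≤ gromov d w y z

/-- `d` is Gromov hyperbolic. -/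
def IsHyperbolic {X : Type*} (d : X → X → ℝ) : Prop :=
  ∃ δ : ℝ, 0 ≤ δ ∧ IsHyperbolicWith d δ

/-- `d` is a genuine metric. -/
structure IsMetricFun {X : Type*} (d : X → X → ℝ) : Prop where
  refl : ∀ x, d x x = 0
  pos : ∀ x y, x ≠ y → 0 < d x y
  symm : ∀ x y, d x y = d y x
  triangle : ∀ x y z, d x z ≤ d x y + d y z

/-- `f` is a `(Λ,c)`-quasi-isometric embedding from `(X,dX)` to `(Y,dY)`. -/
def QIEmbed {X Y : Type*} (dX : X → X → ℝ) (dY : Y → Y → ℝ)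
    (f : X → Y) (Λ c : ℝ) : Prop :=
  ∀ x x' : X, dX x x' / Λ - c ≤ dY (f x) (f x') ∧ dY (f x) (f x') ≤ Λ * dX x x' + c

/-- `(X,dX)` and `(Y,dY)` are quasi-isometric. -/
def QuasiIsometric {X Y : Type*} (dX : X → X → ℝ) (dY : Y → Y → ℝ) : Prop :=
  ∃ (f : X → Y) (Λ c C : ℝ), 1 ≤ Λ ∧ 0 ≤ c ∧ 0 ≤ C ∧
    QIEmbed dX dY f Λ c ∧ ∀ y : Y, ∃ x : X, dY (f x) y ≤ C

variable {G : Type*} [Group G]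

/-- Word length of `g` with respect to the (symmetrized) finite set `S`. -/
def wordLength (S : Finset G) (g : G) : ℕ :=
  sInf {n : ℕ | ∃ l : List G, l.length = n ∧ (∀ a ∈ l, a ∈ S ∨ a⁻¹ ∈ S) ∧ l.prod = g}

/-- The word metric associated with a finite generating set `S`. -/
def wordDist (S : Finset G) (x y : G) : ℝ := wordLength S (x⁻¹ * y)

/-- `S` generates the group. -/
def Generates (S : Finset G) : Prop := Subgroup.closure (S : Set G) = ⊤

/-- The standard metric on `ℤ`. -/
def intDist (m n : ℤ) : ℝ := |(m : ℝ) - (n : ℝ)|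

/-- `G` is a non-elementary hyperbolic group: finitely generated, its word metrics are
Gromov hyperbolic, it is infinite, and it is not quasi-isometric to `ℤ`. -/
def NonElemHyperbolic (G : Type*) [Group G] : Prop :=
  Infinite G ∧ (∃ S : Finset G, Generates S) ∧
    ∀ S : Finset G, Generates S →
      IsHyperbolic (wordDist S) ∧ ¬ QuasiIsometric (wordDist S) intDist

/-- `d` is invariant under left translations. -/
def LeftInvariant (d : G → G → ℝ) : Prop := ∀ g x y : G, d (g * x) (g * y) = d x y

/-- `d` belongs to the class `𝒟(Γ)`: it is a left-invariant Gromov hyperbolic metric on the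
group, quasi-isometric to a word metric of a finite generating set. -/
def MemD (d : G → G → ℝ) : Prop :=
  IsMetricFun d ∧ LeftInvariant d ∧ IsHyperbolic d ∧
    ∃ S : Finset G, Generates S ∧ QuasiIsometric d (wordDist S)

/-! ### Random walks -/

/-- `μ` is (the density of) a probability measure on the (countable) group. -/
def IsProbDensity (μ : G → ℝ) : Prop := (∀ g, 0 ≤ μ g) ∧ HasSum μ 1

/-- `μ` is symmetric. -/
def IsSymmetric (μ : G → ℝ) : Prop := ∀ g : G, μ g⁻¹ = μ g

/-- The support of `μ` generates `G`. -/
def GeneratesSupp (μ : G → ℝ) : Prop := Subgroup.closure {g : G | μ g ≠ 0} = ⊤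

open scoped Classical in
/-- Convolution powers `μ^n` of `μ`. -/
def convPow (μ : G → ℝ) : ℕ → G → ℝ
  | 0 => fun g => if g = 1 then 1 else 0
  | n + 1 => fun g => ∑' y : G, convPow μ n y * μ (y⁻¹ * g)

/-- The Green function `G(x,y) = ∑_n μ^n(x⁻¹y)`. -/
def greenFn (μ : G → ℝ) (x y : G) : ℝ := ∑' n : ℕ, convPow μ n (x⁻¹ * y)

/-- The random walk is transient, i.e. `G(e,e) = ∑_n μ^n(e) < ∞`. -/
def Transient (μ : G → ℝ) : Prop := Summable fun n : ℕ => convPow μ n (1 : G)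

/-- Successive positions of a walk started at `x` with increments `l`. -/
def walkPositions (x : G) (l : List G) : List G := l.scanl (fun p a => p * a) x

/-- The increments `l` describe a trajectory from `x` which hits `y` for the first time at
its final position. -/
def IsFirstHitPath (x y : G) (l : List G) : Prop :=
  (walkPositions x l).getLast? = some y ∧ y ∉ (walkPositions x l).dropLast

/-- `F(x,y)`: the probability that the `μ`-random walk started at `x` ever hits `y`. -/
def hitProb (μ : G → ℝ) (x y : G) : ℝ :=
  ∑' l : {l : List G // IsFirstHitPath x y l}, ((l : List G).map μ).prod

/-- The Green metric `d_G(x,y) = - log F(x,y)`. -/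
def greenDist (μ : G → ℝ) (x y : G) : ℝ := - Real.log (hitProb μ x y)

/-- `μ` has a finite first moment with respect to `d`. -/
def FiniteFirstMoment (d : G → G → ℝ) (μ : G → ℝ) : Prop :=
  Summable fun g : G => d 1 g * μ g

/-- `μ` has an exponential moment with respect to `d`. -/
def HasExpMoment (d : G → G → ℝ) (μ : G → ℝ) : Prop :=
  ∃ lam : ℝ, 0 < lam ∧ Summable fun g : G => Real.exp (lam * d 1 g) * μ g

/-- The entropy `H(μ^n) = -∑_γ μ^n(γ) log μ^n(γ)` of the `n`-th convolution power. -/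
def entropyAt (μ : G → ℝ) (n : ℕ) : ℝ :=
  - ∑' g : G, convPow μ n g * Real.log (convPow μ n g)

/-- `h` is the asymptotic entropy of the walk. -/
def HasEntropy (μ : G → ℝ) (h : ℝ) : Prop :=
  Tendsto (fun n : ℕ => entropyAt μ n / n) atTop (𝓝 h)

/-- `v` is the logarithmic volume growth of `(G,d)` (seen from the identity). -/
def HasGrowth (d : G → G → ℝ) (v : ℝ) : Prop :=
  Filter.limsup (fun R : ℝ => Real.log (Nat.card {g : G // d 1 g ≤ R}) / R) atTop = v

/-- The position `Z_n = ω_0 ω_1 ⋯ ω_{n-1}` of the random walk at time `n`, given the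
sequence of increments `ω`. -/
def walkPos (n : ℕ) (ω : ℕ → G) : G := ((List.range n).map ω).prod

/-- `P` is the law on the space of increment sequences of an i.i.d. sequence of law `μ`:
cylinders have product measure.  (This characterizes the path measure of the random walk.) -/
def IsWalkMeasure [MeasurableSpace G] (μ : G → ℝ) (P : Measure (ℕ → G)) : Prop :=
  IsProbabilityMeasure P ∧
    ∀ (n : ℕ) (g : Fin n → G),
      P {ω : ℕ → G | ∀ i : Fin n, ω (i : ℕ) = g i} = ∏ i : Fin n, ENNReal.ofReal (μ (g i))

/-! ### The Gromov boundary, visual metrics, harmonic and quasiconformal measures -/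

/-- A sequence tends to infinity if Gromov products (at the base point `1`) go to `∞`. -/
def TendstoInfinity (d : G → G → ℝ) (u : ℕ → G) : Prop :=
  Tendsto (fun p : ℕ × ℕ => gromov d 1 (u p.1) (u p.2)) atTop atTop

/-- A realization of the Gromov boundary of `(G,d)` as an abstract type `B`:
`conv u b` means that the sequence `u` converges at infinity to the boundary point `b`.
The group acts on its boundary by `smul`. -/
structure BoundaryData (G : Type*) [Group G] (d : G → G → ℝ) (B : Type*) where
  conv : (ℕ → G) → B → Prop
  smul : G → B → B
  conv_unique : ∀ u b b', conv u b → conv u b' → b = b'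
  exists_conv : ∀ u, TendstoInfinity d u → ∃ b, conv u b
  conv_tendstoInfinity : ∀ u b, conv u b → TendstoInfinity d u
  conv_iff : ∀ u v b, conv u b →
    (conv v b ↔ Tendsto (fun n => gromov d 1 (u n) (v n)) atTop atTop)
  conv_surj : ∀ b, ∃ u, conv u b
  smul_conv : ∀ (γ : G) (u) (b), conv u b → conv (fun n => γ * u n) (smul γ b)

/-- Asymptotic Gromov product of two sequences. -/
def seqGromov (d : G → G → ℝ) (u v : ℕ → G) : ℝ :=
  Filter.liminf (fun n => gromov d 1 (u n) (v n)) atTop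

/-- The metric of `B` is a visual metric of parameter `ε` (with comparison constant `C`)
for the hyperbolic distance `d` on the group:  `dist(a,b) ≍ exp(-ε (a|b))`. -/
def IsVisualMetric {B : Type*} [MetricSpace B] (d : G → G → ℝ)
    (bd : BoundaryData G d B) (ε C : ℝ) : Prop :=
  0 < ε ∧ 0 < C ∧
    ∀ u v b b', bd.conv u b → bd.conv v b' → b ≠ b' →
      dist b b' ≤ C * Real.exp (-ε * seqGromov d u v) ∧
      Real.exp (-ε * seqGromov d u v) ≤ C * dist b b'

/-- `ν` is the harmonic measure of the random walk of law `μ` on the boundary `B`: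
it is the law of the almost sure limit `Z_∞` of the walk on the boundary. -/
def IsHarmonicMeasure {B : Type*} [MeasurableSpace G] [MeasurableSpace B]
    (d : G → G → ℝ) (bd : BoundaryData G d B) (μ : G → ℝ)
    (P : Measure (ℕ → G)) (ν : Measure B) : Prop :=
  IsWalkMeasure μ P ∧
    ∃ Zinf : (ℕ → G) → B, Measurable Zinf ∧
      (∀ᵐ ω ∂P, bd.conv (fun n => walkPos n ω) (Zinf ω)) ∧ ν = P.map Zinf

/-- Busemann function `β_b(x,y)` of the boundary point `b`. -/
def busemann {B : Type*} (d : G → G → ℝ) (bd : BoundaryData G d B)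
    (x y : G) (b : B) : ℝ :=
  sSup {t : ℝ | ∃ u, bd.conv u b ∧
    t = Filter.limsup (fun n => d x (u n) - d y (u n)) atTop}

/-- The image measure `γ^*ρ`, `γ^*ρ(A) = ρ(γA)`. -/
def actPush {B : Type*} [MeasurableSpace B] {d : G → G → ℝ}
    (bd : BoundaryData G d B) (γ : G) (ρ : Measure B) : Measure B :=
  ρ.map (bd.smul γ⁻¹)

/-- `ρ` is a quasiconformal measure on the boundary for `(G,d)` of logarithmic growth
parameter `v`: `γ^*ρ` and `ρ` are mutually absolutely continuous, with density
`dγ^*ρ/dρ ≍ exp (v β_b(1,γ⁻¹))` (uniformly in `γ`). -/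
def IsQuasiconformalMeasure {B : Type*} [MeasurableSpace B] {d : G → G → ℝ}
    (bd : BoundaryData G d B) (ρ : Measure B) (v : ℝ) : Prop :=
  ∃ C : ℝ, 0 < C ∧ ∀ γ : G,
    actPush bd γ ρ ≪ ρ ∧ ρ ≪ actPush bd γ ρ ∧
      ∀ᵐ b ∂ρ,
        (actPush bd γ ρ).rnDeriv ρ b
            ≤ ENNReal.ofReal (C * Real.exp (v * busemann d bd 1 γ⁻¹ b)) ∧
        ENNReal.ofReal (C⁻¹ * Real.exp (v * busemann d bd 1 γ⁻¹ b))
            ≤ (actPush bd γ ρ).rnDeriv ρ b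

/-- `ν` is Ahlfors regular of dimension `α`: `ν(B(b,r)) ≍ r^α`. -/
def AhlforsRegularOfDim {B : Type*} [MetricSpace B] [MeasurableSpace B]
    (ν : Measure B) (α : ℝ) : Prop :=
  ∃ C : ℝ, 0 < C ∧ ∀ (b : B) (r : ℝ), 0 < r → r ≤ Metric.diam (Set.univ : Set B) →
    ENNReal.ofReal (C⁻¹ * r ^ α) ≤ ν (Metric.ball b r) ∧
      ν (Metric.ball b r) ≤ ENNReal.ofReal (C * r ^ α)

/-- The Hausdorff dimension of a measure: the infimum of the Hausdorff dimensions of sets of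
full measure. -/
def measureDim {B : Type*} [EMetricSpace B] [MeasurableSpace B] (ν : Measure B) : ℝ≥0∞ :=
  ⨅ (A : Set B) (_ : ν Aᶜ = 0), dimH A

/-! ### Word geodesics -/

/-- `p 0, …, p n` is a geodesic segment for the word metric of `S`. -/
def IsWordGeodesic (S : Finset G) (n : ℕ) (p : ℕ → G) : Prop :=
  ∀ i j : ℕ, i ≤ n → j ≤ n → wordDist S (p i) (p j) = |(i : ℝ) - (j : ℝ)|

/-- `v` lies within distance `r` of some word geodesic segment from `x` to `y`. -/
def NearWordGeodesic (S : Finset G) (x y v : G) (r : ℝ) : Prop :=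
  ∃ (n : ℕ) (p : ℕ → G), IsWordGeodesic S n p ∧ p 0 = x ∧ p n = y ∧
    ∃ i ≤ n, wordDist S v (p i) ≤ r

/-! ### Martin boundary -/

/-- The Martin kernel `K(x,y) = G(x,y)/G(e,y)`. -/
def martinKernel (μ : G → ℝ) (x y : G) : ℝ := greenFn μ x y / greenFn μ 1 y

/-- The embedding `y ↦ K(·,y)` of the group in `C(G)` (pointwise topology). -/
def martinMap (μ : G → ℝ) (y : G) : G → ℝ := fun x => martinKernel μ x y

/-- The Martin boundary: the boundary of the image of the group under the Martin embedding
in the space of functions with the topology of pointwise convergence. -/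
def martinBoundary (μ : G → ℝ) : Set (G → ℝ) :=
  closure (Set.range (martinMap μ)) \ Set.range (martinMap μ)

/-- `h` is a `μ`-harmonic function. -/
def IsHarmonicFn (μ : G → ℝ) (h : G → ℝ) : Prop :=
  ∀ x : G, h x = ∑' y : G, h y * μ (x⁻¹ * y)

/-- `h` is a minimal positive harmonic function. -/
def IsMinimalHarmonic (μ : G → ℝ) (h : G → ℝ) : Prop :=
  IsHarmonicFn μ h ∧ (∀ x, 0 < h x) ∧
    ∀ u : G → ℝ, IsHarmonicFn μ u → (∀ x, 0 ≤ u x) → (∀ x, u x ≤ h x) →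
      ∃ c : ℝ, u = fun x => c * h x

/-! ### Metric space versions (geodesic and quasiruled spaces) -/

/-- A geodesic metric space. -/
def IsGeodesicSpace (X : Type*) [MetricSpace X] : Prop :=
  ∀ x y : X, ∃ f : ℝ → X, f 0 = x ∧ f (dist x y) = y ∧
    ∀ s ∈ Set.Icc (0:ℝ) (dist x y), ∀ t ∈ Set.Icc (0:ℝ) (dist x y),
      dist (f s) (f t) = |s - t|

/-- `f : [a,b] → Y` is a `(Λ,c)`-quasigeodesic segment. -/
def IsQuasigeodesicOn {Y : Type*} [MetricSpace Y] (f : ℝ → Y) (a b Λ c : ℝ) : Prop :=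
  ∀ s ∈ Set.Icc a b, ∀ t ∈ Set.Icc a b,
    |s - t| / Λ - c ≤ dist (f s) (f t) ∧ dist (f s) (f t) ≤ Λ * |s - t| + c

/-- `f : [a,b] → Y` is a `τ`-quasiruler: Gromov products of triples along it are `≤ τ`. -/
def IsQuasirulerOn {Y : Type*} [MetricSpace Y] (f : ℝ → Y) (a b τ : ℝ) : Prop :=
  ∀ s t u : ℝ, s ∈ Set.Icc a b → t ∈ Set.Icc a b → u ∈ Set.Icc a b → s ≤ t → t ≤ u →
    dist (f s) (f t) + dist (f t) (f u) ≤ dist (f s) (f u) + 2 * τ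

/-- A quasiruled metric space: for some constants `(Λ,c,τ)` every pair of points is joined
by a `(Λ,c)`-quasigeodesic, and every `(Λ,c)`-quasigeodesic is a `τ`-quasiruler. -/
def Quasiruled (Y : Type*) [MetricSpace Y] : Prop :=
  ∃ Λ c τ : ℝ, 1 ≤ Λ ∧ 0 ≤ c ∧ 0 ≤ τ ∧
    (∀ x y : Y, ∃ (a b : ℝ) (f : ℝ → Y), a ≤ b ∧ f a = x ∧ f b = y ∧
      IsQuasigeodesicOn f a b Λ c) ∧
    ∀ (f : ℝ → Y) (a b : ℝ), IsQuasigeodesicOn f a b Λ c → IsQuasirulerOn f a b τ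

/-- A metric space is hyperbolic. -/
def HypSpace (Y : Type*) [MetricSpace Y] : Prop :=
  IsHyperbolic (fun x y : Y => dist x y)

/-- `f` is a quasi-isometry between metric spaces. -/
def MetricQI {X Y : Type*} [MetricSpace X] [MetricSpace Y] (f : X → Y) : Prop :=
  ∃ Λ c C : ℝ, 1 ≤ Λ ∧ 0 ≤ c ∧ 0 ≤ C ∧
    QIEmbed (fun a b : X => dist a b) (fun a b : Y => dist a b) f Λ c ∧
    ∀ y : Y, ∃ x : X, dist (f x) y ≤ C


/-! ## M1 -/
theorem wl_le_of_list {S : Finset G} (l : List G) (h : ∀ a ∈ l, a ∈ S ∨ a⁻¹ ∈ S) :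
    wordLength S l.prod ≤ l.length := Nat.sInf_le ⟨l, rfl, h, rfl⟩

theorem wl_list_nonempty {S : Finset G} (hS : Generates S) (g : G) :
    ∃ l : List G, (∀ a ∈ l, a ∈ S ∨ a⁻¹ ∈ S) ∧ l.prod = g := by
  have : g ∈ Subgroup.closure (S : Set G) := by rw [hS]; trivial
  induction this using Subgroup.closure_induction with
  | mem x hx => exact ⟨[x], by simpa using Or.inl hx, by simp⟩
  | one => exact ⟨[], by simp, by simp⟩
  | mul x y _ _ hx hy =>
    obtain ⟨l, hl, rfl⟩ := hx
    obtain ⟨m, hm, rfl⟩ := hy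
    refine ⟨l ++ m, ?_, by simp⟩
    intro a ha
    rcases List.mem_append.1 ha with h | h
    · exact hl a h
    · exact hm a h
  | inv x _ hx =>
    obtain ⟨l, hl, rfl⟩ := hx
    refine ⟨(l.map (fun a => a⁻¹)).reverse, ?_, by rw [List.prod_inv_reverse]⟩
    intro a ha
    simp only [List.mem_reverse, List.mem_map] at ha
    obtain ⟨b, hb, rfl⟩ := ha
    rw [inv_inv]
    exact (hl b hb).symm

theorem wl_exists {S : Finset G} (hS : Generates S) (g : G) :
    ∃ l : List G, l.length = wordLength S g ∧ (∀ a ∈ l, a ∈ S ∨ a⁻¹ ∈ S) ∧ l.prod = g := by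
  have : {n : ℕ | ∃ l : List G, l.length = n ∧ (∀ a ∈ l, a ∈ S ∨ a⁻¹ ∈ S) ∧ l.prod = g}.Nonempty := by
    obtain ⟨l, h1, h2⟩ := wl_list_nonempty hS g
    exact ⟨l.length, l, rfl, h1, h2⟩
  exact Nat.sInf_mem this

theorem wl_one (S : Finset G) : wordLength S (1 : G) = 0 := by
  have := wl_le_of_list (S := S) ([] : List G) (by simp)
  simpa using this

theorem wl_mul {S : Finset G} (hS : Generates S) (g h : G) :
    wordLength S (g * h) ≤ wordLength S g + wordLength S h := by
  obtain ⟨l, hl, hl2, hl3⟩ := wl_exists hS g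
  obtain ⟨m, hm, hm2, hm3⟩ := wl_exists hS h
  have := wl_le_of_list (S := S) (l ++ m) (by
    intro a ha
    rcases List.mem_append.1 ha with h | h
    · exact hl2 a h
    · exact hm2 a h)
  simpa [hl, hm, hl3, hm3] using this

theorem wl_inv_le {S : Finset G} (hS : Generates S) (g : G) :
    wordLength S g⁻¹ ≤ wordLength S g := by
  obtain ⟨l, hl, hl2, hl3⟩ := wl_exists hS g
  have := wl_le_of_list (S := S) (l.map (fun a => a⁻¹)).reverse (by
    intro a ha
    simp only [List.mem_reverse, List.mem_map] at ha
    obtain ⟨b, hb, rfl⟩ := ha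
    rw [inv_inv]
    exact (hl2 b hb).symm)
  rw [← List.prod_inv_reverse, hl3] at this
  simpa [hl] using this

theorem wl_inv {S : Finset G} (hS : Generates S) (g : G) :
    wordLength S g⁻¹ = wordLength S g :=
  le_antisymm (wl_inv_le hS g) (by simpa using wl_inv_le hS g⁻¹)

theorem wl_eq_zero {S : Finset G} (hS : Generates S) {g : G} (h : wordLength S g = 0) : g = 1 := by
  obtain ⟨l, hl, hl2, hl3⟩ := wl_exists hS g
  rw [h, List.length_eq_zero_iff] at hl
  subst hl
  simpa using hl3.symm

/-- word distance in ℕ -/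
def wd (S : Finset G) (x y : G) : ℕ := wordLength S (x⁻¹ * y)

theorem wd_tri {S : Finset G} (hS : Generates S) (x y z : G) : wd S x z ≤ wd S x y + wd S y z := by
  have := wl_mul hS (x⁻¹ * y) (y⁻¹ * z)
  simpa [wd, mul_assoc] using this

theorem wd_comm {S : Finset G} (hS : Generates S) (x y : G) : wd S x y = wd S y x := by
  have := wl_inv hS (x⁻¹ * y)
  simp only [mul_inv_rev, inv_inv] at this
  exact this.symm

theorem wd_self (S : Finset G) (x : G) : wd S x x = 0 := by simp [wd, wl_one]

theorem wd_left (S : Finset G) (g x y : G) : wd S (g * x) (g * y) = wd S x y := by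
  simp [wd, mul_assoc]

theorem wd_one_left (S : Finset G) (x : G) : wd S 1 x = wordLength S x := by simp [wd]

theorem wd_one_right {S : Finset G} (hS : Generates S) (x : G) : wd S x 1 = wordLength S x := by
  simp [wd, wl_inv hS]

theorem exists_geod {S : Finset G} (hS : Generates S) (g : G) :
    ∃ γ : ℕ → G, γ 0 = 1 ∧ γ (wordLength S g) = g ∧
      ∀ i j, i ≤ j → j ≤ wordLength S g → wd S (γ i) (γ j) = j - i := by
  obtain ⟨l, hl, hl2, hl3⟩ := wl_exists hS g
  have key : ∀ i j, i ≤ j → j ≤ wordLength S g → wd S (l.take i).prod (l.take j).prod ≤ j - i := by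
    intro i j hij hj
    have h1 : (l.take i).prod * ((l.take j).drop i).prod = (l.take j).prod := by
      have := List.prod_take_mul_prod_drop (l.take j) i
      rwa [List.take_take, min_eq_left hij] at this
    have h2 : (l.take i).prod⁻¹ * (l.take j).prod = ((l.take j).drop i).prod := by
      rw [← h1]; group
    unfold wd
    rw [h2]
    refine (wl_le_of_list _ ?_).trans ?_
    · intro a ha
      exact hl2 a (List.mem_of_mem_take (List.mem_of_mem_drop ha))
    · simp [hl]; omega
  have hg : (l.take (wordLength S g)).prod = g := by rw [← hl, List.take_length, hl3]
  refine ⟨fun i => (l.take i).prod, by simp, hg, ?_⟩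
  intro i j hij hj
  refine le_antisymm (key i j hij hj) ?_
  have a1 := key 0 i (Nat.zero_le _) (hij.trans hj)
  have a2 := key j _ hj le_rfl
  have t1 := wd_tri hS (l.take 0).prod (l.take i).prod (l.take (wordLength S g)).prod
  have t2 := wd_tri hS (l.take i).prod (l.take j).prod (l.take (wordLength S g)).prod
  have e : wd S (l.take 0).prod (l.take (wordLength S g)).prod = wordLength S g := by
    rw [hg]; simp [wd]
  rw [e] at t1
  change j - i ≤ wd S (l.take i).prod (l.take j).prod
  omega

theorem exists_split {S : Finset G} (hS : Generates S) (g : G) {n : ℕ} (hn : n ≤ wordLength S g) :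
    ∃ h k : G, g = h * k ∧ wordLength S h = n ∧ wordLength S k = wordLength S g - n := by
  obtain ⟨γ, h0, h1, h2⟩ := exists_geod hS g
  refine ⟨γ n, (γ n)⁻¹ * g, by group, ?_, ?_⟩
  · have := h2 0 n (Nat.zero_le _) hn
    simpa [wd, h0] using this
  · have := h2 n _ hn le_rfl
    rwa [h1] at this

open scoped Classical in
def blAux (S : Finset G) : ℕ → Finset G
  | 0 => {1}
  | n + 1 => Finset.image₂ (fun a b => a * b) (blAux S n) (insert 1 (S ∪ S.image (fun a => a⁻¹)))

def growthD (S : Finset G) : ℕ := by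
  classical exact (insert 1 (S ∪ S.image (fun a => a⁻¹))).card

theorem growthD_pos (S : Finset G) : 1 ≤ growthD S := by
  classical
  unfold growthD
  exact Finset.card_pos.2 ⟨1, Finset.mem_insert_self _ _⟩

theorem blAux_card (S : Finset G) (n : ℕ) : (blAux S n).card ≤ growthD S ^ n := by
  classical
  induction n with
  | zero => simp [blAux]
  | succ n ih =>
    rw [blAux, pow_succ]
    refine (Finset.card_image₂_le _ _ _).trans ?_
    have : (insert 1 (S ∪ S.image (fun a => a⁻¹))).card = growthD S := by
      unfold growthD; congr!
    exact Nat.mul_le_mul ih this.le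

theorem mem_blAux {S : Finset G} (hS : Generates S) (n : ℕ) (g : G) (h : wordLength S g ≤ n) :
    g ∈ blAux S n := by
  classical
  induction n generalizing g with
  | zero =>
    have := wl_eq_zero hS (Nat.le_zero.1 h)
    simp [blAux, this]
  | succ n ih =>
    rw [blAux, Finset.mem_image₂]
    rcases Nat.lt_or_ge n (wordLength S g) with hlt | hle
    · obtain ⟨a, b, hab, ha, hb⟩ := exists_split hS g (n := n) (by omega)
      have hb1 : wordLength S b = 1 := by omega
      obtain ⟨l, hl, hl2, hl3⟩ := wl_exists hS b
      rw [hb1, List.length_eq_one_iff] at hl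
      obtain ⟨s, rfl⟩ := hl
      refine ⟨a, ih a ha.le, b, ?_, hab.symm⟩
      simp only [List.prod_singleton] at hl3
      subst hl3
      have := hl2 s (by simp)
      rw [Finset.mem_insert, Finset.mem_union, Finset.mem_image]
      rcases this with h | h
      · exact Or.inr (Or.inl h)
      · exact Or.inr (Or.inr ⟨_, h, inv_inv s⟩)
    · exact ⟨g, ih g hle, 1, by simp, by simp⟩

open scoped Classical in
/-- ball of radius n as a finset -/
def ball (S : Finset G) (n : ℕ) : Finset G := (blAux S n).filter (fun g => wordLength S g ≤ n)

theorem mem_ball {S : Finset G} (hS : Generates S) {n : ℕ} {g : G} :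
    g ∈ ball S n ↔ wordLength S g ≤ n := by
  classical
  unfold ball
  rw [Finset.mem_filter]
  exact ⟨fun h => h.2, fun h => ⟨mem_blAux hS n g h, h⟩⟩

theorem card_ball (S : Finset G) (n : ℕ) : (ball S n).card ≤ growthD S ^ n :=
  (Finset.card_filter_le _ _).trans (blAux_card S n)

theorem exists_len [Infinite G] {S : Finset G} (hS : Generates S) (n : ℕ) :
    ∃ g : G, wordLength S g = n := by
  obtain ⟨g, hg⟩ := Infinite.exists_notMem_finset (ball S n)
  rw [mem_ball hS] at hg
  obtain ⟨h, k, -, hh, -⟩ := exists_split hS g (n := n) (by omega)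
  exact ⟨h, hh⟩

/-! real lengths and Gromov products -/
def len (S : Finset G) (g : G) : ℝ := wordLength S g

def gp (S : Finset G) (x y : G) : ℝ := (len S x + len S y - len S (x⁻¹ * y)) / 2

theorem len_nonneg (S : Finset G) (g : G) : 0 ≤ len S g := Nat.cast_nonneg _
theorem len_one (S : Finset G) : len S 1 = 0 := by simp [len, wl_one]
theorem len_inv {S : Finset G} (hS : Generates S) (g : G) : len S g⁻¹ = len S g := by
  simp [len, wl_inv hS]
theorem len_mul {S : Finset G} (hS : Generates S) (g h : G) : len S (g * h) ≤ len S g + len S h := by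
  unfold len; exact_mod_cast wl_mul hS g h
theorem len_wd (S : Finset G) (x y : G) : len S (x⁻¹ * y) = (wd S x y : ℝ) := rfl

theorem len_tri {S : Finset G} (hS : Generates S) (x y z : G) :
    len S (x⁻¹ * z) ≤ len S (x⁻¹ * y) + len S (y⁻¹ * z) := by
  simpa [mul_assoc] using len_mul hS (x⁻¹ * y) (y⁻¹ * z)

theorem len_swap {S : Finset G} (hS : Generates S) (x y : G) :
    len S (x⁻¹ * y) = len S (y⁻¹ * x) := by
  rw [← len_inv hS]; simp

theorem gp_comm {S : Finset G} (hS : Generates S) (x y : G) : gp S x y = gp S y x := by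
  unfold gp; rw [len_swap hS x y]; ring

theorem gp_nonneg {S : Finset G} (hS : Generates S) (x y : G) : 0 ≤ gp S x y := by
  unfold gp
  have := len_mul hS x⁻¹ y
  rw [len_inv hS] at this
  linarith

theorem gp_le_left {S : Finset G} (hS : Generates S) (x y : G) : gp S x y ≤ len S x := by
  unfold gp
  have := len_mul hS x (x⁻¹ * y)
  rw [mul_inv_cancel_left] at this
  linarith

theorem gp_le_right {S : Finset G} (hS : Generates S) (x y : G) : gp S x y ≤ len S y := by
  rw [gp_comm hS]; exact gp_le_left hS y x

theorem gp_self (S : Finset G) (x : G) : gp S x x = len S x := by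
  unfold gp; rw [inv_mul_cancel, len_one]; ring

theorem gp_one_left {S : Finset G} (hS : Generates S) (x : G) : gp S 1 x = 0 := by
  have := gp_le_left hS 1 x
  rw [len_one] at this
  exact le_antisymm this (gp_nonneg hS _ _)

theorem gp_ident {S : Finset G} (hS : Generates S) (y w : G) :
    gp S y (y * w) + gp S y⁻¹ w = len S y := by
  unfold gp
  rw [inv_mul_cancel_left, inv_inv, len_inv hS]; ring

theorem gp_lip {S : Finset G} (hS : Generates S) (x y y' : G) :
    gp S x y ≤ gp S x y' + len S (y⁻¹ * y') := by
  unfold gp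
  have h1 := len_tri hS x y y'
  have h2 := len_mul hS y' (y'⁻¹ * y)
  rw [mul_inv_cancel_left, len_swap hS y' y] at h2
  linarith

theorem gp_gromov {S : Finset G} (hS : Generates S) (w x y : G) :
    gromov (wordDist S) w x y = gp S (w⁻¹ * x) (w⁻¹ * y) := by
  unfold gromov gp wordDist
  have h1 := len_swap hS x w
  have h2 := len_swap hS y w
  simp only [len] at *
  rw [h1, h2]
  simp [mul_assoc]

theorem gp_gromov_one {S : Finset G} (hS : Generates S) (x y : G) :
    gromov (wordDist S) 1 x y = gp S x y := by
  rw [gp_gromov hS]; simp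

/-- hyperbolic geometry data -/
structure Geo (S : Finset G) (δ : ℕ) : Prop where
  gen : Generates S
  one_le : 1 ≤ δ
  hyp : ∀ x y z : G, min (gp S x y) (gp S y z) ≤ gp S x z + δ

theorem exists_geo {S : Finset G} (hS : Generates S) (h : IsHyperbolic (wordDist S)) :
    ∃ δ : ℕ, Geo S δ := by
  obtain ⟨δ, h0, h1⟩ := h
  refine ⟨⌈δ⌉₊ + 1, hS, by omega, ?_⟩
  intro x y z
  have := h1 1 y x z
  rw [gp_gromov_one hS, gp_gromov_one hS, gp_gromov_one hS, gp_comm hS y x] at this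
  have h2 := Nat.le_ceil δ
  push_cast
  linarith

/-- If the distances along a path behave additively the Gromov products decrease. -/
theorem gp_trunc {S : Finset G} (hS : Generates S) (x h k : G)
    (hk : len S (h * k) = len S h + len S k) : gp S x h ≤ gp S x (h * k) := by
  unfold gp
  have := len_mul hS (x⁻¹ * h) k
  rw [mul_assoc] at this
  linarith

/-! ## M2 -/
theorem exists_line [Infinite G] {S : Finset G} (hS : Generates S) :
    ∃ γ : ℤ → G, ∀ i j : ℤ, wd S (γ i) (γ j) = (i - j).natAbs := by
  classical
  have h1 : ∀ n : ℕ, ∃ β : ℕ → G, ∀ i j, i ≤ j → j ≤ 2 * n → wd S (β i) (β j) = j - i := by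
    intro n
    obtain ⟨g, hg⟩ := exists_len hS (2 * n)
    obtain ⟨β, -, -, h⟩ := exists_geod hS g
    rw [hg] at h
    exact ⟨β, h⟩
  choose β hβ using h1
  let ln : ℕ → ℤ → G := fun n i => (β n n)⁻¹ * β n ((n : ℤ) + i).toNat
  have hln : ∀ n : ℕ, ∀ i j : ℤ, i.natAbs ≤ n → j.natAbs ≤ n →
      wd S (ln n i) (ln n j) = (i - j).natAbs := by
    intro n i j hi hj
    simp only [ln]
    rw [wd_left]
    rcases le_total i j with h | h
    · rw [hβ n _ _ (by omega) (by omega)]; omega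
    · rw [wd_comm hS, hβ n _ _ (by omega) (by omega)]; omega
  let U : Ultrafilter ℕ := Filter.hyperfilter ℕ
  have hU : ∀ k : ℕ, ∀ᶠ n in (U : Filter ℕ), k ≤ n := by
    intro k
    have : (U : Filter ℕ) ≤ atTop := by
      rw [← Nat.cofinite_eq_atTop]; exact Filter.hyperfilter_le_cofinite
    exact this (eventually_ge_atTop k)
  have h0 : ∀ n, ln n 0 = 1 := by intro n; simp [ln]
  have h2 : ∀ i : ℤ, ∃ v : G, ∀ᶠ n in (U : Filter ℕ), ln n i = v := by
    intro i
    have h3 : ∀ᶠ n in (U : Filter ℕ), ln n i ∈ ball S i.natAbs := by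
      filter_upwards [hU i.natAbs] with n hn
      rw [mem_ball hS]
      have := hln n 0 i (by simp) hn
      rw [h0, wd_one_left] at this
      omega
    have h4 : (⋃ v ∈ (ball S i.natAbs : Set G), {n | ln n i = v}) ∈ U := by
      filter_upwards [h3] with n hn
      simpa using hn
    rw [Ultrafilter.finite_biUnion_mem_iff (Finset.finite_toSet _)] at h4
    obtain ⟨v, -, hv⟩ := h4
    exact ⟨v, hv⟩
  choose γ hγ using h2
  refine ⟨γ, fun i j => ?_⟩
  obtain ⟨n, a1, a2, a3, a4⟩ :=
    ((hγ i).and ((hγ j).and ((hU i.natAbs).and (hU j.natAbs)))).exists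
  rw [← a1, ← a2]
  exact hln n i j a3 a4

theorem exists_tripod [Infinite G] {S : Finset G} {δ : ℕ} (hg : Geo S δ)
    (hq : ¬ QuasiIsometric (wordDist S) intDist) (L : ℕ) :
    ∃ t : Fin 3 → G, (∀ i, wordLength S (t i) = L) ∧
      ∀ i j, i ≠ j → gp S (t i) (t j) ≤ 2 * δ + 1 := by
  by_contra hno
  apply hq
  have hS := hg.gen
  obtain ⟨γ, hγ⟩ := exists_line hS
  have hmin : ∀ x : G, ∃ i : ℤ, ∀ j, wd S (γ i) x ≤ wd S (γ j) x := by
    intro x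
    obtain ⟨i, hi⟩ := Nat.sInf_mem (Set.range_nonempty (fun i => wd S (γ i) x))
    refine ⟨i, fun j => ?_⟩
    simp only at hi
    rw [hi]
    exact Nat.sInf_le ⟨j, rfl⟩
  choose f hf using hmin
  have key : ∀ x : G, ∀ m : ℤ, gp S ((γ (f x))⁻¹ * γ (f x + m)) ((γ (f x))⁻¹ * x) ≤ 2 * δ + 1 := by
    intro x m
    by_contra hlt
    push Not at hlt
    set a := (γ (f x))⁻¹ * γ (f x + m) with ha
    set b := (γ (f x))⁻¹ * x with hb
    have la : len S a = m.natAbs := by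
      have := hγ (f x) (f x + m)
      rw [ha, len_wd, this]
      congr 1; omega
    have hsle : gp S a b ≤ m.natAbs := by rw [← la]; exact gp_le_left hS a b
    have hs0 : 0 ≤ gp S a b := gp_nonneg hS _ _
    set k := ⌊gp S a b⌋₊ with hk
    have hkm : k ≤ m.natAbs := by
      have := Nat.floor_le hs0
      exact_mod_cast this.trans hsle
    have hk2 : 2 * δ + 1 ≤ k := Nat.le_floor (by push_cast; linarith)
    set e := (γ (f x))⁻¹ * γ (f x + m.sign * k) with he
    have hsg : (m.sign * k).natAbs = k := by
      rcases lt_trichotomy m 0 with h | h | h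
      · rw [Int.sign_eq_neg_one_of_neg h]; omega
      · subst h; simp at hkm; simp; omega
      · rw [Int.sign_eq_one_of_pos h]; omega
    have le' : len S e = k := by
      have := hγ (f x) (f x + m.sign * k)
      rw [he, len_wd, this]
      congr 1; omega
    have lea : len S (e⁻¹ * a) = (m.natAbs : ℝ) - k := by
      have := hγ (f x + m.sign * k) (f x + m)
      have e1 : e⁻¹ * a = (γ (f x + m.sign * k))⁻¹ * γ (f x + m) := by rw [he, ha]; group
      rw [e1, len_wd, this, ← Nat.cast_sub hkm]
      congr 1
      rcases lt_trichotomy m 0 with h | h | h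
      · rw [Int.sign_eq_neg_one_of_neg h]; omega
      · subst h; simp at hkm; omega
      · rw [Int.sign_eq_one_of_pos h]; omega
    have gea : gp S e a = k := by
      unfold gp; rw [le', la, lea]; ring
    have h1 := hg.hyp e a b
    rw [gea, min_eq_left (Nat.floor_le hs0)] at h1
    have h2 : len S b ≤ len S (e⁻¹ * b) := by
      have := hf x (f x + m.sign * k)
      have e1 : e⁻¹ * b = (γ (f x + m.sign * k))⁻¹ * x := by rw [he, hb]; group
      rw [e1, hb, len_wd, len_wd]
      exact_mod_cast this
    have h3 : gp S e b = (k + len S b - len S (e⁻¹ * b)) / 2 := by unfold gp; rw [le']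
    have h4 : (2 * δ + 1 : ℝ) ≤ k := by exact_mod_cast hk2
    linarith
  have hD : ∀ x, wd S (γ (f x)) x ≤ L := by
    intro x
    by_contra hlt
    push Not at hlt
    apply hno
    obtain ⟨t, k, hb, ht, hk⟩ := exists_split hS ((γ (f x))⁻¹ * x) (n := L) hlt.le
    have hadd : len S (t * k) = len S t + len S k := by
      rw [← hb]; unfold len; rw [ht, hk]
      rw [← Nat.cast_add]; congr 1
      have : L < wordLength S ((γ (f x))⁻¹ * x) := hlt
      omega
    have h13 : ∀ m : ℤ, gp S ((γ (f x))⁻¹ * γ (f x + m)) t ≤ 2 * δ + 1 := by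
      intro m
      refine (gp_trunc hS _ t k hadd).trans ?_
      rw [← hb]; exact key x m
    have hl : ∀ m : ℤ, wordLength S ((γ (f x))⁻¹ * γ (f x + m)) = m.natAbs := by
      intro m
      have := hγ (f x) (f x + m)
      unfold wd at this
      rw [this]; omega
    have h12 : gp S ((γ (f x))⁻¹ * γ (f x + (L : ℤ))) ((γ (f x))⁻¹ * γ (f x + (-(L : ℤ)))) ≤ 2 * δ + 1 := by
      have e1 : ((γ (f x))⁻¹ * γ (f x + (L : ℤ)))⁻¹ * ((γ (f x))⁻¹ * γ (f x + (-(L : ℤ)))) =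
        (γ (f x + (L : ℤ)))⁻¹ * γ (f x + (-(L : ℤ))) := by group
      have e2 := hγ (f x + (L : ℤ)) (f x + (-(L : ℤ)))
      have e3 : (f x + (L : ℤ) - (f x + (-(L : ℤ)))).natAbs = 2 * L := by omega
      rw [e3] at e2
      unfold gp
      rw [e1, len_wd S (γ (f x + (L : ℤ))), e2]
      unfold len
      rw [hl, hl]
      simp only [Int.natAbs_neg, Int.natAbs_natCast]
      push_cast
      have : (0 : ℝ) ≤ δ := Nat.cast_nonneg _
      linarith
    refine ⟨![(γ (f x))⁻¹ * γ (f x + (L : ℤ)), (γ (f x))⁻¹ * γ (f x + (-(L : ℤ))), t], ?_, ?_⟩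
    · intro i
      fin_cases i
      · simpa using hl L
      · simpa using hl (-L)
      · simpa using ht
    · intro i j hij
      fin_cases i <;> fin_cases j <;> first | exact absurd rfl hij | skip
      · exact h12
      · exact h13 _
      · exact (gp_comm hS _ _).trans_le h12
      · exact h13 _
      · exact (gp_comm hS _ _).trans_le (h13 _)
      · exact (gp_comm hS _ _).trans_le (h13 _)
  have hid : ∀ x y, intDist (f x) (f y) = (wd S (γ (f x)) (γ (f y)) : ℝ) := by
    intro x y
    rw [hγ]; unfold intDist
    rw [Nat.cast_natAbs]; push_cast; rfl
  refine ⟨f, 1, 2 * L, L, le_rfl, by positivity, by positivity, ?_, ?_⟩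
  · intro x y
    rw [hid]
    have d1 := hD x
    have d2 := hD y
    have t1 := wd_tri hS x (γ (f x)) y
    have t2 := wd_tri hS (γ (f x)) (γ (f y)) y
    have t3 := wd_tri hS (γ (f x)) x (γ (f y))
    have t4 := wd_tri hS x y (γ (f y))
    rw [wd_comm hS x (γ (f x))] at t1
    rw [wd_comm hS y (γ (f y))] at t4
    have hw : wordDist S x y = (wd S x y : ℝ) := rfl
    rw [hw]
    have A : wd S x y ≤ wd S (γ (f x)) (γ (f y)) + 2 * L := by omega
    have B : wd S (γ (f x)) (γ (f y)) ≤ wd S x y + 2 * L := by omega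
    have A' : (wd S x y : ℝ) ≤ wd S (γ (f x)) (γ (f y)) + 2 * L := by exact_mod_cast A
    have B' : (wd S (γ (f x)) (γ (f y)) : ℝ) ≤ wd S x y + 2 * L := by exact_mod_cast B
    constructor <;> linarith
  · intro i
    refine ⟨γ i, ?_⟩
    have := hD (γ i)
    rw [hγ] at this
    unfold intDist
    have e : |((f (γ i) : ℤ) : ℝ) - (i : ℝ)| = (((f (γ i)) - i).natAbs : ℝ) := by
      rw [Nat.cast_natAbs]; push_cast; rfl
    rw [e]; exact_mod_cast this

/-! ## M3 -/
set_option linter.unusedSectionVars false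
theorem many_good {S : Finset G} {δ : ℕ} (hg : Geo S δ)
    (htri : ∀ L : ℕ, ∃ t : Fin 3 → G, (∀ i, wordLength S (t i) = L) ∧
      ∀ i j, i ≠ j → gp S (t i) (t j) ≤ 2 * δ + 1) (k : ℕ) (y : G) :
    ∃ A : Finset G, 2 ^ k ≤ A.card ∧ ∀ a ∈ A, wordLength S a ≤ k * (8 * δ + 3) ∧
      gp S y a ≤ 4 * δ + 1 := by
  classical
  have hS := hg.gen
  induction k generalizing y with
  | zero =>
    refine ⟨{1}, by simp, ?_⟩
    intro a ha
    rw [Finset.mem_singleton] at ha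
    subst ha
    rw [wl_one, gp_comm hS, gp_one_left hS]
    exact ⟨Nat.zero_le _, by positivity⟩
  | succ k ih =>
    obtain ⟨t, ht, htt⟩ := htri (8 * δ + 3)
    have hlt : ∀ i, len S (t i) = 8 * δ + 3 := by intro i; unfold len; rw [ht]; push_cast; rfl
    have h2 : ∃ i j, i ≠ j ∧ gp S y (t i) ≤ 3 * δ + 1 ∧ gp S y (t j) ≤ 3 * δ + 1 := by
      have hx : ∀ i j, i ≠ j → gp S y (t i) ≤ 3 * δ + 1 ∨ gp S y (t j) ≤ 3 * δ + 1 := by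
        intro i j hij
        by_contra hh
        push Not at hh
        have := hg.hyp (t i) y (t j)
        rw [gp_comm hS (t i) y] at this
        have h3 := lt_min hh.1 hh.2
        have := htt i j hij
        linarith
      rcases hx 0 1 (by decide) with h | h
      · rcases hx 1 2 (by decide) with h' | h'
        · exact ⟨0, 1, by decide, h, h'⟩
        · exact ⟨0, 2, by decide, h, h'⟩
      · rcases hx 0 2 (by decide) with h' | h'
        · exact ⟨1, 0, by decide, h, h'⟩
        · exact ⟨1, 2, by decide, h, h'⟩
    obtain ⟨i, j, hij, hi, hj⟩ := h2
    have step : ∀ i, gp S y (t i) ≤ 3 * δ + 1 → ∃ A : Finset G, 2 ^ k ≤ A.card ∧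
        ∀ a ∈ A, wordLength S a ≤ (k + 1) * (8 * δ + 3) ∧ gp S y a ≤ 4 * δ + 1 ∧
          4 * δ + 2 ≤ gp S (t i) a := by
      intro i hi
      obtain ⟨A, hA, hA2⟩ := ih (t i)⁻¹
      refine ⟨A.image (fun b => t i * b), ?_, ?_⟩
      · rwa [Finset.card_image_of_injective _ (mul_right_injective _)]
      · intro a ha
        rw [Finset.mem_image] at ha
        obtain ⟨b, hb, rfl⟩ := ha
        obtain ⟨h1, h2⟩ := hA2 b hb
        have h3 := gp_ident hS (t i) b
        rw [hlt] at h3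
        have h4 : (4 * δ + 2 : ℝ) ≤ gp S (t i) (t i * b) := by linarith
        refine ⟨?_, ?_, h4⟩
        · have := wl_mul hS (t i) b
          rw [ht] at this
          linarith
        · have h5 := hg.hyp y (t i * b) (t i)
          rw [gp_comm hS (t i * b)] at h5
          by_contra h6
          push Not at h6
          have : (4 * δ + 1 : ℝ) < min (gp S y (t i * b)) (gp S (t i) (t i * b)) :=
            lt_min h6 (by linarith)
          linarith
    obtain ⟨A, hA, hA2⟩ := step i hi
    obtain ⟨A', hA', hA2'⟩ := step j hj
    refine ⟨A ∪ A', ?_, ?_⟩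
    · rw [Finset.card_union_of_disjoint, pow_succ]
      · omega
      · rw [Finset.disjoint_left]
        intro a ha ha'
        have h1 := (hA2 a ha).2.2
        have h2 := (hA2' a ha').2.2
        have := hg.hyp (t i) a (t j)
        rw [gp_comm hS a] at this
        have h3 := le_min h1 h2
        have h4 := htt i j hij
        have : (0 : ℝ) ≤ δ := Nat.cast_nonneg _
        linarith
    · intro a ha
      rcases Finset.mem_union.1 ha with h | h
      · exact ⟨(hA2 a h).1, (hA2 a h).2.1⟩
      · exact ⟨(hA2' a h).1, (hA2' a h).2.1⟩

theorem mult_bound {S : Finset G} {δ : ℕ} (hg : Geo S δ) (k : ℕ) (A : G → Finset G)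
    (hA : ∀ y, ∀ a ∈ A y, wordLength S a ≤ k * (8 * δ + 3) ∧ gp S y a ≤ 4 * δ + 1)
    (F : Finset G) (z : G) [DecidablePred fun a => a ∈ A ((z * a⁻¹)⁻¹)] :
    (F.filter (fun a => a ∈ A ((z * a⁻¹)⁻¹))).card ≤
      (ball S (10 * δ + 2)).card * (k * (8 * δ + 3) + 8 * δ + 3) := by
  classical
  have hS := hg.gen
  set I := Finset.Icc (wordLength S z - k * (8 * δ + 3)) (wordLength S z + (8 * δ + 2)) with hI
  have key : ∀ a, a ∈ A ((z * a⁻¹)⁻¹) →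
      len S z = len S (z * a⁻¹) + len S a - 2 * gp S (z * a⁻¹)⁻¹ a ∧
      len S (z * a⁻¹) - (4 * δ + 1) ≤ gp S (z * a⁻¹) z := by
    intro a ha
    have h2 := (hA _ a ha).2
    have h3 := gp_ident hS (z * a⁻¹) a
    rw [inv_mul_cancel_right] at h3
    refine ⟨?_, by linarith⟩
    unfold gp
    rw [inv_inv, inv_mul_cancel_right, len_inv hS]; ring
  have h1 : (F.filter (fun a => a ∈ A ((z * a⁻¹)⁻¹))).card ≤
      (ball S (10 * δ + 2)).card * I.card := by
    refine Finset.card_le_mul_card_image_of_maps_to (f := fun a => wordLength S (z * a⁻¹)) ?_ _ ?_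
    · intro a ha
      rw [Finset.mem_filter] at ha
      obtain ⟨e1, e2⟩ := key a ha.2
      have e3 := hA _ a ha.2
      have e4 := gp_nonneg hS (z * a⁻¹)⁻¹ a
      rw [hI, Finset.mem_Icc]
      have e5 : len S a ≤ k * (8 * δ + 3) := by unfold len; exact_mod_cast e3.1
      have e6 := len_nonneg S a
      constructor
      · rw [tsub_le_iff_right]
        have : len S z ≤ len S (z * a⁻¹) + k * (8 * δ + 3) := by linarith
        unfold len at this; exact_mod_cast this
      · have : len S (z * a⁻¹) ≤ len S z + (8 * δ + 2) := by linarith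
        unfold len at this; exact_mod_cast this
    · intro m hm
      set Q := (F.filter (fun a => a ∈ A ((z * a⁻¹)⁻¹))).filter (fun a => wordLength S (z * a⁻¹) = m)
        with hQ
      rcases Q.eq_empty_or_nonempty with h | ⟨a0, ha0⟩
      · rw [h]; simp
      · refine Finset.card_le_card_of_injOn (fun a => (z * a0⁻¹)⁻¹ * (z * a⁻¹)) ?_ ?_
        · intro a ha
          have ha : a ∈ Q := ha
          rw [hQ, Finset.mem_filter, Finset.mem_filter] at ha ha0
          obtain ⟨-, e2⟩ := key a ha.1.2
          obtain ⟨-, f2⟩ := key a0 ha0.1.2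
          have l1 : len S (z * a⁻¹) = m := by unfold len; rw [ha.2]
          have l2 : len S (z * a0⁻¹) = m := by unfold len; rw [ha0.2]
          have h3 := hg.hyp (z * a0⁻¹) z (z * a⁻¹)
          rw [gp_comm hS z] at h3
          rw [l1] at e2
          rw [l2] at f2
          have h4 := le_min f2 e2
          have h5 : gp S (z * a0⁻¹) (z * a⁻¹) = (m + m - len S ((z * a0⁻¹)⁻¹ * (z * a⁻¹))) / 2 := by
            unfold gp; rw [l1, l2]
          rw [Finset.mem_coe, mem_ball hS]
          have h6 : len S ((z * a0⁻¹)⁻¹ * (z * a⁻¹)) ≤ 10 * δ + 2 := by linarith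
          unfold len at h6; exact_mod_cast h6
        · intro a _ b _ hab
          simpa using hab
  refine h1.trans (Nat.mul_le_mul le_rfl ?_)
  rw [hI, Nat.card_Icc]; omega

/-- finitely supported -/
def FS (f : G → ℝ) : Prop := (Function.support f).Finite

theorem FS.sm {f : G → ℝ} (h : FS f) : Summable f := summable_of_hasFiniteSupport h
theorem FS.map2 {f g : G → ℝ} (hf : FS f) (hg : FS g) (φ : ℝ → ℝ → ℝ) (h0 : φ 0 0 = 0) :
    FS (fun y => φ (f y) (g y)) := by
  refine (hf.union hg).subset ?_
  intro y hy
  by_contra h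
  simp only [Set.mem_union, Function.mem_support, not_or, not_not] at h
  apply hy
  simp only [h.1, h.2, h0]
theorem FS.map1 {f : G → ℝ} (hf : FS f) (φ : ℝ → ℝ) (h0 : φ 0 = 0) :
    FS (fun y => φ (f y)) := hf.map2 hf (fun a _ => φ a) h0
theorem FS.shift {f : G → ℝ} (hf : FS f) (a : G) : FS (fun y => f (y * a)) :=
  Set.Finite.preimage ((mul_left_injective a).injOn) hf

theorem tsum_shift (f : G → ℝ) (a : G) : ∑' y, f (y * a) = ∑' y, f y :=
  (Equiv.mulRight a).tsum_eq f

def sqn (f : G → ℝ) : ℝ := ∑' y, f y ^ 2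
def Ea (a : G) (f : G → ℝ) : ℝ := ∑' y, (f (y * a) - f y) ^ 2

theorem sqn_nonneg (f : G → ℝ) : 0 ≤ sqn f := tsum_nonneg fun _ => sq_nonneg _
theorem Ea_nonneg (a : G) (f : G → ℝ) : 0 ≤ Ea a f := tsum_nonneg fun _ => sq_nonneg _

theorem FS.Esm {f : G → ℝ} (hf : FS f) (a : G) : Summable (fun y => (f (y * a) - f y) ^ 2) :=
  ((hf.shift a).map2 hf (fun u v => (u - v) ^ 2) (by simp)).sm

theorem Ea_inv (a : G) (f : G → ℝ) : Ea a⁻¹ f = Ea a f := by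
  unfold Ea
  rw [← tsum_shift (fun y => (f (y * a⁻¹) - f y) ^ 2) a]
  refine tsum_congr fun y => ?_
  rw [mul_inv_cancel_right]; ring

theorem Ea_mul (a b : G) {f : G → ℝ} (hf : FS f) : Ea (a * b) f ≤ 2 * Ea a f + 2 * Ea b f := by
  have h1 : Ea b f = ∑' y, (f (y * a * b) - f (y * a)) ^ 2 :=
    (tsum_shift (fun y => (f (y * b) - f y) ^ 2) a).symm
  have s1 : Summable (fun y => (f (y * a * b) - f (y * a)) ^ 2) :=
    (((hf.shift b).shift a).map2 (hf.shift a) (fun u v => (u - v) ^ 2) (by simp)).sm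
  rw [h1]
  unfold Ea
  rw [← tsum_mul_left, ← tsum_mul_left, ← ((hf.Esm a).mul_left 2).tsum_add (s1.mul_left 2)]
  refine (hf.Esm _).tsum_le_tsum ?_ (((hf.Esm a).mul_left 2).add (s1.mul_left 2))
  intro y
  rw [← mul_assoc]
  nlinarith [sq_nonneg (f (y * a * b) - f (y * a) - (f (y * a) - f y))]

theorem exists_isop {S : Finset G} {δ : ℕ} (hg : Geo S δ)
    (htri : ∀ L : ℕ, ∃ t : Fin 3 → G, (∀ i, wordLength S (t i) = L) ∧
      ∀ i j, i ≠ j → gp S (t i) (t j) ≤ 2 * δ + 1) :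
    ∃ F : Finset G, F.Nonempty ∧ ∀ g : G → ℝ, FS g → (∀ y, 0 ≤ g y) →
      ∑' y, g y ≤ ∑ a ∈ F, ∑' y, |g (y * a) - g y| := by
  classical
  have hS := hg.gen
  set b := (ball S (10 * δ + 2)).card
  obtain ⟨k, hk⟩ : ∃ k : ℕ, 2 * (b * (k * (8 * δ + 3) + 8 * δ + 3)) ≤ 2 ^ k := by
    set j := 2 * b * (2 * (8 * δ + 3) + 8 * δ + 3)
    refine ⟨2 * j, ?_⟩
    have h1 : j + 1 ≤ 2 ^ j := Nat.lt_two_pow_self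
    have h2 : (j + 1) * (j + 1) ≤ 2 ^ (2 * j) := by
      rw [two_mul, pow_add]; exact Nat.mul_le_mul h1 h1
    refine le_trans ?_ h2
    have : 2 * j * (8 * δ + 3) + 8 * δ + 3 ≤ (2 * (8 * δ + 3) + 8 * δ + 3) * (j + 1) := by
      nlinarith [Nat.zero_le (j * δ), Nat.zero_le j]
    calc 2 * (b * (2 * j * (8 * δ + 3) + 8 * δ + 3))
        ≤ 2 * (b * ((2 * (8 * δ + 3) + 8 * δ + 3) * (j + 1))) := by gcongr
      _ = j * (j + 1) := by simp only [j]; ring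
      _ ≤ (j + 1) * (j + 1) := by gcongr; omega
  set M := b * (k * (8 * δ + 3) + 8 * δ + 3)
  have hM1 : 1 ≤ M := by
    have : 1 ≤ b := Finset.card_pos.2 ⟨1, by rw [mem_ball hS, wl_one]; omega⟩
    exact Nat.mul_pos this (by omega)
  choose A hA1 hA2 using many_good hg htri k
  set F := ball S (k * (8 * δ + 3))
  have hAF : ∀ y, A y ⊆ F := fun y a ha => (mem_ball hS).2 (hA2 y a ha).1
  refine ⟨F, ⟨1, by rw [mem_ball hS, wl_one]; omega⟩, fun g hgf hg0 => ?_⟩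
  let ι : G → G → ℝ := fun a y => if a ∈ A y⁻¹ then 1 else 0
  have hι0 : ∀ a y, 0 ≤ ι a y := by intro a y; simp only [ι]; split_ifs <;> norm_num
  have hι1 : ∀ a y, ι a y ≤ 1 := by intro a y; simp only [ι]; split_ifs <;> norm_num
  have hfs : ∀ (φ : G → ℝ) (f : G → ℝ), FS f → FS (fun y => φ y * f y) := by
    intro φ f hf
    refine hf.subset ?_
    intro y hy h
    apply hy
    simp [h]
  have hcard : ∀ y, ∑ a ∈ F, ι a y = (A y⁻¹).card := by
    intro y
    simp only [ι]
    rw [← Finset.sum_filter]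
    have : F.filter (fun a => a ∈ A y⁻¹) = A y⁻¹ := by
      ext a
      rw [Finset.mem_filter]
      exact ⟨fun h => h.2, fun h => ⟨hAF _ h, h⟩⟩
    rw [this]; simp
  have low : 2 * (M : ℝ) * ∑' y, g y ≤ ∑ a ∈ F, ∑' y, ι a y * g y := by
    rw [← Summable.tsum_finsetSum (fun a _ => (hfs (ι a) g hgf).sm), ← tsum_mul_left]
    refine (hgf.sm.mul_left _).tsum_le_tsum ?_ ?_
    · intro y
      rw [← Finset.sum_mul, hcard]
      gcongr
      · exact hg0 y
      · exact_mod_cast hk.trans (hA1 y⁻¹)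
    · exact summable_sum (fun a _ => (hfs (ι a) g hgf).sm)
  have upp : ∑ a ∈ F, ∑' y, ι a y * g (y * a) ≤ M * ∑' y, g y := by
    have e : ∀ a, ∑' y, ι a y * g (y * a) = ∑' z, ι a (z * a⁻¹) * g z := by
      intro a
      rw [← tsum_shift (fun z => ι a (z * a⁻¹) * g z) a]
      refine tsum_congr fun y => ?_
      rw [mul_inv_cancel_right]
    simp_rw [e]
    rw [← Summable.tsum_finsetSum (fun a _ => (hfs (fun z => ι a (z * a⁻¹)) g hgf).sm), ← tsum_mul_left]
    refine Summable.tsum_le_tsum ?_ ?_ (hgf.sm.mul_left _)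
    · intro z
      rw [← Finset.sum_mul]
      gcongr
      · exact hg0 z
      · simp only [ι]
        rw [← Finset.sum_filter, Finset.sum_const, nsmul_eq_mul, mul_one]
        exact_mod_cast mult_bound hg k A hA2 F z
    · exact summable_sum (fun a _ => (hfs _ g hgf).sm)
  have diff : ∑ a ∈ F, ∑' y, ι a y * g y - ∑ a ∈ F, ∑' y, ι a y * g (y * a) ≤
      ∑ a ∈ F, ∑' y, |g (y * a) - g y| := by
    rw [← Finset.sum_sub_distrib]
    refine Finset.sum_le_sum fun a _ => ?_
    rw [← (hfs (ι a) g hgf).sm.tsum_sub (hfs (ι a) _ (hgf.shift a)).sm]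
    refine Summable.tsum_le_tsum ?_ ((hfs (ι a) g hgf).sm.sub (hfs (ι a) _ (hgf.shift a)).sm)
      ((hgf.shift a).map2 hgf (fun u v => |u - v|) (by simp)).sm
    intro y
    rw [← mul_sub]
    have : ι a y * (g y - g (y * a)) ≤ ι a y * |g (y * a) - g y| := by
      refine mul_le_mul_of_nonneg_left ?_ (hι0 _ _)
      rw [abs_sub_comm]; exact le_abs_self _
    exact this.trans (mul_le_of_le_one_left (abs_nonneg _) (hι1 _ _))
  have hsum0 : 0 ≤ ∑' y, g y := tsum_nonneg hg0
  have hM1' : (1 : ℝ) ≤ M := by exact_mod_cast hM1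
  nlinarith

theorem exists_isop2 {F : Finset G} (hF : F.Nonempty)
    (h : ∀ g : G → ℝ, FS g → (∀ y, 0 ≤ g y) →
      ∑' y, g y ≤ ∑ a ∈ F, ∑' y, |g (y * a) - g y|) (f : G → ℝ) (hf : FS f) :
    sqn f ≤ 4 * F.card * ∑ a ∈ F, Ea a f := by
  have h1 := h (fun y => f y ^ 2) (hf.map1 (fun u => u ^ 2) (by simp)) (fun y => sq_nonneg _)
  have hc : (0 : ℝ) < F.card := by exact_mod_cast hF.card_pos
  set s : ℝ := 2 * F.card with hs
  have hs0 : 0 < s := by positivity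
  have sf : Summable (fun y => f y ^ 2) := (hf.map1 (fun u => u ^ 2) (by simp)).sm
  have key : ∀ a, ∑' y, |f (y * a) ^ 2 - f y ^ 2| ≤ s * Ea a f + s⁻¹ * sqn f := by
    intro a
    have sfa : Summable (fun y => f (y * a) ^ 2) :=
      ((hf.shift a).map1 (fun u => u ^ 2) (by simp)).sm
    have e : s * Ea a f + s⁻¹ * sqn f = ∑' y, (s * (f (y * a) - f y) ^ 2 +
        s⁻¹ / 2 * (f (y * a) ^ 2 + f y ^ 2)) := by
      rw [((hf.Esm a).mul_left s).tsum_add ((sfa.add sf).mul_left _), tsum_mul_left, tsum_mul_left,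
        sfa.tsum_add sf, tsum_shift (fun y => f y ^ 2) a]
      unfold Ea sqn
      ring
    rw [e]
    refine Summable.tsum_le_tsum ?_
      ((hf.shift a).map2 hf (fun u v => |u ^ 2 - v ^ 2|) (by simp)).sm
      (((hf.Esm a).mul_left s).add ((sfa.add sf).mul_left _))
    intro y
    set u := f (y * a)
    set v := f y
    have hi : s * s⁻¹ = 1 := mul_inv_cancel₀ hs0.ne'
    have hi0 : 0 < s⁻¹ := by positivity
    have e1 : |u ^ 2 - v ^ 2| = |u - v| * |u + v| := by rw [← abs_mul]; congr 1; ring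
    have e2 : (u - v) ^ 2 = |u - v| ^ 2 := (sq_abs _).symm
    have e3 : |u + v| ^ 2 ≤ 2 * (u ^ 2 + v ^ 2) := by
      rw [sq_abs]; nlinarith [sq_nonneg (u - v)]
    rw [e1, e2]
    have e4 : 0 ≤ s * (|u - v| - s⁻¹ / 2 * |u + v|) ^ 2 := by positivity
    have e5 : s * (|u - v| - s⁻¹ / 2 * |u + v|) ^ 2 =
        s * |u - v| ^ 2 - |u - v| * |u + v| + s⁻¹ / 4 * |u + v| ^ 2 := by
      field_simp; ring
    have e6 : s⁻¹ / 4 * |u + v| ^ 2 ≤ s⁻¹ / 4 * (2 * (u ^ 2 + v ^ 2)) := by gcongr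
    linarith
  have h2 : sqn f ≤ ∑ a ∈ F, (s * Ea a f + s⁻¹ * sqn f) := h1.trans (Finset.sum_le_sum fun a _ => key a)
  rw [Finset.sum_add_distrib, ← Finset.mul_sum, Finset.sum_const, nsmul_eq_mul] at h2
  have e7 : (F.card : ℝ) * (s⁻¹ * sqn f) = sqn f / 2 := by rw [hs]; field_simp
  rw [e7, hs] at h2
  linarith

/-! ## M3b -/
set_option linter.unusedSectionVars false
theorem convPow_nonneg {μ : G → ℝ} (hp : IsProbDensity μ) (n : ℕ) (g : G) : 0 ≤ convPow μ n g := by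
  induction n generalizing g with
  | zero => simp only [convPow]; split_ifs <;> norm_num
  | succ n ih => exact tsum_nonneg fun y => mul_nonneg (ih y) (hp.1 _)

def Pop (μ : G → ℝ) (T : Finset G) (f : G → ℝ) (y : G) : ℝ := ∑ a ∈ T, μ a * f (y * a)

def ip (f g : G → ℝ) : ℝ := ∑' y, f y * g y

theorem convPow_succ_eq {μ : G → ℝ} (hs : IsSymmetric μ) (T : Finset G)
    (hT : ∀ g, μ g ≠ 0 → g ∈ T) (n : ℕ) (g : G) :
    convPow μ (n + 1) g = Pop μ T (convPow μ n) g := by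
  simp only [convPow]
  have : ∑' y, convPow μ n y * μ (y⁻¹ * g) = ∑' a, convPow μ n (g * a) * μ a := by
    rw [← (Equiv.mulLeft g).tsum_eq (fun y => convPow μ n y * μ (y⁻¹ * g))]
    refine tsum_congr fun a => ?_
    simp only [Equiv.coe_mulLeft, mul_inv_rev]
    rw [inv_mul_cancel_right, hs]
  rw [this, tsum_eq_sum (s := T)]
  · unfold Pop
    exact Finset.sum_congr rfl fun a _ => mul_comm _ _
  · intro a ha
    have : μ a = 0 := by by_contra h; exact ha (hT a h)
    rw [this, mul_zero]

theorem FS.Pop {f : G → ℝ} (hf : FS f) (μ : G → ℝ) (T : Finset G) : FS (Pop μ T f) := by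
  refine (Set.Finite.biUnion T.finite_toSet (fun a _ => hf.shift a)).subset ?_
  intro y hy
  by_contra h
  apply hy
  unfold GHM.Pop
  refine Finset.sum_eq_zero fun a ha => ?_
  simp only [Set.mem_iUnion, Function.mem_support, not_exists, not_not] at h
  rw [h a ha, mul_zero]

theorem FS.ipsm {f g : G → ℝ} (hf : FS f) (hg : FS g) : Summable (fun y => f y * g y) :=
  (hf.map2 hg (fun u v => u * v) (by simp)).sm

theorem ip_Pop {f g : G → ℝ} (hf : FS f) (hg : FS g) (μ : G → ℝ) (T : Finset G) :
    ip f (Pop μ T g) = ∑ a ∈ T, μ a * ∑' y, f y * g (y * a) := by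
  unfold ip Pop
  simp_rw [← tsum_mul_left]
  rw [← Summable.tsum_finsetSum (fun a _ => (hf.ipsm (hg.shift a)).mul_left _)]
  refine tsum_congr fun y => ?_
  rw [Finset.mul_sum]
  exact Finset.sum_congr rfl fun a _ => by ring

theorem Ea_expand {f : G → ℝ} (hf : FS f) (a : G) :
    Ea a f = 2 * sqn f - 2 * ∑' y, f y * f (y * a) := by
  have s1 : Summable (fun y => f y ^ 2) := (hf.map1 (fun u => u ^ 2) (by simp)).sm
  have s2 : Summable (fun y => f (y * a) ^ 2) := ((hf.shift a).map1 (fun u => u ^ 2) (by simp)).sm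
  have s3 := hf.ipsm (hf.shift a)
  have e : Ea a f = ∑' y, (f (y * a) ^ 2 + f y ^ 2 - 2 * (f y * f (y * a))) :=
    tsum_congr fun y => by ring
  rw [e, (s2.add s1).tsum_sub (s3.mul_left 2), s2.tsum_add s1, tsum_shift (fun y => f y ^ 2) a,
    tsum_mul_left]
  unfold sqn; ring

theorem Ea_one (f : G → ℝ) : Ea 1 f = 0 := by unfold Ea; simp

theorem ip_Pop_symm {f g : G → ℝ} (hf : FS f) (hg : FS g) {μ : G → ℝ} (hs : IsSymmetric μ)
    (T : Finset G) (hT : ∀ g, g ∈ T ↔ μ g ≠ 0) : ip f (Pop μ T g) = ip g (Pop μ T f) := by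
  rw [ip_Pop hf hg, ip_Pop hg hf]
  refine Finset.sum_bij' (fun a _ => a⁻¹) (fun a _ => a⁻¹) ?_ ?_ ?_ ?_ ?_
  · intro a ha; rw [hT] at *; rwa [hs]
  · intro a ha; rw [hT] at *; rwa [hs]
  · intro a _; simp
  · intro a _; simp
  · intro a ha
    rw [hs, ← tsum_shift (fun y => g y * f (y * a⁻¹)) a]
    congr 1
    refine tsum_congr fun y => ?_
    rw [mul_inv_cancel_right, mul_comm]

theorem ip_lin {f g f' g' : G → ℝ} (hf : FS f) (hg : FS g) (hf' : FS f') (hg' : FS g') (c : ℝ)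
    (μ : G → ℝ) (T : Finset G) :
    ip (fun y => f y + c * g y) (Pop μ T (fun y => f' y + c * g' y)) =
      ip f (Pop μ T f') + c * ip f (Pop μ T g') + c * ip g (Pop μ T f') + c ^ 2 * ip g (Pop μ T g') := by
  have e : Pop μ T (fun y => f' y + c * g' y) = fun y => Pop μ T f' y + c * Pop μ T g' y := by
    funext y
    unfold Pop
    rw [Finset.mul_sum, ← Finset.sum_add_distrib]
    exact Finset.sum_congr rfl fun a _ => by ring
  rw [e]
  have pf := hf'.Pop μ T
  have pg := hg'.Pop μ T
  unfold ip
  rw [← tsum_mul_left, ← tsum_mul_left, ← tsum_mul_left,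
    ← (hf.ipsm pf).tsum_add ((hf.ipsm pg).mul_left _),
    ← ((hf.ipsm pf).add ((hf.ipsm pg).mul_left _)).tsum_add ((hg.ipsm pf).mul_left _),
    ← (((hf.ipsm pf).add ((hf.ipsm pg).mul_left _)).add ((hg.ipsm pf).mul_left _)).tsum_add
      ((hg.ipsm pg).mul_left _)]
  exact tsum_congr fun y => by ring

theorem sqn_lin {f g : G → ℝ} (hf : FS f) (hg : FS g) (c : ℝ) :
    sqn (fun y => f y + c * g y) = sqn f + 2 * c * ip f g + c ^ 2 * sqn g := by
  have s1 : Summable (fun y => f y ^ 2) := (hf.map1 (fun u => u ^ 2) (by simp)).sm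
  have s2 : Summable (fun y => g y ^ 2) := (hg.map1 (fun u => u ^ 2) (by simp)).sm
  have s3 := hf.ipsm hg
  unfold sqn ip
  rw [← tsum_mul_left, ← tsum_mul_left, ← s1.tsum_add (s3.mul_left _),
    ← (s1.add (s3.mul_left _)).tsum_add (s2.mul_left _)]
  exact tsum_congr fun y => by ring

theorem exists_gap {F : Finset G}
    (hF : ∀ f : G → ℝ, FS f → sqn f ≤ 4 * F.card * ∑ a ∈ F, Ea a f)
    {μ : G → ℝ} (hp : IsProbDensity μ) (hgen : GeneratesSupp μ)
    (T : Finset G) (hT : ∀ g, g ∈ T ↔ μ g ≠ 0) :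
    ∃ lam : ℝ, 0 < lam ∧ lam < 1 ∧ ∀ f : G → ℝ, FS f → ip f (Pop μ T f) ≤ lam * sqn f := by
  classical
  have hsum : ∑ a ∈ T, μ a = 1 := by
    rw [← hp.2.tsum_eq, tsum_eq_sum]
    intro a ha
    by_contra h
    exact ha ((hT a).2 h)
  let Dm : (G → ℝ) → ℝ := fun f => ∑ a ∈ T, μ a * Ea a f
  have hD0 : ∀ f, 0 ≤ Dm f := fun f => Finset.sum_nonneg fun a _ => mul_nonneg (hp.1 a) (Ea_nonneg a f)
  have hD : ∀ f, FS f → Dm f = 2 * sqn f - 2 * ip f (Pop μ T f) := by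
    intro f hf
    rw [ip_Pop hf hf]
    simp only [Dm]
    simp_rw [Ea_expand hf, mul_sub]
    rw [Finset.sum_sub_distrib, ← Finset.sum_mul, hsum, one_mul, Finset.mul_sum]
    congr 1
    exact Finset.sum_congr rfl fun a _ => by ring
  have hE : ∀ a : G, ∃ C : ℝ, 0 ≤ C ∧ ∀ f, FS f → Ea a f ≤ C * Dm f := by
    intro a
    have : a ∈ Subgroup.closure {g : G | μ g ≠ 0} := by rw [hgen]; trivial
    induction this using Subgroup.closure_induction with
    | mem x hx =>
      have hpos : 0 < μ x := lt_of_le_of_ne (hp.1 x) (Ne.symm hx)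
      refine ⟨(μ x)⁻¹, by positivity, fun f hf => ?_⟩
      rw [← div_eq_inv_mul, le_div_iff₀ hpos, mul_comm]
      exact Finset.single_le_sum (f := fun a => μ a * Ea a f)
        (fun a _ => mul_nonneg (hp.1 a) (Ea_nonneg a f)) ((hT x).2 hx)
    | one => exact ⟨0, le_rfl, fun f hf => by rw [Ea_one]; simp⟩
    | mul x y _ _ hx hy =>
      obtain ⟨C, hC, h1⟩ := hx
      obtain ⟨C', hC', h2⟩ := hy
      refine ⟨2 * C + 2 * C', by positivity, fun f hf => ?_⟩
      have := Ea_mul x y hf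
      have := h1 f hf
      have := h2 f hf
      linarith
    | inv x _ hx =>
      obtain ⟨C, hC, h1⟩ := hx
      exact ⟨C, hC, fun f hf => by rw [Ea_inv]; exact h1 f hf⟩
  choose C hC0 hC using hE
  set K : ℝ := 4 * F.card * ∑ a ∈ F, C a + 1 with hK
  have hK1 : 1 ≤ K := by
    have : 0 ≤ ∑ a ∈ F, C a := Finset.sum_nonneg fun a _ => hC0 a
    have : 0 ≤ 4 * (F.card : ℝ) * ∑ a ∈ F, C a := by positivity
    linarith
  have main : ∀ f, FS f → sqn f ≤ K * Dm f := by
    intro f hf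
    have h1 := hF f hf
    have h2 : ∑ a ∈ F, Ea a f ≤ (∑ a ∈ F, C a) * Dm f := by
      rw [Finset.sum_mul]; exact Finset.sum_le_sum fun a _ => hC a f hf
    have h3 : 4 * (F.card : ℝ) * ∑ a ∈ F, Ea a f ≤ 4 * F.card * ((∑ a ∈ F, C a) * Dm f) := by gcongr
    have := hD0 f
    rw [hK]; linarith
  have hKi : 0 < K⁻¹ := by positivity
  have hKi1 : K⁻¹ ≤ 1 := inv_le_one_of_one_le₀ hK1
  refine ⟨1 - K⁻¹ / 2, by linarith, by linarith, fun f hf => ?_⟩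
  have h1 := main f hf
  rw [hD f hf] at h1
  have h2 : K⁻¹ * sqn f ≤ 2 * sqn f - 2 * ip f (Pop μ T f) := by
    rw [← div_eq_inv_mul, div_le_iff₀ (by positivity)]; linarith
  linarith

theorem gap_conv {μ : G → ℝ} (hp : IsProbDensity μ) (hs : IsSymmetric μ)
    (T : Finset G) (hT : ∀ g, g ∈ T ↔ μ g ≠ 0) {lam : ℝ} (hl : 0 < lam)
    (hgap : ∀ f : G → ℝ, FS f → ip f (Pop μ T f) ≤ lam * sqn f) (n : ℕ) (g : G) :
    convPow μ n g ≤ lam ^ n := by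
  have habs : ∀ f : G → ℝ, FS f → |ip f (Pop μ T f)| ≤ lam * sqn f := by
    intro f hf
    have hf' : FS (fun y => |f y|) := hf.map1 (fun u => |u|) (by simp)
    have h1 := hgap _ hf'
    have h2 : sqn (fun y => |f y|) = sqn f := tsum_congr fun y => sq_abs _
    rw [h2] at h1
    refine le_trans ?_ h1
    unfold ip
    have s1 := (hf.ipsm (hf.Pop μ T)).abs
    have hn : |∑' y, f y * Pop μ T f y| ≤ ∑' y, |f y * Pop μ T f y| := by
      have s2 : Summable (fun y => ‖f y * Pop μ T f y‖) := by
        simp only [Real.norm_eq_abs]; exact s1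
      have := norm_tsum_le_tsum_norm s2
      simpa only [Real.norm_eq_abs] using this
    refine hn.trans ?_
    refine s1.tsum_le_tsum ?_ (hf'.ipsm (hf'.Pop μ T))
    intro y
    rw [abs_mul]
    gcongr
    unfold Pop
    refine (Finset.abs_sum_le_sum_abs _ _).trans (Finset.sum_le_sum fun a _ => ?_)
    rw [abs_mul, abs_of_nonneg (hp.1 a)]
  have hstep : ∀ f : G → ℝ, FS f → sqn (Pop μ T f) ≤ lam ^ 2 * sqn f := by
    intro f hf
    set g := Pop μ T f with hgd
    have hgf : FS g := hf.Pop μ T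
    have a1 := (abs_le.1 (habs (fun y => f y + lam⁻¹ * g y)
      (hf.map2 hgf (fun u v => u + lam⁻¹ * v) (by simp)))).2
    have a2 := (abs_le.1 (habs (fun y => f y + (-lam⁻¹) * g y)
      (hf.map2 hgf (fun u v => u + (-lam⁻¹) * v) (by simp)))).1
    rw [ip_lin hf hgf hf hgf, sqn_lin hf hgf] at a1 a2
    have e1 : ip f (Pop μ T g) = ip g (Pop μ T f) := ip_Pop_symm hf hgf hs T hT
    have e2 : ip g (Pop μ T f) = sqn g := by
      unfold ip sqn; exact tsum_congr fun y => by rw [← hgd]; ring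
    rw [e1, e2] at a1 a2
    have hli : lam * lam⁻¹ = 1 := mul_inv_cancel₀ hl.ne'
    have h3 : 4 * lam⁻¹ * sqn g ≤ 2 * lam * (sqn f + lam⁻¹ ^ 2 * sqn g) := by linarith
    have h4 : lam * (lam⁻¹ ^ 2 * sqn g) = lam⁻¹ * sqn g := by
      rw [← mul_assoc, pow_two, ← mul_assoc, hli, one_mul]
    have h5 : lam⁻¹ * sqn g ≤ lam * sqn f := by linarith
    have h6 := mul_le_mul_of_nonneg_left h5 hl.le
    rw [← mul_assoc, hli, one_mul] at h6
    linarith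
  have hT' : ∀ g, μ g ≠ 0 → g ∈ T := fun g => (hT g).2
  have hn : FS (convPow μ n) ∧ sqn (convPow μ n) ≤ (lam ^ n) ^ 2 := by
    induction n with
    | zero =>
      have hsub : Function.support (convPow μ 0) ⊆ {(1 : G)} := by
        intro y hy
        by_contra h
        apply hy
        simp only [convPow]
        rw [if_neg (by simpa using h)]
      refine ⟨(Set.finite_singleton _).subset hsub, ?_⟩
      unfold sqn
      rw [tsum_eq_single 1]
      · simp [convPow]
      · intro y hy; simp [convPow, hy]
    | succ n ih =>
      have e : convPow μ (n + 1) = Pop μ T (convPow μ n) := funext (convPow_succ_eq hs T hT' n)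
      rw [e]
      refine ⟨ih.1.Pop μ T, (hstep _ ih.1).trans ?_⟩
      rw [pow_succ]
      calc lam ^ 2 * sqn (convPow μ n) ≤ lam ^ 2 * (lam ^ n) ^ 2 := by gcongr; exact ih.2
        _ = (lam ^ n * lam) ^ 2 := by ring
  have h1 : convPow μ n g ^ 2 ≤ sqn (convPow μ n) :=
    (hn.1.map1 (fun u => u ^ 2) (by simp)).sm.le_tsum g (fun y _ => sq_nonneg _)
  exact (abs_le_of_sq_le_sq' (h1.trans hn.2) (by positivity)).2

structure WalkOK (S : Finset G) (μ : G → ℝ) (K : ℕ) (lam : ℝ) : Prop where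
  prob : IsProbDensity μ
  symm : IsSymmetric μ
  fin : {g : G | μ g ≠ 0}.Finite
  gen : GeneratesSupp μ
  K_pos : 1 ≤ K
  step : ∀ g, μ g ≠ 0 → wordLength S g ≤ K
  lam_pos : 0 < lam
  lam_lt : lam < 1
  conv : ∀ n g, convPow μ n g ≤ lam ^ n

theorem exists_walkOK [Infinite G] {S : Finset G} {δ : ℕ} (hg : Geo S δ)
    (hq : ¬ QuasiIsometric (wordDist S) intDist)
    {μ : G → ℝ} (hp : IsProbDensity μ) (hs : IsSymmetric μ) (hfin : {g : G | μ g ≠ 0}.Finite)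
    (hgen : GeneratesSupp μ) : ∃ K lam, WalkOK S μ K lam := by
  obtain ⟨F, hF0, hF⟩ := exists_isop hg (exists_tripod hg hq)
  have hT : ∀ g, g ∈ hfin.toFinset ↔ μ g ≠ 0 := by intro g; simp
  obtain ⟨lam, h1, h2, h3⟩ := exists_gap (exists_isop2 hF0 hF) hp hgen hfin.toFinset hT
  refine ⟨hfin.toFinset.sup (wordLength S) + 1, lam, hp, hs, hfin, hgen, by omega, ?_, h1, h2,
    gap_conv hp hs _ hT h1 h3⟩
  intro g hg
  have := Finset.le_sup (f := wordLength S) ((hT g).2 hg)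
  omega

/-! ## M4 -/
set_option linter.unusedSectionVars false
def mE (μ : G → ℝ) (a : G) : ℝ≥0∞ := ENNReal.ofReal (μ a)

open scoped Classical in
def dl (w v : G) : ℝ≥0∞ := if w = v then 1 else 0

open scoped Classical in
/-- kernel of the walk killed when leaving a point of U -/
def q (μ : G → ℝ) (U : Set G) : ℕ → G → G → ℝ≥0∞
  | 0 => fun w v => dl w v
  | n + 1 => fun w v => if w ∈ U then 0 else ∑' a, mE μ a * q μ U n (w * a) v

def gU (μ : G → ℝ) (U : Set G) (w v : G) : ℝ≥0∞ := ∑' n, q μ U n w v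
def Gr (μ : G → ℝ) (w v : G) : ℝ≥0∞ := gU μ ∅ w v

theorem mE_sum {μ : G → ℝ} (hp : IsProbDensity μ) : ∑' a, mE μ a = 1 := by
  unfold mE
  rw [← ENNReal.ofReal_tsum_of_nonneg hp.1 hp.2.summable, hp.2.tsum_eq, ENNReal.ofReal_one]

theorem q_succ_notMem (μ : G → ℝ) {U : Set G} {w : G} (h : w ∉ U) (n : ℕ) (v : G) :
    q μ U (n + 1) w v = ∑' a, mE μ a * q μ U n (w * a) v := by simp [q, h]

theorem q_succ_mem (μ : G → ℝ) {U : Set G} {w : G} (h : w ∈ U) (n : ℕ) (v : G) :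
    q μ U (n + 1) w v = 0 := by simp [q, h]

theorem gU_mem (μ : G → ℝ) {U : Set G} {w : G} (h : w ∈ U) (v : G) : gU μ U w v = dl w v := by
  unfold gU
  rw [tsum_eq_single 0]
  · rfl
  · intro n hn
    obtain ⟨k, rfl⟩ := Nat.exists_eq_succ_of_ne_zero hn
    exact q_succ_mem μ h k v

theorem gU_notMem (μ : G → ℝ) {U : Set G} {w : G} (h : w ∉ U) (v : G) :
    gU μ U w v = dl w v + ∑' a, mE μ a * gU μ U (w * a) v := by
  unfold gU
  rw [tsum_eq_zero_add' ENNReal.summable]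
  congr 1
  simp_rw [q_succ_notMem μ h]
  rw [ENNReal.tsum_comm]
  exact tsum_congr fun a => ENNReal.tsum_mul_left

theorem Gr_rec (μ : G → ℝ) (w v : G) :
    Gr μ w v = dl w v + ∑' a, mE μ a * Gr μ (w * a) v := gU_notMem μ (by simp) v

theorem q_le (μ : G → ℝ) (U : Set G) (n : ℕ) (w v : G) : q μ U n w v ≤ q μ ∅ n w v := by
  induction n generalizing w with
  | zero => exact le_rfl
  | succ n ih =>
    rw [q_succ_notMem μ (U := ∅) (by simp)]
    by_cases h : w ∈ U
    · rw [q_succ_mem μ h]; exact zero_le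
    · rw [q_succ_notMem μ h]
      exact ENNReal.tsum_le_tsum fun a => by gcongr; exact ih _

/-- U1 -/
theorem Gr_le (μ : G → ℝ) (U : Set G) (w v : G) :
    Gr μ w v ≤ ∑' u, U.indicator (fun u => gU μ U w u * Gr μ u v) u +
      Uᶜ.indicator (fun v => gU μ U w v) v := by
  have key : ∀ N w, ∑ n ∈ Finset.range N, q μ ∅ n w v ≤
      ∑' u, U.indicator (fun u => gU μ U w u * Gr μ u v) u +
      Uᶜ.indicator (fun v => gU μ U w v) v := by
    intro N
    induction N with
    | zero => intro w; simp
    | succ N ih =>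
      intro w
      by_cases hw : w ∈ U
      · refine le_trans (ENNReal.sum_le_tsum _) (le_trans ?_ le_self_add)
        refine le_trans ?_ (ENNReal.le_tsum w)
        rw [Set.indicator_of_mem hw, gU_mem μ hw]
        simp [dl, Gr, gU]
      · rw [Finset.sum_range_succ']
        have h1 : ∑ n ∈ Finset.range N, q μ ∅ (n + 1) w v =
            ∑' a, mE μ a * ∑ n ∈ Finset.range N, q μ ∅ n (w * a) v := by
          simp_rw [q_succ_notMem μ (Set.notMem_empty w), Finset.mul_sum]
          rw [Summable.tsum_finsetSum (fun _ _ => ENNReal.summable)]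
        rw [h1]
        have h2 : ∑' a, mE μ a * ∑ n ∈ Finset.range N, q μ ∅ n (w * a) v ≤
            ∑' a, mE μ a * (∑' u, U.indicator (fun u => gU μ U (w * a) u * Gr μ u v) u +
              Uᶜ.indicator (fun v => gU μ U (w * a) v) v) :=
          ENNReal.tsum_le_tsum fun a => by gcongr; exact ih _
        refine (add_le_add_left h2 _).trans ?_
        simp_rw [mul_add]
        rw [ENNReal.tsum_add, add_assoc]
        refine add_le_add ?_ ?_
        · simp_rw [← ENNReal.tsum_mul_left]
          rw [ENNReal.tsum_comm]
          refine ENNReal.tsum_le_tsum fun u => ?_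
          by_cases hu : u ∈ U
          · simp only [Set.indicator_of_mem hu]
            rw [gU_notMem μ hw]
            rw [add_mul, ← ENNReal.tsum_mul_right]
            simp_rw [mul_assoc]
            exact le_add_self
          · simp [Set.indicator_of_notMem hu]
        · by_cases hv : v ∈ U
          · have : q μ ∅ 0 w v = 0 := by
              simp only [q, dl]
              rw [if_neg]
              rintro rfl; exact hw hv
            simp [Set.indicator, hv, this]
          · have hv' : v ∈ Uᶜ := hv
            simp only [Set.indicator_of_mem hv']
            rw [gU_notMem μ hw, add_comm]
            rfl
  unfold Gr gU at *
  rw [ENNReal.tsum_eq_iSup_nat]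
  exact iSup_le fun N => key N w

/-- U2 -/
theorem superharm (μ : G → ℝ) (U : Set G) (f : G → ℝ≥0∞)
    (hf : ∀ w, ∑' a, mE μ a * f (w * a) ≤ f w) (w : G) :
    ∑' u, U.indicator (fun u => gU μ U w u * f u) u ≤ f w := by
  have e : ∑' u, U.indicator (fun u => gU μ U w u * f u) u =
      ∑' n, ∑' u, U.indicator (fun u => q μ U n w u * f u) u := by
    rw [ENNReal.tsum_comm]
    refine tsum_congr fun u => ?_
    by_cases hu : u ∈ U
    · simp only [Set.indicator_of_mem hu]
      rw [ENNReal.tsum_mul_right]; rfl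
    · simp [Set.indicator_of_notMem hu]
  rw [e, ENNReal.tsum_eq_iSup_nat]
  refine iSup_le fun N => ?_
  induction N generalizing w with
  | zero => simp
  | succ N ih =>
    have h0 : ∑' u, U.indicator (fun u => q μ U 0 w u * f u) u = U.indicator f w := by
      rw [tsum_eq_single w]
      · by_cases hw : w ∈ U <;> simp [Set.indicator, hw, q, dl]
      · intro u hu
        by_cases h : u ∈ U <;> simp [Set.indicator, h, q, dl, hu.symm]
    rw [Finset.sum_range_succ', h0]
    by_cases hw : w ∈ U
    · have : ∀ n, ∑' u, U.indicator (fun u => q μ U (n + 1) w u * f u) u = 0 := by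
        intro n
        simp [q_succ_mem μ hw]
      simp [this, hw]
    · rw [Set.indicator_of_notMem hw, add_zero]
      have h1 : ∀ n, ∑' u, U.indicator (fun u => q μ U (n + 1) w u * f u) u =
          ∑' a, mE μ a * ∑' u, U.indicator (fun u => q μ U n (w * a) u * f u) u := by
        intro n
        simp_rw [← ENNReal.tsum_mul_left]
        rw [ENNReal.tsum_comm]
        refine tsum_congr fun u => ?_
        by_cases hu : u ∈ U
        · simp only [Set.indicator_of_mem hu]
          rw [q_succ_notMem μ hw, ← ENNReal.tsum_mul_right]
          simp_rw [mul_assoc]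
        · simp [Set.indicator_of_notMem hu]
      simp_rw [h1]
      rw [← Summable.tsum_finsetSum (fun _ _ => ENNReal.summable)]
      refine le_trans (ENNReal.tsum_le_tsum fun a => ?_) (hf w)
      rw [← Finset.mul_sum]
      gcongr
      exact ih (w * a) (by
        rw [ENNReal.tsum_comm]
        refine tsum_congr fun u => ?_
        by_cases hu : u ∈ U
        · simp only [Set.indicator_of_mem hu]
          rw [ENNReal.tsum_mul_right]; rfl
        · simp [Set.indicator_of_notMem hu])

theorem superharm_one {μ : G → ℝ} (hp : IsProbDensity μ) (U : Set G) (w : G) :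
    ∑' u, U.indicator (fun u => gU μ U w u) u ≤ 1 := by
  have := superharm μ U (fun _ => 1) (by intro w; simp [mE_sum hp]) w
  simpa using this

theorem superharm_Gr (μ : G → ℝ) (U : Set G) (w v : G) :
    ∑' u, U.indicator (fun u => gU μ U w u * Gr μ u v) u ≤ Gr μ w v :=
  superharm μ U (fun u => Gr μ u v) (by intro w; rw [Gr_rec μ w]; exact le_add_self) w

theorem Gr_mul_le' (μ : G → ℝ) (w x v : G) : Gr μ w x * Gr μ x v ≤ Gr μ x x * Gr μ w v := by
  have h1 := Gr_le μ {x} w x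
  have h2 := superharm_Gr μ {x} w v
  have e1 : ∀ y, ∑' u, ({x} : Set G).indicator (fun u => gU μ {x} w u * Gr μ u y) u =
      gU μ {x} w x * Gr μ x y := by
    intro y
    rw [tsum_eq_single x]
    · simp
    · intro u hu; simp [hu]
  rw [e1] at h1 h2
  rw [Set.indicator_of_notMem (by simp), add_zero] at h1
  calc Gr μ w x * Gr μ x v ≤ gU μ {x} w x * Gr μ x x * Gr μ x v := by gcongr
    _ = Gr μ x x * (gU μ {x} w x * Gr μ x v) := by ring
    _ ≤ _ := by gcongr

/-! relation with convPow -/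
theorem q_shift (μ : G → ℝ) (n : ℕ) (x w v : G) : q μ ∅ n (x * w) (x * v) = q μ ∅ n w v := by
  induction n generalizing w with
  | zero => by_cases h : w = v <;> simp [q, dl, h]
  | succ n ih =>
    rw [q_succ_notMem μ (by simp), q_succ_notMem μ (by simp)]
    refine tsum_congr fun a => ?_
    rw [mul_assoc, ih]

/-- right recursion -/
theorem q_right (μ : G → ℝ) (n : ℕ) (w v : G) :
    q μ ∅ (n + 1) w v = ∑' y, q μ ∅ n w y * mE μ (y⁻¹ * v) := by
  induction n generalizing w with
  | zero =>
    rw [q_succ_notMem μ (by simp), tsum_eq_single (w⁻¹ * v), tsum_eq_single w]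
    · simp [q, dl]
    · intro y hy; simp [q, dl, hy.symm]
    · intro a ha
      have : w * a ≠ v := by rintro rfl; simp at ha
      simp [q, dl, this]
  | succ n ih =>
    rw [q_succ_notMem μ (by simp)]
    simp_rw [ih, q_succ_notMem μ (Set.notMem_empty _), ← ENNReal.tsum_mul_left,
      ← ENNReal.tsum_mul_right]
    rw [ENNReal.tsum_comm]
    simp_rw [mul_assoc]

theorem q_symm {μ : G → ℝ} (hs : IsSymmetric μ) (n : ℕ) (w v : G) : q μ ∅ n w v = q μ ∅ n v w := by
  induction n generalizing w v with
  | zero =>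
    by_cases h : w = v
    · simp [q, dl, h]
    · simp [q, dl, h, Ne.symm h]
  | succ n ih =>
    rw [q_right, q_succ_notMem μ (by simp), ← (Equiv.mulLeft v).tsum_eq]
    refine tsum_congr fun a => ?_
    simp only [Equiv.coe_mulLeft, mul_inv_rev, inv_mul_cancel_right]
    rw [ih, mul_comm]
    congr 1
    unfold mE; rw [hs]

theorem q_convPow {S : Finset G} {μ : G → ℝ} {K : ℕ} {lam : ℝ} (hw : WalkOK S μ K lam) (n : ℕ) (w v : G) :
    q μ ∅ n w v = ENNReal.ofReal (convPow μ n (w⁻¹ * v)) := by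
  have h1 : ∀ v, q μ ∅ n 1 v = ENNReal.ofReal (convPow μ n v) := by
    induction n with
    | zero => intro v; by_cases h : v = 1 <;> simp [q, dl, convPow, h, eq_comm]
    | succ n ih =>
      intro v
      rw [q_right]
      simp only [convPow]
      rw [ENNReal.ofReal_tsum_of_nonneg]
      · refine tsum_congr fun y => ?_
        rw [ih, ENNReal.ofReal_mul (convPow_nonneg hw.prob _ _)]; rfl
      · intro y; exact mul_nonneg (convPow_nonneg hw.prob _ _) (hw.prob.1 _)
      · refine summable_of_hasFiniteSupport ?_
        refine ((hw.fin.image (fun a => v * a⁻¹))).subset ?_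
        intro y hy
        refine ⟨y⁻¹ * v, ?_, by group⟩
        intro h
        apply hy
        simp [h]
  rw [← h1, ← q_shift μ n w 1 (w⁻¹ * v)]
  simp

section
variable {S : Finset G} {μ : G → ℝ} {K : ℕ} {lam : ℝ}

theorem WalkOK.q_le_pow (hw : WalkOK S μ K lam) (U : Set G) (n : ℕ) (w v : G) :
    q μ U n w v ≤ ENNReal.ofReal lam ^ n := by
  refine (q_le μ U n w v).trans ?_
  rw [q_convPow hw, ← ENNReal.ofReal_pow hw.lam_pos.le]
  exact ENNReal.ofReal_le_ofReal (hw.conv n _)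

theorem WalkOK.tail (hw : WalkOK S μ K lam) (N : ℕ) :
    ∑' n, (if N ≤ n then ENNReal.ofReal lam ^ n else 0) = ENNReal.ofReal (lam ^ N / (1 - lam)) := by
  have h1 : ∀ n, (if N ≤ n then ENNReal.ofReal lam ^ n else 0) =
      ENNReal.ofReal (if N ≤ n then lam ^ n else 0) := by
    intro n; split_ifs
    · rw [ENNReal.ofReal_pow hw.lam_pos.le]
    · simp
  have hs : HasSum (fun n => if N ≤ n then lam ^ n else 0) (lam ^ N / (1 - lam)) := by
    rw [← hasSum_nat_add_iff' N]
    have e : ∑ i ∈ Finset.range N, (if N ≤ i then lam ^ i else 0) = 0 := by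
      refine Finset.sum_eq_zero fun i hi => ?_
      rw [Finset.mem_range] at hi
      rw [if_neg (by omega)]
    rw [e, sub_zero]
    have := (hasSum_geometric_of_lt_one hw.lam_pos.le hw.lam_lt).mul_left (lam ^ N)
    rw [← div_eq_mul_inv] at this
    have e2 : (fun i => if N ≤ i + N then lam ^ (i + N) else 0) = fun i => lam ^ N * lam ^ i := by
      funext i; rw [if_pos (by omega), pow_add, mul_comm]
    rw [e2]; exact this
  simp_rw [h1]
  rw [← ENNReal.ofReal_tsum_of_nonneg _ hs.summable, hs.tsum_eq]
  intro n; split_ifs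
  · exact pow_nonneg hw.lam_pos.le _
  · exact le_rfl

theorem WalkOK.gU_le_of_avoid (hw : WalkOK S μ K lam) {U : Set G} {w v : G} (N : ℕ)
    (h : ∀ n < N, q μ U n w v = 0) : gU μ U w v ≤ ENNReal.ofReal (lam ^ N / (1 - lam)) := by
  rw [← hw.tail N]
  refine ENNReal.tsum_le_tsum fun n => ?_
  split_ifs with hn
  · exact hw.q_le_pow U n w v
  · rw [h n (by omega)]

theorem WalkOK.Gr_le_const (hw : WalkOK S μ K lam) (w v : G) :
    Gr μ w v ≤ ENNReal.ofReal (1 / (1 - lam)) := by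
  have := hw.gU_le_of_avoid (U := ∅) (w := w) (v := v) 0 (by simp)
  rwa [pow_zero] at this

theorem WalkOK.Gr_ne_top (hw : WalkOK S μ K lam) (w v : G) : Gr μ w v ≠ ⊤ :=
  ((hw.Gr_le_const w v).trans_lt ENNReal.ofReal_lt_top).ne

theorem Gr_symm (hs : IsSymmetric μ) (w v : G) : Gr μ w v = Gr μ v w :=
  tsum_congr fun n => q_symm hs n w v

theorem Gr_shift (μ : G → ℝ) (x w v : G) : Gr μ (x * w) (x * v) = Gr μ w v :=
  tsum_congr fun n => q_shift μ n x w v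

theorem Gr_eq_one (μ : G → ℝ) (w v : G) : Gr μ w v = Gr μ 1 (w⁻¹ * v) := by
  have := Gr_shift μ w 1 (w⁻¹ * v); simpa using this

theorem Gr_diag (μ : G → ℝ) (x : G) : Gr μ x x = Gr μ 1 1 := by rw [Gr_eq_one]; simp

theorem Gr_mul_le (μ : G → ℝ) (w x v : G) : Gr μ w x * Gr μ x v ≤ Gr μ 1 1 * Gr μ w v := by
  rw [← Gr_diag μ x]; exact Gr_mul_le' μ w x v

theorem one_le_Gr (μ : G → ℝ) : 1 ≤ Gr μ 1 1 := by
  rw [Gr_rec]; simp [dl]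

theorem WalkOK.greenFn_eq (hw : WalkOK S μ K lam) (w v : G) : greenFn μ w v = (Gr μ w v).toReal := by
  unfold greenFn Gr gU
  simp_rw [q_convPow hw]
  rw [ENNReal.tsum_toReal_eq (fun _ => ENNReal.ofReal_ne_top)]
  exact tsum_congr fun n => (ENNReal.toReal_ofReal (convPow_nonneg hw.prob _ _)).symm

theorem WalkOK.q_pos (hw : WalkOK S μ K lam) (g : G) : ∃ n, q μ ∅ n 1 g ≠ 0 := by
  have hmul : ∀ n (m : ℕ) w x v, q μ ∅ n w x ≠ 0 → q μ ∅ m x v ≠ 0 → q μ ∅ (n + m) w v ≠ 0 := by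
    intro n m w x v h1 h2
    induction n generalizing w with
    | zero =>
      simp only [q, dl] at h1
      split_ifs at h1 with h
      · subst h; simpa using h2
      · exact absurd rfl h1
    | succ n ih =>
      rw [q_succ_notMem μ (by simp)] at h1
      rw [show n + 1 + m = (n + m) + 1 by ring, q_succ_notMem μ (by simp)]
      rw [Ne, ENNReal.tsum_eq_zero] at h1 ⊢
      push Not at h1 ⊢
      obtain ⟨a, ha⟩ := h1
      refine ⟨a, mul_ne_zero (left_ne_zero_of_mul ha) (ih _ (right_ne_zero_of_mul ha))⟩
  have : g ∈ Subgroup.closure {g : G | μ g ≠ 0} := by rw [hw.gen]; trivial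
  induction this using Subgroup.closure_induction with
  | mem x hx =>
    refine ⟨1, ?_⟩
    rw [q_right, Ne, ENNReal.tsum_eq_zero]
    push Not
    refine ⟨1, ?_⟩
    have : 0 < μ x := lt_of_le_of_ne (hw.prob.1 x) (Ne.symm hx)
    simp [q, dl, mE, this]
  | one => exact ⟨0, by simp [q, dl]⟩
  | mul x y _ _ hx hy =>
    obtain ⟨n, hn⟩ := hx
    obtain ⟨m, hm⟩ := hy
    refine ⟨n + m, hmul n m 1 x _ hn ?_⟩
    have := q_shift μ m x 1 y
    rw [mul_one] at this
    rwa [this]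
  | inv x _ hx =>
    obtain ⟨n, hn⟩ := hx
    refine ⟨n, ?_⟩
    have := q_shift μ n x 1 x⁻¹
    rw [mul_one, mul_inv_cancel] at this
    rwa [← this, q_symm hw.symm]

theorem WalkOK.Gr_pos (hw : WalkOK S μ K lam) (w v : G) : Gr μ w v ≠ 0 := by
  rw [Gr_eq_one]
  obtain ⟨n, hn⟩ := hw.q_pos (w⁻¹ * v)
  intro h
  exact hn (ENNReal.tsum_eq_zero.1 h n)

theorem WalkOK.Gr_lower (hw : WalkOK S μ K lam) (hS : Generates S) :
    ∃ c : ℝ, 0 < c ∧ c < 1 ∧ ∀ w v, ENNReal.ofReal (c ^ wd S w v) ≤ Gr μ w v := by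
  classical
  set B := (ball S 1)
  have hB : B.Nonempty := ⟨1, by rw [mem_ball hS, wl_one]; omega⟩
  obtain ⟨s0, hs0, hmin⟩ := B.exists_min_image (fun s => (Gr μ 1 s).toReal) hB
  set g1 := (Gr μ 1 1).toReal with hg1
  have hg1pos : 1 ≤ g1 := by
    rw [hg1, ← ENNReal.toReal_one]
    exact ENNReal.toReal_mono (hw.Gr_ne_top _ _) (one_le_Gr μ)
  set c0 := (Gr μ 1 s0).toReal
  have hc0 : 0 < c0 := ENNReal.toReal_pos (hw.Gr_pos _ _) (hw.Gr_ne_top _ _)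
  set c := min (c0 / g1) (1 / 2)
  have hc : 0 < c := lt_min (by positivity) (by norm_num)
  have hmul : ∀ w x v, (Gr μ w x).toReal * (Gr μ x v).toReal ≤ g1 * (Gr μ w v).toReal := by
    intro w x v
    rw [hg1, ← ENNReal.toReal_mul, ← ENNReal.toReal_mul]
    exact ENNReal.toReal_mono (ENNReal.mul_ne_top (hw.Gr_ne_top _ _) (hw.Gr_ne_top _ _)) (Gr_mul_le μ w x v)
  have key : ∀ n g, wordLength S g = n → c ^ n ≤ (Gr μ 1 g).toReal := by
    intro n
    induction n with
    | zero => intro g hg; rw [wl_eq_zero hS hg]; simpa using hg1pos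
    | succ n ih =>
      intro g hg
      obtain ⟨h, k, rfl, hh, hk⟩ := exists_split hS g (n := n) (by omega)
      have h1 := ih h hh
      have h2 := hmul 1 h (h * k)
      have h3 : (Gr μ h (h * k)).toReal = (Gr μ 1 k).toReal := by
        rw [Gr_eq_one μ h]; simp
      rw [h3] at h2
      have h4 : c0 ≤ (Gr μ 1 k).toReal := hmin k (by rw [mem_ball hS]; omega)
      have h5 : c * g1 ≤ c0 := by
        have := min_le_left (c0 / g1) (1 / 2)
        rwa [le_div_iff₀ (by linarith)] at this
      have h6 : c ^ n * (c * g1) ≤ g1 * (Gr μ 1 (h * k)).toReal :=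
        le_trans (mul_le_mul h1 (h5.trans h4) (by positivity) ENNReal.toReal_nonneg) h2
      rw [pow_succ]
      have : g1 * (c ^ n * c) ≤ g1 * (Gr μ 1 (h * k)).toReal := by linarith
      exact le_of_mul_le_mul_left this (by linarith)
  refine ⟨c, hc, (min_le_right _ _).trans_lt (by norm_num), fun w v => ?_⟩
  rw [Gr_eq_one]
  exact ENNReal.ofReal_le_of_le_toReal (key _ _ rfl)

theorem WalkOK.q_path (hw : WalkOK S μ K lam) (U : Set G) (n : ℕ) (w v : G) (h : q μ U n w v ≠ 0) :
    ∃ x : ℕ → G, x 0 = w ∧ x n = v ∧ ∀ i < n, x i ∉ U ∧ wd S (x i) (x (i + 1)) ≤ K := by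
  induction n generalizing w with
  | zero =>
    simp only [q, dl] at h
    split_ifs at h with h'
    · exact ⟨fun _ => w, rfl, h', by simp⟩
    · exact absurd rfl h
  | succ n ih =>
    by_cases hwU : w ∈ U
    · exact absurd (q_succ_mem μ hwU n v) h
    · rw [q_succ_notMem μ hwU, Ne, ENNReal.tsum_eq_zero] at h
      push Not at h
      obtain ⟨a, ha⟩ := h
      obtain ⟨x, h0, h1, h2⟩ := ih _ (right_ne_zero_of_mul ha)
      refine ⟨fun i => if i = 0 then w else x (i - 1), by simp, by simpa using h1, ?_⟩
      intro i hi
      rcases Nat.eq_zero_or_pos i with rfl | hi0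
      · refine ⟨by simpa using hwU, ?_⟩
        simp only [if_true, zero_add, one_ne_zero, if_false, Nat.sub_self]
        rw [h0]
        unfold wd
        rw [inv_mul_cancel_left]
        apply hw.step
        intro h
        apply left_ne_zero_of_mul ha
        simp [mE, h]
      · have := h2 (i - 1) (by omega)
        rw [Nat.sub_add_cancel hi0] at this
        simpa [hi0.ne'] using this

end

/-! ## M5 -/
set_option linter.unusedSectionVars false
set_option linter.unusedVariables false
section
variable {S : Finset G} {δ : ℕ} {μ : G → ℝ} {K : ℕ} {lam : ℝ}

theorem chain_block (hg : Geo S δ) (x : ℕ → G) (B : ℝ) (m : ℕ) : ∀ a l, 1 ≤ l → l ≤ 2 ^ m →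
    (∀ i, a ≤ i → i < a + l → B ≤ gp S (x i) (x (i + 1))) →
    B - m * δ ≤ gp S (x a) (x (a + l)) := by
  induction m with
  | zero =>
    intro a l h1 h2 h
    have : l = 1 := by simp at h2; omega
    subst this
    simpa using h a le_rfl (by omega)
  | succ m ih =>
    intro a l h1 h2 h
    have hd : (0 : ℝ) ≤ δ := Nat.cast_nonneg _
    push_cast
    by_cases hl : l ≤ 2 ^ m
    · have := ih a l h1 hl h
      nlinarith
    · push Not at hl
      have e1 := ih a (2 ^ m) Nat.one_le_two_pow le_rfl (fun i hi hi2 => h i hi (by omega))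
      have e2 := ih (a + 2 ^ m) (l - 2 ^ m) (by omega) (by rw [pow_succ] at h2; omega)
        (fun i hi hi2 => h i (by omega) (by omega))
      rw [show a + 2 ^ m + (l - 2 ^ m) = a + l by omega] at e2
      have := hg.hyp (x a) (x (a + 2 ^ m)) (x (a + l))
      have := le_min e1 e2
      linarith

theorem chain (hg : Geo S δ) (x : ℕ → G) (n K : ℕ) (T : ℝ)
    (hst : ∀ i < n, wd S (x i) (x (i + 1)) ≤ K) (hT : gp S (x 0) (x n) < T) :
    ∃ i ≤ n, len S (x i) < T + K + (2 * Nat.log 2 (i + 1) + 1) * δ := by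
  by_contra! hcon
  have hd : (0 : ℝ) ≤ δ := Nat.cast_nonneg _
  have hgp : ∀ i < n, T + (2 * Nat.log 2 (i + 1) + 1) * δ ≤ gp S (x i) (x (i + 1)) := by
    intro i hi
    have h1 := hcon i hi.le
    have h2 := gp_lip hg.gen (x i) (x i) (x (i + 1))
    rw [gp_self, len_wd] at h2
    have h3 : (wd S (x i) (x (i + 1)) : ℝ) ≤ K := by exact_mod_cast hst i hi
    linarith
  have blk : ∀ m l : ℕ, 1 ≤ l → l ≤ 2 ^ m → 2 ^ m - 1 + l ≤ n →
      T + (m + 1) * δ ≤ gp S (x (2 ^ m - 1)) (x (2 ^ m - 1 + l)) := by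
    intro m l h1 h2 h3
    have h0 := Nat.one_le_two_pow (n := m)
    have := chain_block hg x (T + (2 * m + 1) * δ) m (2 ^ m - 1) l h1 h2 (by
      intro i hi hi2
      have := hgp i (by omega)
      have e : Nat.log 2 (i + 1) = m := by
        apply Nat.log_eq_of_pow_le_of_lt_pow <;> [skip; rw [pow_succ]] <;> omega
      rwa [e] at this)
    linarith
  have key : ∀ d m : ℕ, n ≤ 2 ^ (m + d + 1) - 1 → 2 ^ m - 1 < n →
      T + m * δ ≤ gp S (x (2 ^ m - 1)) (x n) := by
    intro d
    induction d with
    | zero =>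
      intro m h1 h2
      have := blk m (n - (2 ^ m - 1)) (by omega) (by rw [add_zero, pow_succ] at h1; omega) (by omega)
      rw [show 2 ^ m - 1 + (n - (2 ^ m - 1)) = n by omega] at this
      linarith
    | succ d ih =>
      intro m h1 h2
      have h0 := Nat.one_le_two_pow (n := m)
      have hp : 2 ^ (m + 1) = 2 ^ m * 2 := pow_succ _ _
      by_cases hn : n ≤ 2 ^ (m + 1) - 1
      · have := blk m (n - (2 ^ m - 1)) (by omega) (by omega) (by omega)
        rw [show 2 ^ m - 1 + (n - (2 ^ m - 1)) = n by omega] at this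
        linarith
      · push Not at hn
        have e1 := blk m (2 ^ m) h0 le_rfl (by omega)
        rw [show 2 ^ m - 1 + 2 ^ m = 2 ^ (m + 1) - 1 by omega] at e1
        have e2 := ih (m + 1) (by rw [show m + 1 + d + 1 = m + (d + 1) + 1 by ring]; exact h1) hn
        push_cast at e2
        have := hg.hyp (x (2 ^ m - 1)) (x (2 ^ (m + 1) - 1)) (x n)
        have := le_min e1 e2
        linarith
  rcases Nat.eq_zero_or_pos n with rfl | hn
  · have := hcon 0 le_rfl
    rw [gp_self] at hT
    simp at this
    have : (0 : ℝ) ≤ K := Nat.cast_nonneg _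
    linarith
  · have := key n 0 (by have := Nat.lt_two_pow_self (n := 0 + n + 1); omega) (by simpa using hn)
    simp at this
    linarith

/-- Gromov product at base `p` -/
def gb (S : Finset G) (p x y : G) : ℝ := gp S (p⁻¹ * x) (p⁻¹ * y)

theorem gb_eq (S : Finset G) (p x y : G) : gb S p x y = (wd S p x + wd S p y - wd S x y) / 2 := by
  unfold gb gp
  rw [len_wd, len_wd, show (p⁻¹ * x)⁻¹ * (p⁻¹ * y) = x⁻¹ * y by group, len_wd]

theorem thin_sep (hg : Geo S δ) {p w v x z : G} (h1 : w = x ∨ 2 * δ < gb S p w x)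
    (h2 : v = z ∨ 2 * δ < gb S p v z) (h : gb S p x z ≤ 0) : gb S p w v ≤ 2 * δ := by
  by_contra! hc
  have hd : (0 : ℝ) ≤ δ := Nat.cast_nonneg _
  have e1 : (δ : ℝ) < gb S p x v ∧ (v = z → 2 * δ < gb S p x v ∨ (δ : ℝ) < gb S p x v) := by
    have : (δ : ℝ) < gb S p x v := by
      rcases h1 with rfl | h1
      · linarith
      · have := hg.hyp (p⁻¹ * x) (p⁻¹ * w) (p⁻¹ * v)
        rw [gp_comm hg.gen (p⁻¹ * x)] at this
        have h3 := lt_min h1 hc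
        unfold gb at *
        linarith
    exact ⟨this, fun _ => Or.inr this⟩
  rcases h2 with rfl | h2
  · linarith [e1.1]
  · have := hg.hyp (p⁻¹ * x) (p⁻¹ * v) (p⁻¹ * z)
    have h3 := lt_min e1.1 (show (δ : ℝ) < gb S p v z by linarith)
    unfold gb at *
    linarith

/-- avoiding a ball around a point of the geodesic takes long -/
theorem WalkOK.avoid (hw : WalkOK S μ K lam) (hg : Geo S δ) {p w v : G} {r j : ℕ}
    (hsep : gb S p w v ≤ 2 * δ) (hr : (3 * δ + 1 + K + 4 * δ * j : ℕ) ≤ r)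
    (hv : v ∉ {g | wd S p g ≤ r}) {n : ℕ} (hn : n < 4 ^ j) :
    q μ {g | wd S p g ≤ r} n w v = 0 := by
  by_contra h
  obtain ⟨y, h0, h1, h2⟩ := hw.q_path _ n w v h
  obtain ⟨i, hi, hi2⟩ := chain hg (fun i => p⁻¹ * y i) n K (2 * δ + 1)
    (fun i hi => by rw [wd_left]; exact (h2 i hi).2) (by
      simp only [h0, h1]; unfold gb at hsep; linarith)
  have hd : (0 : ℝ) ≤ δ := Nat.cast_nonneg _
  have hl : Nat.log 2 (i + 1) ≤ 2 * j := by
    have : i + 1 ≤ 2 ^ (2 * j) := by rw [pow_mul]; norm_num; omega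
    calc Nat.log 2 (i + 1) ≤ Nat.log 2 (2 ^ (2 * j)) := Nat.log_mono_right this
      _ = 2 * j := Nat.log_pow (by norm_num) _
  have hl' : (Nat.log 2 (i + 1) : ℝ) ≤ 2 * j := by exact_mod_cast hl
  have hr' : (3 * δ + 1 + K + 4 * δ * j : ℝ) ≤ r := by exact_mod_cast hr
  have hout : r < wd S p (y i) := by
    rcases hi.lt_or_eq with hi | rfl
    · have := (h2 i hi).1
      simpa using this
    · rw [h1]; simpa using hv
  have hout' : (r : ℝ) < wd S p (y i) := by exact_mod_cast hout
  rw [len_wd] at hi2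
  nlinarith

def nb (S : Finset G) (γ : ℕ → G) (x : G) (n r : ℕ) : Set G :=
  {g | (n < wordLength S x ∧ wd S (γ n) g ≤ r) ∨ (wordLength S x ≤ n ∧ g = x)}

structure Gd (S : Finset G) (γ : ℕ → G) (x : G) : Prop where
  zero : γ 0 = 1
  last : γ (wordLength S x) = x
  geo : ∀ i j, i ≤ j → j ≤ wordLength S x → wd S (γ i) (γ j) = j - i

theorem Gd.wx {γ : ℕ → G} {x : G} (h : Gd S γ x) {i : ℕ} (hi : i ≤ wordLength S x) :
    wd S (γ i) x = wordLength S x - i := by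
  have := h.geo i _ hi le_rfl
  rwa [h.last] at this

theorem Gd.w1 (hS : Generates S) {γ : ℕ → G} {x : G} (h : Gd S γ x) {i : ℕ}
    (hi : i ≤ wordLength S x) : wordLength S (γ i) = i := by
  have := h.geo 0 i (by omega) hi
  rwa [h.zero, wd_one_left] at this

/-- concatenated geodesics -/
theorem Gd.cross (hS : Generates S) {γ γ' : ℕ → G} {x z : G} (h : Gd S γ x) (h' : Gd S γ' z)
    (hxz : gp S x z = 0) {i j : ℕ} (hi : i ≤ wordLength S x) (hj : j ≤ wordLength S z) :
    wd S (γ i) (γ' j) = i + j := by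
  have a1 := wd_tri hS (γ i) 1 (γ' j)
  rw [wd_one_right hS, wd_one_left, h.w1 hS hi, h'.w1 hS hj] at a1
  have a2 := wd_tri hS x (γ i) z
  have a3 := wd_tri hS (γ i) (γ' j) z
  rw [wd_comm hS x (γ i), h.wx hi] at a2
  rw [h'.wx hj] at a3
  have a4 : (wd S x z : ℝ) = wordLength S x + wordLength S z := by
    unfold gp at hxz; rw [len_wd] at hxz; unfold len at hxz; linarith
  have a5 : wd S x z = wordLength S x + wordLength S z := by exact_mod_cast a4
  omega

theorem gb_near (hS : Generates S) (p a g x : G) (r : ℕ) (h : wd S a g ≤ r) :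
    gb S p a x - r ≤ gb S p g x := by
  rw [gb_eq, gb_eq]
  have h1 := wd_tri hS p g a
  have h2 := wd_tri hS g a x
  rw [wd_comm hS g a] at h1 h2
  have h1' : (wd S p a : ℝ) ≤ wd S p g + wd S a g := by exact_mod_cast h1
  have h2' : (wd S g x : ℝ) ≤ wd S a g + wd S a x := by exact_mod_cast h2
  have h' : (wd S a g : ℝ) ≤ r := by exact_mod_cast h
  linarith

/-- the basic avoidance estimate: `w` beyond `γ n`, `v` on the other side -/
theorem WalkOK.avoid2 (hw : WalkOK S μ K lam) (hg : Geo S δ) {γ γ' : ℕ → G} {x z w v : G}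
    (h : Gd S γ x) (h' : Gd S γ' z) (hxz : gp S x z = 0) {j r r1 r2 n n2 : ℕ}
    (hr : 3 * δ + 1 + K + 4 * δ * j ≤ r) (hn : 2 * δ + r1 < n) (hn2 : 2 * δ + r2 < n)
    (hwm : w ∈ nb S γ x (2 * n) r1) (hvm : v ∈ nb S γ' z n2 r2) :
    (nb S γ x n r)ᶜ.indicator (fun v => gU μ (nb S γ x n r) w v) v
      ≤ ENNReal.ofReal (lam ^ (4 ^ j) / (1 - lam)) := by
  have hS := hg.gen
  by_cases hvU : v ∈ nb S γ x n r
  · rw [Set.indicator_of_notMem (by simpa using hvU)]; exact zero_le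
  rw [Set.indicator_of_mem (by simpa using hvU)]
  refine hw.gU_le_of_avoid _ fun m hm => ?_
  by_cases hnx : n < wordLength S x
  · have e : nb S γ x n r = {g | wd S (γ n) g ≤ r} := by
      ext g; unfold nb; simp [hnx]
    rw [e] at hvU ⊢
    refine hw.avoid hg ?_ hr hvU hm
    refine thin_sep hg (x := x) (z := z) ?_ ?_ ?_
    · rcases hwm with ⟨a, b⟩ | ⟨a, b⟩
      · right
        have h1 := gb_near hS (γ n) (γ (2 * n)) w x r1 b
        rw [gb_eq, h.geo n (2 * n) (by omega) a.le, h.wx hnx.le, h.wx a.le] at h1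
        rw [Nat.cast_sub (by omega), Nat.cast_sub (by omega), Nat.cast_sub (by omega)] at h1
        have : (2 * δ + r1 : ℝ) < n := by exact_mod_cast hn
        push_cast at h1
        linarith
      · exact Or.inl b
    · rcases hvm with ⟨a, b⟩ | ⟨a, b⟩
      · right
        have h1 := gb_near hS (γ n) (γ' n2) v z r2 b
        have h2 := h.cross hS h' hxz hnx.le le_rfl
        rw [h'.last] at h2
        rw [gb_eq, h.cross hS h' hxz hnx.le a.le, h2, h'.wx a.le, Nat.cast_sub a.le] at h1
        have : (2 * δ + r2 : ℝ) < n := by exact_mod_cast hn2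
        push_cast at h1
        have : (0 : ℝ) ≤ n2 := Nat.cast_nonneg _
        linarith
      · exact Or.inl b
    · have h2 := h.cross hS h' hxz hnx.le le_rfl
      have h3 := h.cross hS h' hxz le_rfl le_rfl
      rw [h'.last] at h2 h3
      rw [h.last] at h3
      rw [gb_eq, h2, h3, h.wx hnx.le, Nat.cast_sub hnx.le]
      push_cast; linarith
  · push Not at hnx
    have hwx : w = x := by
      rcases hwm with ⟨a, b⟩ | ⟨a, b⟩
      · omega
      · exact b
    have hwU : w ∈ nb S γ x n r := Or.inr ⟨hnx, hwx⟩
    cases m with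
    | zero =>
      have : w ≠ v := by rintro rfl; exact hvU hwU
      simp [q, dl, this]
    | succ m => exact q_succ_mem μ hwU m v

theorem nb_len (hS : Generates S) {γ : ℕ → G} {x w : G} (h : Gd S γ x) {n r : ℕ}
    (hwm : w ∈ nb S γ x n r) : wordLength S w ≤ n + r := by
  rcases hwm with ⟨a, b⟩ | ⟨a, b⟩
  · have := wd_tri hS 1 (γ n) w
    rw [wd_one_left, wd_one_left, h.w1 hS a.le] at this
    omega
  · subst b; omega

theorem ancona_num (B : ℕ) : ∃ k0, 1 ≤ k0 ∧ ∀ j ≥ k0, B * (j + 1) < 2 ^ j := by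
  refine ⟨4 * B + 2, by omega, fun j hj => ?_⟩
  have h1 : j / 2 < 2 ^ (j / 2) := Nat.lt_two_pow_self
  have h2 : 2 ^ (j / 2) * 2 ^ (j / 2) ≤ 2 ^ j := by
    rw [← pow_add]; exact Nat.pow_le_pow_right (by norm_num) (by omega)
  have h3 : j + 1 ≤ 2 * 2 ^ (j / 2) := by omega
  have h4 : 2 * B < 2 ^ (j / 2) := by omega
  nlinarith

end

/-! ## M5b -/
set_option linter.unusedSectionVars false
set_option linter.unusedVariables false
section
variable {S : Finset G} {δ : ℕ} {μ : G → ℝ} {K : ℕ} {lam : ℝ}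

/-- one half-step of the Ancona induction -/
theorem ancona_half (U : Set G) (w v : G) (A e : ℝ≥0∞)
    (h1 : ∀ u ∈ U, Gr μ u v ≤ A * (Gr μ u 1 * Gr μ 1 v))
    (h2 : Uᶜ.indicator (fun v => gU μ U w v) v ≤ e * (Gr μ w 1 * Gr μ 1 v)) :
    Gr μ w v ≤ (A + e) * (Gr μ w 1 * Gr μ 1 v) := by
  refine (Gr_le μ U w v).trans ?_
  rw [add_mul]
  refine add_le_add ?_ h2
  calc ∑' u, U.indicator (fun u => gU μ U w u * Gr μ u v) u
      ≤ ∑' u, (A * Gr μ 1 v) * U.indicator (fun u => gU μ U w u * Gr μ u 1) u := by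
        refine ENNReal.tsum_le_tsum fun u => ?_
        by_cases hu : u ∈ U
        · simp only [Set.indicator_of_mem hu]
          calc _ ≤ gU μ U w u * (A * (Gr μ u 1 * Gr μ 1 v)) := by gcongr; exact h1 u hu
            _ = _ := by ring
        · simp [Set.indicator_of_notMem hu]
    _ = (A * Gr μ 1 v) * ∑' u, U.indicator (fun u => gU μ U w u * Gr μ u 1) u :=
        ENNReal.tsum_mul_left
    _ ≤ (A * Gr μ 1 v) * Gr μ w 1 := by gcongr; exact superharm_Gr μ U w 1
    _ = _ := by ring

theorem WalkOK.ancona0 (hw : WalkOK S μ K lam) (hg : Geo S δ) :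
    ∃ C : ℝ≥0∞, C ≠ ⊤ ∧ ∀ x z, gp S x z = 0 → Gr μ x z ≤ C * (Gr μ x 1 * Gr μ 1 z) := by
  have hS := hg.gen
  obtain ⟨c, hc0, hc1, hc⟩ := hw.Gr_lower hS
  obtain ⟨a, ha⟩ := exists_pow_lt_of_lt_one (show 0 < c ^ 8 / 2 by positivity) hw.lam_lt
  set β := 7 * δ + 1 + K with hβ
  obtain ⟨k0, hk1, hk0⟩ := ancona_num (β + 2 * δ + a)
  have num : ∀ j ≥ k0, 2 * δ + β * (j + 1) < 2 ^ j ∧ a ≤ 2 ^ j := by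
    intro j hj
    have := hk0 j hj
    constructor <;> nlinarith
  have hl1 : 0 < 1 - lam := by linarith [hw.lam_lt]
  have low : ∀ w v N, wordLength S w ≤ N → wordLength S v ≤ N →
      ENNReal.ofReal (c ^ (2 * N)) ≤ Gr μ w 1 * Gr μ 1 v := by
    intro w v N h1 h2
    rw [two_mul, pow_add, ENNReal.ofReal_mul (by positivity)]
    refine mul_le_mul' ((ENNReal.ofReal_le_ofReal ?_).trans (hc w 1))
      ((ENNReal.ofReal_le_ofReal ?_).trans (hc 1 v))
    · rw [wd_one_right hS]; exact pow_le_pow_of_le_one hc0.le hc1.le h1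
    · rw [wd_one_left]; exact pow_le_pow_of_le_one hc0.le hc1.le h2
  have err : ∀ j ≥ k0, ∀ w v, wordLength S w ≤ 4 * 2 ^ j → wordLength S v ≤ 4 * 2 ^ j →
      ENNReal.ofReal (lam ^ (4 ^ j) / (1 - lam)) ≤
        (ENNReal.ofReal (1 / (1 - lam)) * 2⁻¹ ^ j) * (Gr μ w 1 * Gr μ 1 v) := by
    intro j hj w v h1 h2
    refine le_trans ?_ (mul_le_mul_right (low w v _ h1 h2) _)
    have e : (2⁻¹ : ℝ≥0∞) ^ j = ENNReal.ofReal ((1 / 2) ^ j) := by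
      rw [ENNReal.ofReal_pow (by norm_num)]
      congr 1
      rw [one_div, ENNReal.ofReal_inv_of_pos (by norm_num)]; norm_num
    rw [e, ← ENNReal.ofReal_mul (by positivity), ← ENNReal.ofReal_mul (by positivity)]
    refine ENNReal.ofReal_le_ofReal ?_
    have b1 : lam ^ (4 ^ j) ≤ (c ^ 8 / 2) ^ (2 ^ j) := by
      rw [show (4 : ℕ) ^ j = 2 ^ j * 2 ^ j by rw [← mul_pow]; norm_num, pow_mul]
      refine pow_le_pow_left₀ (pow_nonneg hw.lam_pos.le _) ?_ _
      exact (pow_le_pow_of_le_one hw.lam_pos.le hw.lam_lt.le (num j hj).2).trans ha.le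
    have b2 : (c ^ 8 / 2) ^ (2 ^ j) ≤ (1 / 2) ^ j * c ^ (2 * (4 * 2 ^ j)) := by
      rw [show c ^ 8 / 2 = (1 / 2) * c ^ 8 by ring, mul_pow, ← pow_mul c 8,
        show 2 * (4 * 2 ^ j) = 8 * 2 ^ j by ring]
      gcongr ?_ * _
      exact pow_le_pow_of_le_one (by norm_num) (by norm_num) Nat.lt_two_pow_self.le
    calc lam ^ (4 ^ j) / (1 - lam) ≤ ((1 / 2) ^ j * c ^ (2 * (4 * 2 ^ j))) / (1 - lam) := by
          gcongr; exact b1.trans b2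
      _ = _ := by ring
  set E : ℕ → ℝ≥0∞ := fun k => ENNReal.ofReal (1 / (1 - lam)) * 2⁻¹ ^ (k + k0) with hE
  set A0 : ℝ≥0∞ := ENNReal.ofReal (1 / (1 - lam) / c ^ (2 * (2 ^ k0 + β * k0))) with hA0
  refine ⟨A0 + ∑' k, 2 * E k, ?_, ?_⟩
  · refine ENNReal.add_ne_top.2 ⟨ENNReal.ofReal_ne_top, ?_⟩
    have : ∑' k, 2 * E k ≤ 2 * ENNReal.ofReal (1 / (1 - lam)) * ∑' k : ℕ, (2⁻¹ : ℝ≥0∞) ^ k := by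
      rw [← ENNReal.tsum_mul_left]
      refine ENNReal.tsum_le_tsum fun k => ?_
      rw [hE]; simp only
      rw [pow_add, ← mul_assoc, ← mul_assoc]
      refine mul_le_of_le_one_right' (pow_le_one' (by simp) _)
    refine ne_top_of_le_ne_top ?_ this
    rw [ENNReal.tsum_geometric, ENNReal.one_sub_inv_two, inv_inv]
    exact ENNReal.mul_ne_top (ENNReal.mul_ne_top (by simp) ENNReal.ofReal_ne_top) (by simp)
  intro x z hxz
  obtain ⟨γ, g0, g1, g2⟩ := exists_geod hS x
  obtain ⟨γ', g0', g1', g2'⟩ := exists_geod hS z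
  have hγ : Gd S γ x := ⟨g0, g1, g2⟩
  have hγ' : Gd S γ' z := ⟨g0', g1', g2'⟩
  have hzx : gp S z x = 0 := by rw [gp_comm hS, hxz]
  have main : ∀ k, ∀ w ∈ nb S γ x (2 ^ (k + k0)) (β * (k + k0)),
      ∀ v ∈ nb S γ' z (2 ^ (k + k0)) (β * (k + k0)),
      Gr μ w v ≤ (A0 + ∑ j ∈ Finset.range k, 2 * E j) * (Gr μ w 1 * Gr μ 1 v) := by
    intro k
    induction k with
    | zero =>
      intro w hw1 v hv1
      rw [zero_add] at hw1 hv1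
      have l1 := low w v _ (nb_len hS hγ hw1) (nb_len hS hγ' hv1)
      simp only [Finset.range_zero, Finset.sum_empty, add_zero]
      refine le_trans ?_ (mul_le_mul_right l1 _)
      rw [hA0, ← ENNReal.ofReal_mul (by positivity), div_mul_cancel₀ _ (by positivity)]
      exact hw.Gr_le_const w v
    | succ k ih =>
      intro w hw1 v hv1
      set j := k + k0 with hj
      have ej : k + 1 + k0 = j + 1 := by omega
      rw [ej] at hw1 hv1
      have nj := (num j (by omega)).1
      have hp : 2 ^ (j + 1) = 2 * 2 ^ j := pow_succ' _ _
      have hr : 3 * δ + 1 + K + 4 * δ * j ≤ β * j := by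
        have : 1 ≤ j := by omega
        rw [hβ]; nlinarith
      have hβj : β * j ≤ β * (j + 1) := Nat.mul_le_mul_left _ (by omega)
      have lw := nb_len hS hγ hw1
      have lv := nb_len hS hγ' hv1
      have step1 : ∀ u ∈ nb S γ x (2 ^ j) (β * j),
          Gr μ u v ≤ ((A0 + ∑ j ∈ Finset.range k, 2 * E j) + E k) * (Gr μ u 1 * Gr μ 1 v) := by
        intro u hu
        have lu := nb_len hS hγ hu
        have := ancona_half (nb S γ' z (2 ^ j) (β * j)) v u (A0 + ∑ j ∈ Finset.range k, 2 * E j) (E k)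
          (fun t ht => by
            have := ih u hu t ht
            rw [Gr_symm hw.symm t u, Gr_symm hw.symm t 1, Gr_symm hw.symm 1 u, mul_comm (Gr μ 1 t)]
            exact this)
          ((hw.avoid2 hg hγ' hγ hzx (r1 := β * (j + 1)) (r2 := β * j) hr (by omega) (by omega)
            (by rw [← hp]; exact hv1) hu).trans
            (err j (by omega) v u (by omega) (by omega)))
        rw [Gr_symm hw.symm u v, Gr_symm hw.symm u 1, Gr_symm hw.symm 1 v, mul_comm (Gr μ 1 u)]
        exact this
      have := ancona_half (nb S γ x (2 ^ j) (β * j)) w v _ (E k) step1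
        ((hw.avoid2 hg hγ hγ' hxz (r1 := β * (j + 1)) (r2 := β * (j + 1)) hr (by omega) (by omega)
            (by rw [← hp]; exact hw1) hv1).trans (err j (by omega) w v (by omega) (by omega)))
      rw [Finset.sum_range_succ, two_mul (E k)]
      rw [← add_assoc, ← add_assoc]
      exact this
  set k := wordLength S x + wordLength S z
  have hk : wordLength S x + wordLength S z < 2 ^ (k + k0) :=
    lt_of_lt_of_le Nat.lt_two_pow_self (Nat.pow_le_pow_right (by norm_num) (by omega))
  refine (main k x (Or.inr ⟨by omega, rfl⟩) z (Or.inr ⟨by omega, rfl⟩)).trans ?_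
  gcongr
  exact ENNReal.sum_le_tsum _

/-! real form -/
/-- `X = -log G(1,·)` -/
def XG (μ : G → ℝ) (g : G) : ℝ := -Real.log (greenFn μ 1 g)

theorem WalkOK.green_pos (hw : WalkOK S μ K lam) (w v : G) : 0 < greenFn μ w v := by
  rw [hw.greenFn_eq]
  exact ENNReal.toReal_pos (hw.Gr_pos w v) (hw.Gr_ne_top w v)

theorem WalkOK.green_eq_exp (hw : WalkOK S μ K lam) (g : G) : greenFn μ 1 g = Real.exp (-XG μ g) := by
  unfold XG; rw [neg_neg, Real.exp_log (hw.green_pos 1 g)]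

theorem WalkOK.green_one (hw : WalkOK S μ K lam) (w v : G) : greenFn μ w v = greenFn μ 1 (w⁻¹ * v) := by
  rw [hw.greenFn_eq, hw.greenFn_eq, Gr_eq_one]

theorem WalkOK.X_inv (hw : WalkOK S μ K lam) (g : G) : XG μ g⁻¹ = XG μ g := by
  unfold XG; rw [hw.greenFn_eq, hw.greenFn_eq, Gr_symm hw.symm, Gr_eq_one]; simp

theorem WalkOK.X_props (hw : WalkOK S μ K lam) (hg : Geo S δ) :
    ∃ C : ℝ, 0 ≤ C ∧ (∀ g h, XG μ (g * h) ≤ XG μ g + XG μ h + C) ∧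
      (∀ g h, XG μ g + XG μ h - C * (1 + gp S g⁻¹ h) ≤ XG μ (g * h)) ∧
      (∀ g, |XG μ g| ≤ C * (1 + len S g)) := by
  have hS := hg.gen
  obtain ⟨c, hc0, hc1, hc⟩ := hw.Gr_lower hS
  obtain ⟨D, hD, hanc⟩ := hw.ancona0 hg
  set L := -Real.log c
  have hL : 0 < L := by have := Real.log_neg hc0 hc1; simp only [L]; linarith
  set C1 := Real.log (greenFn μ 1 1)
  have g11 : 1 ≤ greenFn μ 1 1 := by
    rw [hw.greenFn_eq]
    have := ENNReal.toReal_mono (hw.Gr_ne_top 1 1) (one_le_Gr μ)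
    simpa using this
  have hC1 : 0 ≤ C1 := Real.log_nonneg g11
  have a1 : ∀ g h, XG μ (g * h) ≤ XG μ g + XG μ h + C1 := by
    intro g h
    have h1 := ENNReal.toReal_mono (ENNReal.mul_ne_top (hw.Gr_ne_top _ _) (hw.Gr_ne_top _ _))
      (Gr_mul_le μ 1 g (g * h))
    rw [ENNReal.toReal_mul, ENNReal.toReal_mul, ← hw.greenFn_eq, ← hw.greenFn_eq, ← hw.greenFn_eq,
      ← hw.greenFn_eq, hw.green_one g, inv_mul_cancel_left] at h1
    have p1 := hw.green_pos 1 g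
    have p2 := hw.green_pos 1 h
    have p3 := hw.green_pos 1 (g * h)
    have h2 := Real.log_le_log (by positivity) h1
    rw [Real.log_mul p1.ne' p2.ne', Real.log_mul (by positivity) p3.ne'] at h2
    unfold XG; linarith
  have a3 : ∀ g, XG μ g ≤ L * len S g := by
    intro g
    have h1 := ENNReal.toReal_mono (hw.Gr_ne_top _ _) (hc 1 g)
    rw [ENNReal.toReal_ofReal (by positivity), ← hw.greenFn_eq, wd_one_left] at h1
    have h2 := Real.log_le_log (by positivity) h1
    rw [Real.log_pow] at h2
    unfold XG len; simp only [L]; linarith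
  have a3' : ∃ C2, 0 ≤ C2 ∧ ∀ g, -C2 ≤ XG μ g := by
    have hl1 : 0 < 1 - lam := by linarith [hw.lam_lt]
    refine ⟨|Real.log (1 / (1 - lam))|, abs_nonneg _, fun g => ?_⟩
    have h1 := ENNReal.toReal_mono ENNReal.ofReal_ne_top (hw.Gr_le_const 1 g)
    rw [ENNReal.toReal_ofReal (by positivity), ← hw.greenFn_eq] at h1
    have h2 := Real.log_le_log (hw.green_pos 1 g) h1
    have := le_abs_self (Real.log (1 / (1 - lam)))
    unfold XG; linarith
  obtain ⟨C2, hC2, a4⟩ := a3'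
  -- aligned case
  have al : ∃ C3, 0 ≤ C3 ∧ ∀ x z, gp S x z = 0 → XG μ x + XG μ z ≤ XG μ (x⁻¹ * z) + C3 := by
    refine ⟨|Real.log D.toReal|, abs_nonneg _, fun x z hxz => ?_⟩
    have h1 := ENNReal.toReal_mono (ENNReal.mul_ne_top hD (ENNReal.mul_ne_top (hw.Gr_ne_top _ _)
      (hw.Gr_ne_top _ _))) (hanc x z hxz)
    rw [ENNReal.toReal_mul, ENNReal.toReal_mul, ← hw.greenFn_eq, ← hw.greenFn_eq, ← hw.greenFn_eq,
      hw.green_one x z, hw.green_one x 1, mul_one] at h1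
    have p1 := hw.green_pos 1 x⁻¹
    have p2 := hw.green_pos 1 z
    have p3 := hw.green_pos 1 (x⁻¹ * z)
    have pD : 0 < D.toReal := by
      by_contra! hcon
      have : D.toReal * (greenFn μ 1 x⁻¹ * greenFn μ 1 z) ≤ 0 :=
        mul_nonpos_of_nonpos_of_nonneg hcon (by positivity)
      linarith
    have h2 := Real.log_le_log (by positivity) h1
    rw [Real.log_mul pD.ne' (by positivity), Real.log_mul p1.ne' p2.ne'] at h2
    have := le_abs_self (Real.log D.toReal)
    rw [← hw.X_inv x]
    unfold XG; linarith
  obtain ⟨C3, hC3, al⟩ := al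
  -- general case
  have gen : ∀ g h, XG μ g + XG μ h ≤ XG μ (g * h) + C3 + 2 * C1 + 2 * L * (gp S g⁻¹ h + 1 + 2 * δ) := by
    intro g h
    set y := g * h with hy
    have hfl : ⌊gp S g y⌋₊ ≤ wordLength S y := by
      have := gp_le_right hS g y
      exact Nat.floor_le_of_le this
    obtain ⟨p, k, e, hp, hk⟩ := exists_split hS y hfl
    have hkn : (wordLength S k : ℝ) = wordLength S y - ⌊gp S g y⌋₊ := by
      rw [hk, Nat.cast_sub hfl]
    have hpk : gp S p⁻¹ k = 0 := by
      unfold gp; rw [inv_inv, ← e, len_inv hS]; unfold len; rw [hkn, hp]; ring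
    have hpy : gp S p y = len S p := by
      have := gp_ident hS p k
      rw [← e] at this; linarith
    have hpl : len S p = ⌊gp S g y⌋₊ := by unfold len; rw [hp]
    have f1 := Nat.floor_le (gp_nonneg hS g y)
    have f2 := Nat.lt_floor_add_one (gp S g y)
    have hgpp : len S p ≤ gp S g p + δ := by
      have := hg.hyp g y p
      rw [gp_comm hS y p, hpy] at this
      rw [← hpl] at f1
      rw [min_eq_right f1] at this
      exact this
    have hdist : len S (g⁻¹ * p) ≤ gp S g⁻¹ h + 1 + 2 * δ := by
      have h1 : gp S g y + gp S g⁻¹ h = len S g := gp_ident hS g h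
      have h2 : gp S g p = (len S g + len S p - len S (g⁻¹ * p)) / 2 := rfl
      rw [hpl] at hgpp h2
      linarith
    have b1 := al p⁻¹ k hpk
    rw [inv_inv, ← e, hw.X_inv] at b1
    have b2 := a1 p (p⁻¹ * g)
    rw [mul_inv_cancel_left] at b2
    have b3 := a1 (g⁻¹ * p) k
    rw [show g⁻¹ * p * k = h by rw [mul_assoc, ← e, hy]; group] at b3
    have b4 := a3 (g⁻¹ * p)
    have b5 := a3 (p⁻¹ * g)
    rw [len_swap hS p g] at b5
    have b6 : L * len S (g⁻¹ * p) ≤ L * (gp S g⁻¹ h + 1 + 2 * δ) := by gcongr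
    linarith
  have hd : (0 : ℝ) ≤ δ := Nat.cast_nonneg _
  refine ⟨C1 + C2 + C3 + 2 * C1 + 2 * L * (2 + 2 * δ), by positivity, ?_, ?_, ?_⟩
  · intro g h
    have := a1 g h
    have : 0 ≤ 2 * L * (2 + 2 * δ) := by positivity
    linarith
  · intro g h
    have h1 := gen g h
    have h2 := gp_nonneg hS g⁻¹ h
    have h3 : 0 ≤ L * δ := by positivity
    have h4 : 0 ≤ L * δ * gp S g⁻¹ h := by positivity
    have h5 : 0 ≤ L * gp S g⁻¹ h := by positivity
    have h6 : 0 ≤ C1 * gp S g⁻¹ h := by positivity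
    have h7 : 0 ≤ C2 * gp S g⁻¹ h := by positivity
    have h8 : 0 ≤ C3 * gp S g⁻¹ h := by positivity
    nlinarith
  · intro g
    have h1 := a3 g
    have h2 := a4 g
    have h0 := len_nonneg S g
    have h3 : 0 ≤ L * δ := by positivity
    have h4 : 0 ≤ L * δ * len S g := by positivity
    have h5 : 0 ≤ L * len S g := by positivity
    have h6 : 0 ≤ C1 * len S g := by positivity
    have h7 : 0 ≤ C2 * len S g := by positivity
    have h8 : 0 ≤ C3 * len S g := by positivity
    rw [abs_le]; constructor <;> nlinarith

end

/-! ## M6 -/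
set_option linter.unusedSectionVars false
set_option linter.unusedVariables false
section
theorem walkPos_zero (ω : ℕ → G) : walkPos 0 ω = 1 := rfl
theorem walkPos_succ (n : ℕ) (ω : ℕ → G) : walkPos (n + 1) ω = walkPos n ω * ω n := by
  simp [walkPos, List.range_succ]
def sh (n : ℕ) (ω : ℕ → G) : ℕ → G := fun i => ω (n + i)
theorem walkPos_add (n k : ℕ) (ω : ℕ → G) :
    walkPos (n + k) ω = walkPos n ω * walkPos k (sh n ω) := by
  induction k with
  | zero => simp [walkPos_zero]
  | succ k ih => rw [← add_assoc, walkPos_succ, ih, walkPos_succ, mul_assoc]; rfl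
theorem walkPos_one (ω : ℕ → G) : walkPos 1 ω = ω 0 := by rw [walkPos_succ, walkPos_zero, one_mul]
theorem walkPos_congr (n : ℕ) (ω ω' : ℕ → G) (h : ∀ i < n, ω i = ω' i) :
    walkPos n ω = walkPos n ω' := by
  induction n with
  | zero => rfl
  | succ n ih =>
    rw [walkPos_succ, walkPos_succ, h n (by omega), ih fun i hi => h i (by omega)]

/-- `C` depends only on the first `n` increments -/
def Dep (n : ℕ) (C : Set (ℕ → G)) : Prop := ∀ ω ω', (∀ i < n, ω i = ω' i) → ω ∈ C → ω' ∈ C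

theorem dep_pos {n k : ℕ} (hk : k ≤ n) (A : Set G) : Dep n {ω | walkPos k ω ∈ A} := by
  intro ω ω' h hω
  rwa [mem_ofPred_eq, ← walkPos_congr k ω ω' fun i hi => h i (by omega)]

theorem Dep.inter {n : ℕ} {C D : Set (ℕ → G)} (hC : Dep n C) (hD : Dep n D) : Dep n (C ∩ D) :=
  fun ω ω' h hω => ⟨hC ω ω' h hω.1, hD ω ω' h hω.2⟩

/-- first entrance in `Λ` at time `n`, at the point `z` -/
def fst (Λ : Set G) (n : ℕ) (z : G) : Set (ℕ → G) :=
  {ω | (∀ k < n, walkPos k ω ∉ Λ) ∧ walkPos n ω ∈ Λ ∧ walkPos n ω = z}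

theorem dep_fst (Λ : Set G) (n : ℕ) (z : G) : Dep n (fst Λ n z) := by
  intro ω ω' h hω
  have e : ∀ k ≤ n, walkPos k ω' = walkPos k ω :=
    fun k hk => (walkPos_congr k ω ω' fun i hi => h i (by omega)).symm
  refine ⟨fun k hk => ?_, ?_⟩
  · rw [e k hk.le]; exact hω.1 k hk
  · rw [e n le_rfl]; exact hω.2

variable [Countable G] [MeasurableSpace G] [MeasurableSingletonClass G]
variable {μ : G → ℝ} {P : Measure (ℕ → G)}

theorem meas_sh (n : ℕ) : Measurable (sh n : (ℕ → G) → (ℕ → G)) := by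
  rw [measurable_pi_iff]; intro i; exact measurable_pi_apply _

theorem meas_pos (n : ℕ) : Measurable (walkPos n : (ℕ → G) → G) := by
  induction n with
  | zero => exact measurable_const
  | succ n ih =>
    have : (walkPos (n + 1) : (ℕ → G) → G) = (fun p : G × G => p.1 * p.2) ∘ fun ω => (walkPos n ω, ω n) := by
      funext ω; exact walkPos_succ n ω
    rw [this]
    exact (measurable_of_countable _).comp (ih.prodMk (measurable_pi_apply n))

theorem ms_pos (n : ℕ) (A : Set G) : MeasurableSet {ω : ℕ → G | walkPos n ω ∈ A} :=
  meas_pos n (MeasurableSet.of_discrete)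

theorem Dep.eq {n : ℕ} {C : Set (ℕ → G)} (hC : Dep n C) :
    C = (fun ω (i : Fin n) => ω i) ⁻¹' {g | ∃ ω ∈ C, (fun i : Fin n => ω i) = g} := by
  ext ω; constructor
  · intro h; exact ⟨ω, h, rfl⟩
  · rintro ⟨ω', h, e⟩
    exact hC ω' ω (fun i hi => congrFun e ⟨i, hi⟩) h

theorem meas_restr (n : ℕ) : Measurable (fun (ω : ℕ → G) (i : Fin n) => ω i) := by
  rw [measurable_pi_iff]; intro i; exact measurable_pi_apply _

theorem Dep.meas {n : ℕ} {C : Set (ℕ → G)} (hC : Dep n C) : MeasurableSet C := by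
  rw [hC.eq]; exact meas_restr n (MeasurableSet.of_discrete)

def cyl (k : ℕ) (ω : ℕ → G) : Set (ℕ → G) := {ω' | ∀ i < k, ω' i = ω i}

theorem cyl_eq (k : ℕ) (ω : ℕ → G) : cyl k ω = {ω' | ∀ i : Fin k, ω' (i : ℕ) = ω i} := by
  ext ω'; exact ⟨fun h i => h i i.2, fun h i hi => h ⟨i, hi⟩⟩

theorem ms_cyl (k : ℕ) (ω : ℕ → G) : MeasurableSet (cyl k ω) :=
  Dep.meas (n := k) fun a b h ha i hi => by rw [← h i hi]; exact ha i hi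

theorem P_cyl (hP : IsWalkMeasure μ P) (k : ℕ) (ω : ℕ → G) :
    P (cyl k ω) = ∏ i ∈ Finset.range k, mE μ (ω i) := by
  rw [cyl_eq, hP.2 k (fun i => ω i), Finset.prod_range]; rfl

theorem gen_cyl : (MeasurableSpace.pi : MeasurableSpace (ℕ → G)) =
    MeasurableSpace.generateFrom {C | ∃ k ω, C = cyl k ω} := by
  apply le_antisymm
  · refine iSup_le fun i => ?_
    rintro _ ⟨A, -, rfl⟩
    have : (fun ω : ℕ → G => ω i) ⁻¹' A = ⋃ g : {g : Fin (i + 1) → G // g ⟨i, by omega⟩ ∈ A},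
        cyl (i + 1) (fun j => if h : j < i + 1 then g.1 ⟨j, h⟩ else 1) := by
      ext ω
      simp only [mem_preimage, mem_iUnion]
      constructor
      · intro h
        refine ⟨⟨fun j => ω j, h⟩, fun j hj => ?_⟩
        simp [hj]
      · rintro ⟨g, hg⟩
        have := hg i (by omega)
        simp at this
        rw [this]; exact g.2
    rw [this]
    refine @MeasurableSet.iUnion _ _ (MeasurableSpace.generateFrom {C | ∃ k ω, C = cyl k ω}) _ _
      fun g => ?_
    exact @MeasurableSpace.measurableSet_generateFrom _ {C | ∃ k ω, C = cyl k ω} _ ⟨_, _, rfl⟩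
  · refine MeasurableSpace.generateFrom_le ?_
    rintro _ ⟨k, ω, rfl⟩
    exact ms_cyl k ω

theorem markov_cyl (hP : IsWalkMeasure μ P) (n : ℕ) (ω : ℕ → G) {A : Set (ℕ → G)}
    (hA : MeasurableSet A) : P (cyl n ω ∩ sh n ⁻¹' A) = P (cyl n ω) * P A := by
  have := hP.1
  have h : (P.restrict (cyl n ω)).map (sh n) = P (cyl n ω) • P := by
    have : IsFiniteMeasure ((P.restrict (cyl n ω)).map (sh n)) := inferInstance
    refine ext_of_generate_finite _ gen_cyl ?_ ?_ ?_
    · rintro _ ⟨k, a, rfl⟩ _ ⟨l, b, rfl⟩ ⟨c, hc1, hc2⟩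
      refine ⟨max k l, c, ?_⟩
      ext d; constructor
      · rintro ⟨h1, h2⟩ i hi
        rcases lt_max_iff.1 hi with hi | hi
        · rw [h1 i hi, hc1 i hi]
        · rw [h2 i hi, hc2 i hi]
      · intro h
        exact ⟨fun i hi => by rw [h i (lt_max_of_lt_left hi), hc1 i hi],
          fun i hi => by rw [h i (lt_max_of_lt_right hi), hc2 i hi]⟩
    · rintro _ ⟨k, a, rfl⟩
      rw [Measure.map_apply (meas_sh n) (ms_cyl _ _), Measure.restrict_apply (meas_sh n (ms_cyl _ _))]
      have : sh n ⁻¹' cyl k a ∩ cyl n ω = cyl (n + k) (fun i => if i < n then ω i else a (i - n)) := by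
        ext d; constructor
        · rintro ⟨h1, h2⟩ i hi
          simp only
          split_ifs with h
          · exact h2 i h
          · have := h1 (i - n) (by omega)
            rw [← this]; simp [sh]; congr 1; omega
        · intro h
          refine ⟨fun i hi => ?_, fun i hi => ?_⟩
          · have := h (n + i) (by omega)
            simpa [sh] using this
          · have := h i (by omega)
            simpa [hi] using this
      rw [this, P_cyl hP, Finset.prod_range_add]
      simp only [Measure.smul_apply, smul_eq_mul]
      rw [P_cyl hP, P_cyl hP]
      congr 1
      · refine Finset.prod_congr rfl fun i hi => ?_
        rw [if_pos (Finset.mem_range.1 hi)]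
      · refine Finset.prod_congr rfl fun i hi => ?_
        simp
    · rw [Measure.map_apply (meas_sh n) MeasurableSet.univ]; simp
  have := congrArg (fun m : Measure (ℕ → G) => m A) h
  simp only [Measure.smul_apply, smul_eq_mul] at this
  rwa [Measure.map_apply (meas_sh n) hA, Measure.restrict_apply (meas_sh n hA), inter_comm] at this

theorem markov (hP : IsWalkMeasure μ P) {n : ℕ} {C : Set (ℕ → G)} (hC : Dep n C) {A : Set (ℕ → G)}
    (hA : MeasurableSet A) : P (C ∩ sh n ⁻¹' A) = P C * P A := by
  set D := {g : Fin n → G | ∃ ω ∈ C, (fun i : Fin n => ω i) = g} with hD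
  set r := fun (ω : ℕ → G) (i : Fin n) => ω i
  have hr : ∀ y ∈ D, MeasurableSet (r ⁻¹' {y}) := fun y _ => meas_restr n (MeasurableSet.of_discrete)
  have h1 := tsum_measure_preimage_singleton (μ := P.restrict (sh n ⁻¹' A)) (to_countable D) hr
  have h2 := tsum_measure_preimage_singleton (μ := P) (to_countable D) hr
  rw [← hC.eq] at h1 h2
  rw [Measure.restrict_apply hC.meas] at h1
  rw [← h1, ← h2, ← ENNReal.tsum_mul_right]
  refine tsum_congr fun g => ?_
  obtain ⟨g, ω, hω, rfl⟩ := g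
  have : r ⁻¹' {fun i : Fin n => ω i} = cyl n ω := by
    ext a; simp only [mem_preimage, mem_singleton_iff]
    exact ⟨fun h i hi => congrFun h ⟨i, hi⟩, fun h => funext fun i => h i i.2⟩
  rw [Measure.restrict_apply (hr _ ⟨ω, hω, rfl⟩), this, markov_cyl hP n ω hA]

theorem law (hP : IsWalkMeasure μ P) (n : ℕ) (g : G) : P {ω | walkPos n ω = g} = q μ ∅ n 1 g := by
  have := hP.1
  induction n generalizing g with
  | zero =>
    by_cases h : 1 = g
    · simp [walkPos_zero, q, dl, h]
    · simp [walkPos_zero, q, dl, h]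
  | succ n ih =>
    rw [q_right]
    have e : {ω : ℕ → G | walkPos (n + 1) ω = g} =
        ⋃ y, {ω | walkPos n ω ∈ ({y} : Set G)} ∩ sh n ⁻¹' (cyl 1 fun _ => y⁻¹ * g) := by
      ext ω
      simp only [mem_ofPred_eq, mem_iUnion, mem_inter_iff, mem_singleton_iff, mem_preimage, walkPos_succ]
      constructor
      · intro h
        refine ⟨walkPos n ω, rfl, fun i hi => ?_⟩
        have : i = 0 := by omega
        subst this
        simp [sh, ← h]
      · rintro ⟨y, h1, h2⟩
        have := h2 0 (by omega)
        simp [sh] at this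
        rw [h1, this]; simp
    rw [e, measure_iUnion]
    · refine tsum_congr fun y => ?_
      rw [markov hP (dep_pos le_rfl {y}) (ms_cyl _ _), P_cyl hP]
      have := ih y
      simp only [mem_singleton_iff]
      rw [this]; simp
    · intro y y' hne
      refine Set.disjoint_left.2 ?_
      rintro ω ⟨h1, -⟩ ⟨h2, -⟩
      exact hne (by rw [← show walkPos n ω = y from h1, ← show walkPos n ω = y' from h2])
    · intro y
      exact (ms_pos n _).inter (meas_sh n (ms_cyl _ _))

theorem law_set (hP : IsWalkMeasure μ P) (n : ℕ) (A : Set G) :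
    P {ω | walkPos n ω ∈ A} = ∑' g, A.indicator (fun g => q μ ∅ n 1 g) g := by
  have h2 := tsum_measure_preimage_singleton (μ := P) (f := walkPos n) (to_countable A)
    (fun y _ => ms_pos n _)
  rw [tsum_subtype A (fun b => P (walkPos n ⁻¹' {b}))] at h2
  change P (walkPos n ⁻¹' A) = _
  rw [← h2]
  refine tsum_congr fun g => ?_
  by_cases hg : g ∈ A
  · simp only [indicator_of_mem hg]; exact law hP n g
  · simp [indicator_of_notMem hg]

/-- the event of hitting `Λ` -/
def hit (Λ : Set G) : Set (ℕ → G) := {ω | ∃ n, walkPos n ω ∈ Λ}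

theorem ms_hit (Λ : Set G) : MeasurableSet (hit Λ) := by
  have : hit Λ = ⋃ n, {ω | walkPos n ω ∈ Λ} := by ext; simp [hit]
  rw [this]; exact MeasurableSet.iUnion fun n => ms_pos n Λ

theorem hit_eq (Λ : Set G) : hit Λ = ⋃ p : ℕ × G, fst Λ p.1 p.2 := by
  classical
  ext ω; simp only [hit, mem_ofPred_eq, mem_iUnion, Prod.exists]
  constructor
  · intro h
    exact ⟨Nat.find h, _, fun k hk => Nat.find_min h hk, Nat.find_spec h, rfl⟩
  · rintro ⟨n, z, -, h, -⟩
    exact ⟨n, h⟩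

theorem fst_disj (Λ : Set G) : Pairwise (Function.onFun Disjoint fun p : ℕ × G => fst Λ p.1 p.2) := by
  rintro ⟨n, z⟩ ⟨m, y⟩ hne
  refine Set.disjoint_left.2 ?_
  rintro ω ⟨a1, a2, a3⟩ ⟨b1, b2, b3⟩
  have : n = m := by
    rcases lt_trichotomy n m with h | h | h
    · exact absurd a2 (b1 n h)
    · exact h
    · exact absurd b2 (a1 m h)
  subst this
  exact hne (Prod.ext rfl (a3.symm.trans b3))

theorem P_hit (hP : IsWalkMeasure μ P) (Λ : Set G) : P (hit Λ) = ∑' p : ℕ × G, P (fst Λ p.1 p.2) := by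
  rw [hit_eq, measure_iUnion (fst_disj Λ) fun p => (dep_fst Λ p.1 p.2).meas]

/-- strong Markov at the first entrance -/
theorem strong_markov (hP : IsWalkMeasure μ P) (Λ : Set G) (A : G → Set (ℕ → G))
    (hA : ∀ z, MeasurableSet (A z)) (c : ℝ≥0∞) (hc : ∀ z ∈ Λ, c ≤ P (A z)) :
    c * P (hit Λ) ≤ P {ω | ∃ n, walkPos n ω ∈ Λ ∧ sh n ω ∈ A (walkPos n ω)} := by
  have h1 : (⋃ p : ℕ × G, fst Λ p.1 p.2 ∩ sh p.1 ⁻¹' (A p.2)) ⊆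
      {ω | ∃ n, walkPos n ω ∈ Λ ∧ sh n ω ∈ A (walkPos n ω)} := by
    intro ω h
    obtain ⟨⟨n, z⟩, h1, h2⟩ := mem_iUnion.1 h
    refine ⟨n, h1.2.1, ?_⟩
    rw [h1.2.2]; exact h2
  refine le_trans ?_ (measure_mono h1)
  rw [measure_iUnion]
  · rw [P_hit hP, ← ENNReal.tsum_mul_left]
    refine ENNReal.tsum_le_tsum fun p => ?_
    rw [markov hP (dep_fst Λ p.1 p.2) (hA p.2), mul_comm]
    by_cases hz : p.2 ∈ Λ
    · gcongr; exact hc _ hz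
    · have : fst Λ p.1 p.2 = ∅ := by
        ext ω; simp only [mem_empty_iff_false, iff_false]
        rintro ⟨-, h1, h2⟩; rw [h2] at h1; exact hz h1
      rw [this]; simp
  · intro p p' hne
    exact (fst_disj Λ hne).mono inter_subset_left inter_subset_left
  · intro p; exact (dep_fst Λ p.1 p.2).meas.inter (meas_sh _ (hA _))

/-- union bound over all times and positions -/
theorem union_markov (hP : IsWalkMeasure μ P) (A : G → Set (ℕ → G))
    (hA : ∀ z, MeasurableSet (A z)) :
    P {ω | ∃ n, sh n ω ∈ A (walkPos n ω)} ≤ ∑' z, Gr μ 1 z * P (A z) := by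
  have h1 : {ω | ∃ n, sh n ω ∈ A (walkPos n ω)} ⊆
      ⋃ p : ℕ × G, {ω | walkPos p.1 ω ∈ ({p.2} : Set G)} ∩ sh p.1 ⁻¹' (A p.2) := by
    rintro ω ⟨n, h⟩
    exact mem_iUnion.2 ⟨(n, walkPos n ω), rfl, h⟩
  refine (measure_mono h1).trans ((measure_iUnion_le _).trans ?_)
  have : ∀ p : ℕ × G, P ({ω | walkPos p.1 ω ∈ ({p.2} : Set G)} ∩ sh p.1 ⁻¹' (A p.2)) =
      q μ ∅ p.1 1 p.2 * P (A p.2) := by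
    intro p
    rw [markov hP (dep_pos le_rfl _) (hA _), ← law hP]; rfl
  simp_rw [this]
  rw [ENNReal.tsum_prod (f := fun n z => q μ ∅ n 1 z * P (A z)), ENNReal.tsum_comm]
  simp_rw [ENNReal.tsum_mul_right]
  exact le_rfl

theorem P_hit_le (hP : IsWalkMeasure μ P) (y : G) : P (hit {y}) ≤ Gr μ 1 y := by
  have : hit {y} = ⋃ n, {ω : ℕ → G | walkPos n ω = y} := by ext; simp [hit]
  rw [this]
  refine (measure_iUnion_le _).trans ?_
  simp_rw [law hP]; exact le_rfl

theorem Gr_le_hit (hP : IsWalkMeasure μ P) (y : G) : Gr μ 1 y ≤ Gr μ 1 1 * P (hit {y}) := by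
  have h1 : ∀ n, q μ ∅ n 1 y ≤ ∑' m, if m ≤ n then P (fst {y} m y) * q μ ∅ (n - m) 1 1 else 0 := by
    intro n
    rw [← law hP]
    have : {ω : ℕ → G | walkPos n ω = y} ⊆ ⋃ m, {ω | m ≤ n ∧ ω ∈ fst {y} m y ∧
        walkPos (n - m) (sh m ω) = 1} := by
      intro ω h
      have hh : ω ∈ hit {y} := ⟨n, h⟩
      rw [hit_eq] at hh
      obtain ⟨⟨m, z⟩, h1, h2, h3⟩ := mem_iUnion.1 hh
      simp only at h1 h2 h3
      have hz : z = y := by rw [← h3]; exact h2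
      subst hz
      have hm : m ≤ n := by by_contra hc; push Not at hc; exact h1 n hc h
      refine mem_iUnion.2 ⟨m, hm, ⟨h1, h2, h3⟩, ?_⟩
      have := walkPos_add m (n - m) ω
      rw [show m + (n - m) = n by omega, h3, show walkPos n ω = z from h] at this
      simpa using this.symm
    refine (measure_mono this).trans ((measure_iUnion_le _).trans ?_)
    refine ENNReal.tsum_le_tsum fun m => ?_
    split_ifs with hm
    · rw [← law hP]
      refine le_of_le_of_eq ?_ (markov hP (dep_fst {y} m y) (ms_pos (n - m) {1}))
      exact measure_mono fun ω h => ⟨h.2.1, h.2.2⟩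
    · simp [hm]
  calc Gr μ 1 y ≤ ∑' n, ∑' m, if m ≤ n then P (fst {y} m y) * q μ ∅ (n - m) 1 1 else 0 :=
        ENNReal.tsum_le_tsum h1
    _ = ∑' m, ∑' n, if m ≤ n then P (fst {y} m y) * q μ ∅ (n - m) 1 1 else 0 := ENNReal.tsum_comm
    _ ≤ ∑' m, P (fst {y} m y) * Gr μ 1 1 := by
        refine ENNReal.tsum_le_tsum fun m => ?_
        rw [← Summable.sum_add_tsum_nat_add' (k := m) ENNReal.summable, Finset.sum_eq_zero, zero_add]
        · simp only [le_add_iff_nonneg_left, zero_le, if_true, Nat.add_sub_cancel]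
          rw [ENNReal.tsum_mul_left]; exact le_rfl
        · intro i hi
          rw [if_neg]; have := Finset.mem_range.1 hi; omega
    _ = Gr μ 1 1 * ∑' m, P (fst {y} m y) := by rw [ENNReal.tsum_mul_right, mul_comm]
    _ ≤ _ := by
        gcongr
        rw [P_hit hP, ENNReal.tsum_prod (f := fun m z => P (fst {y} m z))]
        exact ENNReal.tsum_le_tsum fun m => ENNReal.le_tsum y

end

/-! ## M7 -/
set_option linter.unusedSectionVars false
set_option linter.unusedVariables false
section
variable {S : Finset G} {δ : ℕ} {μ : G → ℝ} {K : ℕ} {lam : ℝ}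

theorem WalkOK.q_len (hw : WalkOK S μ K lam) (hS : Generates S) (n : ℕ) (g : G)
    (h : q μ ∅ n 1 g ≠ 0) : wordLength S g ≤ K * n := by
  obtain ⟨x, h0, h1, h2⟩ := hw.q_path ∅ n 1 g h
  have : ∀ i ≤ n, wd S 1 (x i) ≤ K * i := by
    intro i
    induction i with
    | zero => intro _; rw [h0, wd_self]; omega
    | succ i ih =>
      intro hi
      have a := ih (by omega)
      have b := (h2 i (by omega)).2
      have c := wd_tri hS 1 (x i) (x (i + 1))
      rw [mul_add]; omega
  have := this n le_rfl
  rwa [h1, wd_one_left] at this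

variable [Countable G] [MeasurableSpace G] [MeasurableSingletonClass G] {P : Measure (ℕ → G)}

theorem hit_mono {Λ Λ' : Set G} (h : Λ ⊆ Λ') : hit Λ ⊆ hit Λ' := fun ω ⟨n, hn⟩ => ⟨n, h hn⟩

theorem WalkOK.P_ball (hw : WalkOK S μ K lam) (hS : Generates S) (hP : IsWalkMeasure μ P)
    (i t : ℕ) (p : G) : P {ω | walkPos i ω ∈ {g | wd S p g ≤ t}} ≤
      if wordLength S p ≤ K * i + t then (growthD S ^ t : ℕ) * ENNReal.ofReal lam ^ i else 0 := by
  classical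
  rw [law_set hP]
  split_ifs with h
  · calc ∑' g, indicator {g | wd S p g ≤ t} (fun g => q μ ∅ i 1 g) g
        = ∑' b, indicator {g | wd S p g ≤ t} (fun g => q μ ∅ i 1 g) (p * b) :=
          ((Equiv.mulLeft p).tsum_eq _).symm
      _ ≤ ∑' b, if b ∈ ball S t then ENNReal.ofReal lam ^ i else 0 := by
          refine ENNReal.tsum_le_tsum fun b => ?_
          by_cases hb : wd S p (p * b) ≤ t
          · rw [indicator_of_mem (by exact hb), if_pos]
            · exact hw.q_le_pow _ _ _ _
            · rw [mem_ball hS]; simpa [wd] using hb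
          · rw [indicator_of_notMem (by exact hb)]; exact zero_le
      _ = (ball S t).card * ENNReal.ofReal lam ^ i := by
          rw [tsum_eq_sum (s := ball S t) (by intro b hb; rw [if_neg hb])]
          rw [Finset.sum_ite_mem, Finset.inter_self, Finset.sum_const, nsmul_eq_mul]
      _ ≤ _ := by gcongr; exact card_ball S t
  · rw [nonpos_iff_eq_zero, ENNReal.tsum_eq_zero]
    intro g
    by_cases hg : wd S p g ≤ t
    · rw [indicator_of_mem (by exact hg)]
      by_contra hq
      have h1 := hw.q_len hS i g hq
      have h2 := wd_tri hS 1 g p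
      rw [wd_one_left, wd_one_left, wd_comm hS g p] at h2
      omega
    · exact indicator_of_notMem (by exact hg) _

theorem poly_geom (b : ℕ) {lam : ℝ} (h0 : 0 < lam) (h1 : lam < 1) :
    ∑' i : ℕ, ((i + 1 : ℕ) : ℝ≥0∞) ^ b * ENNReal.ofReal lam ^ i ≠ ⊤ := by
  have hs : Summable (fun i : ℕ => ((i + 1 : ℕ) : ℝ) ^ b * lam ^ i) := by
    have := (summable_nat_add_iff 1).2 (summable_pow_mul_geometric_of_norm_lt_one b
      (r := lam) (by rw [Real.norm_eq_abs, abs_of_pos h0]; exact h1))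
    refine (this.mul_left lam⁻¹).congr fun i => ?_
    rw [pow_succ]; field_simp
  have : ∀ i : ℕ, ((i + 1 : ℕ) : ℝ≥0∞) ^ b * ENNReal.ofReal lam ^ i =
      ENNReal.ofReal (((i + 1 : ℕ) : ℝ) ^ b * lam ^ i) := by
    intro i
    rw [ENNReal.ofReal_mul (by positivity), ENNReal.ofReal_pow (by positivity),
      ENNReal.ofReal_pow h0.le, ENNReal.ofReal_natCast]
  simp_rw [this]
  rw [← ENNReal.ofReal_tsum_of_nonneg (fun i => by positivity) hs]
  exact ENNReal.ofReal_ne_top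

theorem WalkOK.dev (hw : WalkOK S μ K lam) (hg : Geo S δ) (hP : IsWalkMeasure μ P) :
    ∃ C1 : ℝ≥0∞, C1 ≠ ⊤ ∧ ∀ a : G, ∑' r : ℕ, P (hit {g | ((r + 1 : ℕ) : ℝ) ≤ gp S a g}) ≤ C1 := by
  classical
  have hS := hg.gen
  set A := 2 * δ + 1 + K with hA
  set t : ℕ → ℕ := fun i => A + 2 * δ * Nat.log 2 (i + 1) with ht
  set D := growthD S with hD
  set b := 2 * δ * D
  set M := K + A + 2 * δ
  have hone : ∀ a (r : ℕ), P (hit {g | ((r + 1 : ℕ) : ℝ) ≤ gp S a g}) ≤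
      ∑' i, if r + 1 ≤ K * i + t i then (D ^ (t i) : ℕ) * ENNReal.ofReal lam ^ i else 0 := by
    intro a r
    by_cases hr : r + 1 ≤ wordLength S a
    · obtain ⟨p, k, e, hp, hk⟩ := exists_split hS a hr
      have hpa : gp S p a = (r + 1 : ℕ) := by
        have h1 := gp_ident hS p k
        rw [← e] at h1
        have h2 : gp S p⁻¹ k = 0 := by
          unfold gp; rw [inv_inv, ← e, len_inv hS]; unfold len; rw [hk, hp, Nat.cast_sub hr]; ring
        rw [h2, add_zero] at h1
        rw [h1]; unfold len; rw [hp]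
      have hsub : hit {g | ((r + 1 : ℕ) : ℝ) ≤ gp S a g} ∩
          {ω | ∀ i, wd S (walkPos i ω) (walkPos (i + 1) ω) ≤ K} ⊆
          ⋃ i, {ω : ℕ → G | walkPos i ω ∈ {g | wd S p g ≤ t i}} := by
        rintro ω ⟨⟨n, hn⟩, hst⟩
        have hn' : ((r + 1 : ℕ) : ℝ) ≤ gp S a (walkPos n ω) := hn
        have h1 := hg.hyp p a (walkPos n ω)
        rw [hpa, min_eq_left hn'] at h1
        have h2 := gp_ident hS p (p⁻¹ * walkPos n ω)
        rw [mul_inv_cancel_left] at h2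
        have h3 : len S p = (r + 1 : ℕ) := by unfold len; rw [hp]
        obtain ⟨i, hi, hi2⟩ := chain hg (fun i => p⁻¹ * walkPos i ω) n K (δ + 1)
          (fun i _ => by rw [wd_left]; exact hst i) (by
            simp only [walkPos_zero, mul_one]; linarith)
        refine mem_iUnion.2 ⟨i, ?_⟩
        rw [len_wd] at hi2
        have h4 : (wd S p (walkPos i ω) : ℝ) ≤ t i := by
          simp only [ht, hA]; push_cast; linarith
        exact_mod_cast h4
      have hae : P {ω | ∀ i, wd S (walkPos i ω) (walkPos (i + 1) ω) ≤ K}ᶜ = 0 := by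
        have : {ω : ℕ → G | ∀ i, wd S (walkPos i ω) (walkPos (i + 1) ω) ≤ K}ᶜ ⊆
            ⋃ i, {ω | walkPos 0 ω ∈ (univ : Set G)} ∩ sh i ⁻¹' {ω | walkPos 1 ω ∈ {g | K < wordLength S g}} := by
          intro ω h
          simp only [mem_compl_iff, mem_ofPred_eq, not_forall, not_le] at h
          obtain ⟨i, hi⟩ := h
          refine mem_iUnion.2 ⟨i, mem_univ _, ?_⟩
          simp only [mem_preimage, mem_ofPred_eq, walkPos_one]
          rw [walkPos_succ] at hi
          simpa [wd, sh] using hi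
        refine measure_mono_null this (measure_iUnion_null fun i => ?_)
        rw [markov hP (dep_pos (by omega) _) (ms_pos 1 _), law_set hP 1]
        refine mul_eq_zero_of_right _ (ENNReal.tsum_eq_zero.2 fun g => ?_)
        by_cases hg : K < wordLength S g
        · rw [indicator_of_mem (by exact hg)]
          by_contra hq
          have := hw.q_len hS 1 g hq
          omega
        · exact indicator_of_notMem (by exact hg) _
      calc P (hit {g | ((r + 1 : ℕ) : ℝ) ≤ gp S a g})
          ≤ P ((hit {g | ((r + 1 : ℕ) : ℝ) ≤ gp S a g} ∩
          {ω | ∀ i, wd S (walkPos i ω) (walkPos (i + 1) ω) ≤ K}) ∪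
            {ω | ∀ i, wd S (walkPos i ω) (walkPos (i + 1) ω) ≤ K}ᶜ) := by
            refine measure_mono fun ω h => ?_
            by_cases h' : ω ∈ {ω : ℕ → G | ∀ i, wd S (walkPos i ω) (walkPos (i + 1) ω) ≤ K}
            · exact Or.inl ⟨h, h'⟩
            · exact Or.inr h'
        _ ≤ _ := measure_union_le _ _
        _ ≤ P (⋃ i, {ω : ℕ → G | walkPos i ω ∈ {g | wd S p g ≤ t i}}) + 0 := by
            rw [hae]; gcongr
        _ ≤ ∑' i, P {ω : ℕ → G | walkPos i ω ∈ {g | wd S p g ≤ t i}} := by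
            rw [add_zero]; exact measure_iUnion_le _
        _ ≤ _ := by
            refine ENNReal.tsum_le_tsum fun i => ?_
            have := hw.P_ball hS hP i (t i) p
            rwa [hp] at this
    · have : hit {g | ((r + 1 : ℕ) : ℝ) ≤ gp S a g} = (∅ : Set (ℕ → G)) := by
        ext ω; simp only [mem_empty_iff_false, iff_false]
        rintro ⟨n, hn⟩
        have h1 := le_trans (show ((r + 1 : ℕ) : ℝ) ≤ gp S a (walkPos n ω) from hn) (gp_le_left hS _ _)
        exact hr (by unfold len at h1; exact_mod_cast h1)
      rw [this]; simp
  refine ⟨(M * D ^ A : ℕ) * ∑' i : ℕ, ((i + 1 : ℕ) : ℝ≥0∞) ^ (b + 1) * ENNReal.ofReal lam ^ i, ?_, ?_⟩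
  · exact ENNReal.mul_ne_top (ENNReal.natCast_ne_top _) (poly_geom _ hw.lam_pos hw.lam_lt)
  intro a
  refine (ENNReal.tsum_le_tsum (hone a)).trans ?_
  rw [ENNReal.tsum_comm, ← ENNReal.tsum_mul_left]
  refine ENNReal.tsum_le_tsum fun i => ?_
  have h1 : ∑' r, (if r + 1 ≤ K * i + t i then ((D ^ (t i) : ℕ) : ℝ≥0∞) * ENNReal.ofReal lam ^ i else 0)
      = (K * i + t i : ℕ) * ((D ^ (t i) : ℕ) * ENNReal.ofReal lam ^ i) := by
    rw [tsum_eq_sum (s := Finset.range (K * i + t i))]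
    · rw [Finset.sum_congr rfl (g := fun _ => ((D ^ (t i) : ℕ) : ℝ≥0∞) * ENNReal.ofReal lam ^ i)]
      · rw [Finset.sum_const, Finset.card_range, nsmul_eq_mul]
      · intro r hr
        rw [if_pos]; have := Finset.mem_range.1 hr; omega
    · intro r hr
      rw [if_neg]; rw [Finset.mem_range] at hr; omega
  rw [h1, ← mul_assoc, ← mul_assoc]
  gcongr ?_ * _
  have hlog : Nat.log 2 (i + 1) ≤ i + 1 := Nat.log_le_self _ _
  have e1 : K * i + t i ≤ M * (i + 1) := by
    have : 2 * δ * Nat.log 2 (i + 1) ≤ 2 * δ * (i + 1) := Nat.mul_le_mul_left _ hlog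
    simp only [ht, M]; nlinarith
  have e2 : D ^ t i ≤ D ^ A * (i + 1) ^ b := by
    simp only [ht]
    rw [pow_add]
    refine Nat.mul_le_mul_left _ ?_
    calc D ^ (2 * δ * Nat.log 2 (i + 1)) ≤ (2 ^ D) ^ (2 * δ * Nat.log 2 (i + 1)) :=
          Nat.pow_le_pow_left Nat.lt_two_pow_self.le _
      _ = (2 ^ Nat.log 2 (i + 1)) ^ b := by rw [← pow_mul, ← pow_mul]; congr 1; simp only [b]; ring
      _ ≤ _ := Nat.pow_le_pow_left (Nat.pow_log_le_self 2 (by omega)) _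
  have e3 : (K * i + t i) * D ^ t i ≤ M * D ^ A * (i + 1) ^ (b + 1) := by
    calc _ ≤ (M * (i + 1)) * (D ^ A * (i + 1) ^ b) := Nat.mul_le_mul e1 e2
      _ = _ := by ring
  exact_mod_cast e3

theorem WalkOK.dev_small (hw : WalkOK S μ K lam) (hg : Geo S δ) (hP : IsWalkMeasure μ P)
    (η : ℝ≥0∞) (hη : η ≠ 0) : ∃ c : ℕ, ∀ a : G, P (hit {g | (c : ℝ) ≤ gp S a g}) ≤ η := by
  obtain ⟨C1, hC, h⟩ := hw.dev hg hP
  obtain ⟨n, hn0, hn⟩ := ENNReal.exists_nat_pos_mul_gt hη hC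
  refine ⟨n, fun a => ?_⟩
  by_contra! hc
  have h1 : (n : ℝ≥0∞) * P (hit {g | (n : ℝ) ≤ gp S a g}) ≤ C1 := by
    refine le_trans ?_ (h a)
    refine le_trans ?_ (ENNReal.sum_le_tsum (Finset.range n))
    rw [← Finset.card_range n, ← nsmul_eq_mul, ← Finset.sum_const, Finset.card_range]
    refine Finset.sum_le_sum fun r hr => measure_mono (hit_mono fun g hg => ?_)
    have := Finset.mem_range.1 hr
    have h2 : ((r + 1 : ℕ) : ℝ) ≤ n := by exact_mod_cast this
    exact h2.trans hg
  have : (n : ℝ≥0∞) * η ≤ n * P (hit {g | (n : ℝ) ≤ gp S a g}) := by gcongr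
  exact absurd (hn.trans_le (this.trans h1)) (lt_irrefl _)

theorem WalkOK.dev_mean (hw : WalkOK S μ K lam) (hg : Geo S δ) (hP : IsWalkMeasure μ P) :
    ∃ C : ℝ, 0 ≤ C ∧ ∀ (a : G) (n : ℕ),
      ∑' g, ENNReal.ofReal (gp S a g) * q μ ∅ n 1 g ≤ ENNReal.ofReal C := by
  obtain ⟨C1, hC, h⟩ := hw.dev hg hP
  have hS := hg.gen
  have := hP.1
  refine ⟨(1 + C1).toReal, ENNReal.toReal_nonneg, fun a n => ?_⟩
  rw [ENNReal.ofReal_toReal (by simp [hC])]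
  have tot : ∑' g, q μ ∅ n 1 g = 1 := by
    have := law_set hP n univ
    simp at this; exact this.symm
  calc ∑' g, ENNReal.ofReal (gp S a g) * q μ ∅ n 1 g
      ≤ ∑' g, (q μ ∅ n 1 g + ∑' r : ℕ, indicator {g | ((r + 1 : ℕ) : ℝ) ≤ gp S a g}
          (fun g => q μ ∅ n 1 g) g) := by
        refine ENNReal.tsum_le_tsum fun g => ?_
        have h0 := gp_nonneg hS a g
        set m := ⌊gp S a g⌋₊
        have h1 : ENNReal.ofReal (gp S a g) ≤ 1 + m := by
          have := Nat.lt_floor_add_one (gp S a g)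
          calc ENNReal.ofReal (gp S a g) ≤ ENNReal.ofReal ((m + 1 : ℕ) : ℝ) :=
                ENNReal.ofReal_le_ofReal (by push_cast; exact this.le)
            _ = _ := by rw [ENNReal.ofReal_natCast]; push_cast; ring
        refine (mul_le_mul_left h1 _).trans ?_
        rw [add_mul, one_mul]
        gcongr
        refine le_trans ?_ (ENNReal.sum_le_tsum (Finset.range m))
        rw [Finset.sum_congr rfl (g := fun _ => q μ ∅ n 1 g)]
        · rw [Finset.sum_const, Finset.card_range, nsmul_eq_mul]
        · intro r hr
          refine indicator_of_mem ?_ _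
          have h2 : r + 1 ≤ m := Finset.mem_range.1 hr
          have h3 : ((r + 1 : ℕ) : ℝ) ≤ m := by exact_mod_cast h2
          exact h3.trans (Nat.floor_le h0)
    _ = 1 + ∑' r : ℕ, P {ω | walkPos n ω ∈ {g | ((r + 1 : ℕ) : ℝ) ≤ gp S a g}} := by
        rw [ENNReal.tsum_add, tot, ENNReal.tsum_comm]
        simp_rw [law_set hP]
    _ ≤ 1 + C1 := by
        gcongr
        refine le_trans (ENNReal.tsum_le_tsum fun r => ?_) (h a)
        exact measure_mono fun ω hω => ⟨n, hω⟩

end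

/-! ## M8 -/
set_option linter.unusedSectionVars false
set_option linter.unusedVariables false
section
variable {S : Finset G} {δ : ℕ} {μ : G → ℝ} {K : ℕ} {lam : ℝ}

def Ex (μ : G → ℝ) (n : ℕ) (f : G → ℝ) : ℝ := ∑' g, convPow μ n g * f g

theorem WalkOK.cp_len (hw : WalkOK S μ K lam) (hS : Generates S) {n : ℕ} {g : G}
    (h : convPow μ n g ≠ 0) : wordLength S g ≤ K * n := by
  refine hw.q_len hS n g ?_
  rw [q_convPow hw, inv_one, one_mul]
  have := lt_of_le_of_ne (convPow_nonneg hw.prob n g) h.symm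
  simpa using this

theorem WalkOK.Ex_eq (hw : WalkOK S μ K lam) (hS : Generates S) {n R : ℕ} (hR : K * n ≤ R) (f : G → ℝ) :
    Ex μ n f = ∑ g ∈ ball S R, convPow μ n g * f g := by
  refine tsum_eq_sum fun g hg => ?_
  rw [mem_ball hS] at hg
  by_cases h : convPow μ n g = 0
  · simp [h]
  · exact absurd (hw.cp_len hS h) (by omega)

theorem WalkOK.Ex_mono (hw : WalkOK S μ K lam) (hS : Generates S) {n : ℕ} {f f' : G → ℝ}
    (h : ∀ g, wordLength S g ≤ K * n → f g ≤ f' g) : Ex μ n f ≤ Ex μ n f' := by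
  rw [hw.Ex_eq hS le_rfl, hw.Ex_eq hS le_rfl]
  refine Finset.sum_le_sum fun g hg => ?_
  exact mul_le_mul_of_nonneg_left (h g ((mem_ball hS).1 hg)) (convPow_nonneg hw.prob n g)

theorem WalkOK.Ex_add (hw : WalkOK S μ K lam) (hS : Generates S) (n : ℕ) (f f' : G → ℝ) :
    Ex μ n (fun g => f g + f' g) = Ex μ n f + Ex μ n f' := by
  rw [hw.Ex_eq hS le_rfl, hw.Ex_eq hS le_rfl, hw.Ex_eq hS le_rfl, ← Finset.sum_add_distrib]
  exact Finset.sum_congr rfl fun g _ => mul_add _ _ _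

theorem Ex_mul (n : ℕ) (c : ℝ) (f : G → ℝ) :
    Ex μ n (fun g => c * f g) = c * Ex μ n f := by
  unfold Ex; rw [← tsum_mul_left]
  exact tsum_congr fun g => by ring

theorem Ex_zero (f : G → ℝ) : Ex μ 0 f = f 1 := by
  unfold Ex
  rw [tsum_eq_single 1 (by intro b hb; simp [convPow, hb])]
  simp [convPow]

theorem WalkOK.Ex_succ (hw : WalkOK S μ K lam) (hS : Generates S) (n : ℕ) (f : G → ℝ) :
    Ex μ (n + 1) f = Ex μ n (fun y => ∑' b, μ b * f (y * b)) := by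
  rw [hw.Ex_eq hS le_rfl, hw.Ex_eq hS (R := K * n) le_rfl]
  have h1 : ∀ g, convPow μ (n + 1) g = ∑ y ∈ ball S (K * n), convPow μ n y * μ (y⁻¹ * g) := by
    intro g
    refine tsum_eq_sum fun y hy => ?_
    rw [mem_ball hS] at hy
    by_cases h : convPow μ n y = 0
    · simp [h]
    · exact absurd (hw.cp_len hS h) (by omega)
  simp_rw [h1, Finset.sum_mul]
  rw [Finset.sum_comm]
  refine Finset.sum_congr rfl fun y hy => ?_
  have h2 : ∑' b, μ b * f (y * b) = ∑' g, μ (y⁻¹ * g) * f g := by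
    rw [← (Equiv.mulLeft y).tsum_eq (fun g => μ (y⁻¹ * g) * f g)]
    simp
  rw [h2, tsum_eq_sum (s := ball S (K * (n + 1))), Finset.mul_sum]
  · exact Finset.sum_congr rfl fun g _ => by ring
  · intro g hg
    by_cases h : μ (y⁻¹ * g) = 0
    · simp [h]
    · exfalso; apply hg
      rw [mem_ball hS] at hy ⊢
      have a := hw.step _ h
      have b := wl_mul hS y (y⁻¹ * g)
      rw [mul_inv_cancel_left] at b
      rw [mul_add]; omega

theorem WalkOK.Ex_conv (hw : WalkOK S μ K lam) (hS : Generates S) (n m : ℕ) (f : G → ℝ) :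
    Ex μ (n + m) f = Ex μ n (fun a => Ex μ m (fun b => f (a * b))) := by
  induction m generalizing f with
  | zero => simp [Ex_zero]
  | succ m ih =>
    rw [← add_assoc, hw.Ex_succ hS, ih]
    congr 1; funext a
    rw [hw.Ex_succ hS]
    simp_rw [mul_assoc]

theorem WalkOK.Ex_one (hw : WalkOK S μ K lam) (hS : Generates S) (n : ℕ) :
    Ex μ n (fun _ => 1) = 1 := by
  induction n with
  | zero => rw [Ex_zero]
  | succ n ih =>
    rw [hw.Ex_succ hS]
    simp only [mul_one, hw.prob.2.tsum_eq]
    exact ih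

theorem WalkOK.Ex_const (hw : WalkOK S μ K lam) (hS : Generates S) (n : ℕ) (c : ℝ) :
    Ex μ n (fun _ => c) = c := by
  have := Ex_mul (μ := μ) n c (fun _ => 1)
  rwa [hw.Ex_one hS, mul_one] at this

theorem WalkOK.Ex_nonneg (hw : WalkOK S μ K lam) (n : ℕ) {f : G → ℝ} (h : ∀ g, 0 ≤ f g) :
    0 ≤ Ex μ n f := tsum_nonneg fun g => mul_nonneg (convPow_nonneg hw.prob n g) (h g)

theorem WalkOK.Ex_ofReal (hw : WalkOK S μ K lam) (hS : Generates S) (n : ℕ) {f : G → ℝ}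
    (h : ∀ g, 0 ≤ f g) :
    ENNReal.ofReal (Ex μ n f) = ∑' g, ENNReal.ofReal (f g) * q μ ∅ n 1 g := by
  unfold Ex
  rw [ENNReal.ofReal_tsum_of_nonneg]
  · refine tsum_congr fun g => ?_
    rw [q_convPow hw, inv_one, one_mul, ENNReal.ofReal_mul (convPow_nonneg hw.prob n g), mul_comm]
  · exact fun g => mul_nonneg (convPow_nonneg hw.prob n g) (h g)
  · refine summable_of_ne_finset_zero (s := ball S (K * n)) fun g hg => ?_
    rw [mem_ball hS] at hg
    by_cases h : convPow μ n g = 0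
    · simp [h]
    · exact absurd (hw.cp_len hS h) (by omega)

variable [Countable G] [MeasurableSpace G] [MeasurableSingletonClass G] {P : Measure (ℕ → G)}

theorem WalkOK.Ex_dev (hw : WalkOK S μ K lam) (hg : Geo S δ) (hP : IsWalkMeasure μ P) :
    ∃ C : ℝ, 0 ≤ C ∧ ∀ (a : G) (n : ℕ), Ex μ n (fun g => gp S a g) ≤ C := by
  obtain ⟨C, h0, h⟩ := hw.dev_mean hg hP
  refine ⟨C, h0, fun a n => ?_⟩
  have := h a n
  rw [← hw.Ex_ofReal hg.gen n (fun g => gp_nonneg hg.gen a g)] at this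
  exact (ENNReal.ofReal_le_ofReal_iff h0).1 this

theorem WalkOK.P_le_Ex (hw : WalkOK S μ K lam) (hS : Generates S) (hP : IsWalkMeasure μ P) (n : ℕ)
    {A : Set G} {f : G → ℝ} (h : ∀ g, 0 ≤ f g) (hA : ∀ g ∈ A, 1 ≤ f g) :
    P {ω | walkPos n ω ∈ A} ≤ ENNReal.ofReal (Ex μ n f) := by
  rw [law_set hP, hw.Ex_ofReal hS n h]
  refine ENNReal.tsum_le_tsum fun g => ?_
  by_cases hg : g ∈ A
  · rw [indicator_of_mem hg]
    have : (1 : ℝ≥0∞) ≤ ENNReal.ofReal (f g) := by simpa using hA g hg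
    calc q μ ∅ n 1 g = 1 * q μ ∅ n 1 g := (one_mul _).symm
      _ ≤ _ := mul_le_mul_left this _
  · rw [indicator_of_notMem hg]; exact zero_le

theorem WalkOK.ae_len (hw : WalkOK S μ K lam) (hS : Generates S) (hP : IsWalkMeasure μ P) (n : ℕ) :
    ∀ᵐ ω ∂P, wordLength S (walkPos n ω) ≤ K * n := by
  rw [ae_iff]
  have := law_set hP n {g | ¬ wordLength S g ≤ K * n}
  rw [ENNReal.tsum_eq_zero.2] at this
  · exact this
  · intro g
    by_cases hg : ¬ wordLength S g ≤ K * n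
    · rw [indicator_of_mem (by exact hg)]
      by_contra h; exact hg (hw.q_len hS n g h)
    · exact indicator_of_notMem (by exact hg) _

theorem WalkOK.Ex_int (hw : WalkOK S μ K lam) (hS : Generates S) (hP : IsWalkMeasure μ P) (n : ℕ)
    (f : G → ℝ) : Integrable (fun ω => f (walkPos n ω)) P ∧ ∫ ω, f (walkPos n ω) ∂P = Ex μ n f := by
  have := hP.1
  have hpm : IsProbabilityMeasure (P.map (walkPos n)) :=
    Measure.isProbabilityMeasure_map (meas_pos n).aemeasurable
  have hf : Measurable f := .of_discrete
  have hi : Integrable f (P.map (walkPos n)) := by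
    refine Integrable.of_bound hf.aestronglyMeasurable (∑ g ∈ ball S (K * n), |f g|) ?_
    rw [ae_map_iff (meas_pos n).aemeasurable MeasurableSet.of_discrete]
    filter_upwards [hw.ae_len hS hP n] with ω hω
    exact Finset.single_le_sum (f := fun g => |f g|) (fun _ _ => abs_nonneg _) ((mem_ball hS).2 hω)
  refine ⟨hi.comp_measurable (meas_pos n), ?_⟩
  rw [← integral_map (meas_pos n).aemeasurable hf.aestronglyMeasurable, integral_countable hi]
  refine tsum_congr fun g => ?_
  rw [measureReal_def, Measure.map_apply (meas_pos n) MeasurableSet.of_discrete]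
  have e := law hP n g
  rw [q_convPow hw, inv_one, one_mul] at e
  change (P {ω | walkPos n ω = g}).toReal • f g = _
  rw [e, ENNReal.toReal_ofReal (convPow_nonneg hw.prob n g), smul_eq_mul]

theorem WalkOK.conc (hw : WalkOK S μ K lam) (hg : Geo S δ) (hP : IsWalkMeasure μ P) {Y : G → ℝ}
    {C θ ε : ℝ} (hC : 0 ≤ C) (h1 : ∀ a b, Y (a * b) ≤ Y a + Y b + C * (1 + gp S a⁻¹ b))
    (h2 : ∀ g, |Y g| ≤ C * (1 + len S g))
    (hθ : Tendsto (fun n : ℕ => Ex μ n Y / n) atTop (𝓝 θ)) (hε : 0 < ε) :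
    ∃ s > 0, ∃ A ≥ 0, ∀ n : ℕ, Ex μ n (fun g => Real.exp (s * Y g)) ≤ A * Real.exp (s * n * (θ + ε)) := by
  have hS := hg.gen
  obtain ⟨C1, hC1, hd⟩ := hw.Ex_dev hg hP
  have e1 : ∀ᶠ n : ℕ in atTop, Ex μ n Y / n < θ + ε / 4 := hθ.eventually_lt_const (by linarith)
  have e2 : ∀ᶠ n : ℕ in atTop, C * (1 + C1) / (ε / 4) ≤ n := tendsto_natCast_atTop_atTop.eventually_ge_atTop _
  obtain ⟨m, hm1, hm2, hm⟩ := (e1.and (e2.and (eventually_ge_atTop 1))).exists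
  have hm' : (1 : ℝ) ≤ m := by exact_mod_cast hm
  rw [div_lt_iff₀ (by linarith)] at hm1
  rw [div_le_iff₀ (by linarith)] at hm2
  set R := 2 * C * (1 + K * m) + 1 with hR
  have hKm : (0 : ℝ) ≤ K * m := by positivity
  have hRp : 1 ≤ R := by rw [hR]; have := mul_nonneg hC (by linarith : (0 : ℝ) ≤ 1 + K * m); nlinarith
  set s := min (1 / R) (m * ε / (2 * R ^ 2)) with hs
  have hsp : 0 < s := lt_min (by positivity) (by positivity)
  have hs1 : s * R ≤ 1 := by
    rw [← le_div_iff₀ (by linarith)]; exact min_le_left _ _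
  have hs2 : s * R ^ 2 ≤ m * ε / 2 := by
    have := min_le_right (1 / R) (m * ε / (2 * R ^ 2))
    rw [← hs, le_div_iff₀ (by positivity)] at this
    linarith
  have key : ∀ a : G, Ex μ m (fun b => Real.exp (s * (Y b + C * (1 + gp S a⁻¹ b)))) ≤
      Real.exp (s * m * (θ + ε)) := by
    intro a
    have b1 : Ex μ m (fun b => Real.exp (s * (Y b + C * (1 + gp S a⁻¹ b)))) ≤
        Ex μ m (fun b => (s * Y b + (s * C) * gp S a⁻¹ b) + (1 + s * C + s ^ 2 * R ^ 2)) := by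
      refine hw.Ex_mono hS fun b hb => ?_
      have hb' : len S b ≤ K * m := by unfold len; exact_mod_cast hb
      have g0 := gp_nonneg hS a⁻¹ b
      have g1 := gp_le_right hS a⁻¹ b
      have l0 := len_nonneg S b
      set u := Y b + C * (1 + gp S a⁻¹ b) with hu
      have hu1 : |u| ≤ R := by
        calc |u| ≤ |Y b| + |C * (1 + gp S a⁻¹ b)| := abs_add_le _ _
          _ ≤ C * (1 + len S b) + C * (1 + gp S a⁻¹ b) := by
            rw [abs_of_nonneg (mul_nonneg hC (by linarith))]; linarith [h2 b]
          _ ≤ C * (1 + K * m) + C * (1 + K * m) := by gcongr; linarith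
          _ ≤ R := by rw [hR]; linarith
      have hu2 : |s * u| ≤ 1 := by
        rw [abs_mul, abs_of_pos hsp]
        exact (mul_le_mul_of_nonneg_left hu1 hsp.le).trans hs1
      have hq := Real.abs_exp_sub_one_sub_id_le hu2
      have hq2 := (abs_le.1 hq).2
      have : u ^ 2 ≤ R ^ 2 := by rw [← sq_abs]; gcongr
      have : (s * u) ^ 2 ≤ s ^ 2 * R ^ 2 := by rw [mul_pow]; gcongr
      have e3 : s * u = s * Y b + s * C * gp S a⁻¹ b + s * C := by rw [hu]; ring
      linarith
    rw [hw.Ex_add hS, hw.Ex_add hS, hw.Ex_const hS, Ex_mul, Ex_mul] at b1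
    have b2 : s * Ex μ m Y ≤ s * ((θ + ε / 4) * m) := by gcongr
    have b3 : s * C * Ex μ m (fun b => gp S a⁻¹ b) ≤ s * C * C1 := by gcongr; exact hd _ _
    have b4 : s * (C * (1 + C1)) ≤ s * (m * (ε / 4)) := by gcongr
    have b5 : s * (s * R ^ 2) ≤ s * (m * ε / 2) := by gcongr
    have b6 := Real.add_one_le_exp (s * m * (θ + ε))
    nlinarith
  have rec1 : ∀ n, Ex μ (n + m) (fun g => Real.exp (s * Y g)) ≤
      Real.exp (s * m * (θ + ε)) * Ex μ n (fun g => Real.exp (s * Y g)) := by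
    intro n
    rw [hw.Ex_conv hS, ← Ex_mul]
    refine hw.Ex_mono hS fun a _ => ?_
    calc Ex μ m (fun b => Real.exp (s * Y (a * b)))
        ≤ Ex μ m (fun b => Real.exp (s * Y a) * Real.exp (s * (Y b + C * (1 + gp S a⁻¹ b)))) := by
          refine hw.Ex_mono hS fun b _ => ?_
          rw [← Real.exp_add, Real.exp_le_exp, ← mul_add]
          exact mul_le_mul_of_nonneg_left (by linarith [h1 a b]) hsp.le
      _ = Real.exp (s * Y a) * _ := Ex_mul _ _ _
      _ ≤ _ := by rw [mul_comm]; exact mul_le_mul_of_nonneg_right (key a) (Real.exp_pos _).le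
  have t0 : ∀ r : ℕ, 0 ≤ Ex μ r (fun g => Real.exp (s * Y g)) * Real.exp (-(s * r * (θ + ε))) := fun r =>
    mul_nonneg (hw.Ex_nonneg r fun g => (Real.exp_pos _).le) (Real.exp_pos _).le
  set A := ∑ r ∈ Finset.range m, Ex μ r (fun g => Real.exp (s * Y g)) * Real.exp (-(s * r * (θ + ε))) with hA
  refine ⟨s, hsp, A, Finset.sum_nonneg fun r _ => t0 r, fun n => ?_⟩
  induction n using Nat.strong_induction_on with
  | _ n ih =>
    rcases lt_or_ge n m with h | h
    · have := Finset.single_le_sum (f := fun r : ℕ => Ex μ r (fun g => Real.exp (s * Y g)) *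
        Real.exp (-(s * r * (θ + ε)))) (fun r _ => t0 r) (Finset.mem_range.2 h)
      rw [← hA] at this
      simp only [Real.exp_neg] at this
      rwa [← div_eq_mul_inv, div_le_iff₀ (Real.exp_pos _)] at this
    · obtain ⟨k, rfl⟩ := Nat.exists_eq_add_of_le' h
      refine (rec1 k).trans ((mul_le_mul_of_nonneg_left (ih k (by omega)) (Real.exp_pos _).le).trans ?_)
      rw [mul_left_comm, ← Real.exp_add]
      push_cast
      apply le_of_eq; congr 2; ring

theorem WalkOK.conc_ev (hw : WalkOK S μ K lam) (hg : Geo S δ) (hP : IsWalkMeasure μ P) {Y : G → ℝ}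
    {C θ : ℝ} (hC : 0 ≤ C) (h1 : ∀ a b, Y (a * b) ≤ Y a + Y b + C * (1 + gp S a⁻¹ b))
    (h2 : ∀ g, |Y g| ≤ C * (1 + len S g))
    (hθ : Tendsto (fun n : ℕ => Ex μ n Y / n) atTop (𝓝 θ)) {ε : ℝ} (hε : 0 < ε) :
    ∀ᵐ ω ∂P, ∀ᶠ n : ℕ in atTop, Y (walkPos n ω) / n < θ + ε := by
  obtain ⟨s, hs, A, hA, h⟩ := hw.conc hg hP hC h1 h2 hθ (half_pos hε)
  have hS := hg.gen
  have hb : ∀ n : ℕ, P {ω | walkPos n ω ∈ {g | n * (θ + ε) ≤ Y g}} ≤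
      ENNReal.ofReal (A * Real.exp (-(s * (ε / 2))) ^ n) := by
    intro n
    refine (hw.P_le_Ex hS hP n (f := fun g => Real.exp (-(s * n * (θ + ε))) * Real.exp (s * Y g))
      (fun g => by positivity) ?_).trans (ENNReal.ofReal_le_ofReal ?_)
    · intro g hg'
      rw [← Real.exp_add]
      refine Real.one_le_exp ?_
      have := mul_le_mul_of_nonneg_left (show n * (θ + ε) ≤ Y g from hg') hs.le
      linarith
    · rw [Ex_mul]
      refine (mul_le_mul_of_nonneg_left (h n) (Real.exp_pos _).le).trans ?_
      rw [mul_left_comm, ← Real.exp_add, ← Real.exp_nat_mul]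
      apply le_of_eq; congr 2; ring
  have hsum : ∑' n : ℕ, P {ω | walkPos n ω ∈ {g | n * (θ + ε) ≤ Y g}} ≠ ⊤ := by
    refine ne_top_of_le_ne_top ?_ (ENNReal.tsum_le_tsum hb)
    refine Summable.tsum_ofReal_ne_top ?_
    refine (summable_geometric_of_lt_one (Real.exp_pos _).le ?_).mul_left A
    rw [Real.exp_lt_one_iff]
    have : 0 < s * (ε / 2) := by positivity
    linarith
  filter_upwards [ae_eventually_notMem hsum] with ω hω
  filter_upwards [hω, eventually_ge_atTop 1] with n hn hn1
  have hn' : (0 : ℝ) < n := by exact_mod_cast hn1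
  rw [div_lt_iff₀ hn', mul_comm]
  exact not_le.1 hn

theorem WalkOK.conc_as (hw : WalkOK S μ K lam) (hg : Geo S δ) (hP : IsWalkMeasure μ P) {Y : G → ℝ}
    {C θ : ℝ} (hC : 0 ≤ C) (h1 : ∀ a b, |Y (a * b) - Y a - Y b| ≤ C * (1 + gp S a⁻¹ b))
    (h2 : ∀ g, |Y g| ≤ C * (1 + len S g))
    (hθ : Tendsto (fun n : ℕ => Ex μ n Y / n) atTop (𝓝 θ)) :
    (∀ᵐ ω ∂P, Tendsto (fun n : ℕ => Y (walkPos n ω) / n) atTop (𝓝 θ)) ∧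
    Tendsto (fun n : ℕ => ∫ ω, |Y (walkPos n ω) / n - θ| ∂P) atTop (𝓝 0) := by
  have hS := hg.gen
  have := hP.1
  have hneg : Tendsto (fun n : ℕ => Ex μ n (fun g => - Y g) / n) atTop (𝓝 (-θ)) := by
    refine hθ.neg.congr fun n => ?_
    have := Ex_mul (μ := μ) n (-1) Y
    simp only [neg_one_mul] at this
    rw [this, neg_div]
  have has : ∀ᵐ ω ∂P, Tendsto (fun n : ℕ => Y (walkPos n ω) / n) atTop (𝓝 θ) := by
    have u : ∀ᵐ ω ∂P, ∀ k : ℕ, ∀ᶠ n : ℕ in atTop, Y (walkPos n ω) / n < θ + 1 / ((k : ℝ) + 1) :=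
      ae_all_iff.2 fun k => hw.conc_ev hg hP hC (fun a b => by linarith [(abs_le.1 (h1 a b)).2]) h2 hθ
        (by positivity)
    have l : ∀ᵐ ω ∂P, ∀ k : ℕ, ∀ᶠ n : ℕ in atTop, -Y (walkPos n ω) / n < -θ + 1 / ((k : ℝ) + 1) :=
      ae_all_iff.2 fun k => hw.conc_ev hg hP (Y := fun g => -Y g) hC
        (fun a b => by linarith [(abs_le.1 (h1 a b)).1]) (fun g => by rw [abs_neg]; exact h2 g) hneg
        (by positivity)
    filter_upwards [u, l] with ω hu hl
    rw [Metric.tendsto_atTop']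
    intro ε hε
    obtain ⟨k, hk⟩ := exists_nat_one_div_lt hε
    obtain ⟨N, hN⟩ := eventually_atTop.1 ((hu k).and (hl k))
    refine ⟨N, fun n hn => ?_⟩
    have := hN n hn.le
    rw [neg_div] at this
    rw [Real.dist_eq, abs_lt]
    constructor <;> linarith
  refine ⟨has, ?_⟩
  have := tendsto_integral_of_dominated_convergence (μ := P)
    (F := fun (n : ℕ) ω => |Y (walkPos n ω) / n - θ|) (f := fun _ => (0 : ℝ))
    (fun _ => C * (1 + K) + |θ|) ?_ (integrable_const _) ?_ ?_
  · simpa using this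
  · intro n
    have : Measurable (fun g : G => |Y g / n - θ|) := .of_discrete
    exact (this.comp (meas_pos n)).aestronglyMeasurable
  · intro n
    filter_upwards [hw.ae_len hS hP n] with ω hω
    rw [Real.norm_eq_abs, abs_abs]
    have hb' : len S (walkPos n ω) ≤ K * n := by unfold len; exact_mod_cast hω
    refine (abs_sub _ _).trans (add_le_add ?_ le_rfl)
    rw [abs_div, Nat.abs_cast]
    rcases Nat.eq_zero_or_pos n with rfl | hn
    · simp; positivity
    · have hn' : (1 : ℝ) ≤ n := by exact_mod_cast hn
      rw [div_le_iff₀ (by linarith)]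
      calc |Y (walkPos n ω)| ≤ C * (1 + len S (walkPos n ω)) := h2 _
        _ ≤ C * (n + K * n) := by gcongr
        _ = _ := by ring
  · filter_upwards [has] with ω hω
    have := (hω.sub_const θ).abs
    simpa using this

/-- entropy = speed in the Green metric -/
theorem WalkOK.entropy (hw : WalkOK S μ K lam) (hg : Geo S δ) (hP : IsWalkMeasure μ P) {h : ℝ}
    (hh : HasEntropy μ h) : Tendsto (fun n : ℕ => Ex μ n (XG μ) / n) atTop (𝓝 h) := by
  have hS := hg.gen
  have := hP.1
  have hen : ∀ n, entropyAt μ n = ∑ g ∈ ball S (K * n), -(convPow μ n g * Real.log (convPow μ n g)) := by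
    intro n
    have := hw.Ex_eq hS (n := n) le_rfl (fun g => Real.log (convPow μ n g))
    unfold entropyAt
    unfold Ex at this
    rw [this, Finset.sum_neg_distrib]
  have up : ∀ n, Ex μ n (XG μ) ≤ entropyAt μ n := by
    intro n
    rw [hen, hw.Ex_eq hS le_rfl]
    refine Finset.sum_le_sum fun g _ => ?_
    rcases (convPow_nonneg hw.prob n g).eq_or_lt with e | e
    · simp [← e]
    · rw [← mul_neg]
      refine mul_le_mul_of_nonneg_left ?_ e.le
      unfold XG
      refine neg_le_neg (Real.log_le_log e ?_)
      rw [hw.greenFn_eq, ← ENNReal.ofReal_le_iff_le_toReal (hw.Gr_ne_top _ _)]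
      have := ENNReal.le_tsum (f := fun n => q μ ∅ n 1 g) n
      rw [q_convPow hw, inv_one, one_mul] at this
      exact this
  obtain ⟨A, hA1, hA⟩ : ∃ A : ℕ, 1 ≤ A ∧ (growthD S : ℝ) ^ K * lam ^ A ≤ 1 := by
    have := ((tendsto_pow_atTop_nhds_zero_of_lt_one hw.lam_pos.le hw.lam_lt).const_mul
      ((growthD S : ℝ) ^ K))
    rw [mul_zero] at this
    obtain ⟨A, h1, h2⟩ := ((this.eventually_le_const one_pos).and (eventually_ge_atTop 1)).exists
    exact ⟨A, h2, h1⟩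
  set c := 1 / (1 - lam) with hc
  have hcp : 0 < c := one_div_pos.2 (by linarith [hw.lam_lt])
  have hN : ∀ n : ℕ, ∑ g ∈ ball S (K * n), greenFn μ 1 g ≤ A * n + c := by
    intro n
    simp_rw [hw.greenFn_eq]
    rw [← ENNReal.toReal_sum (fun g _ => hw.Gr_ne_top _ _)]
    refine ENNReal.toReal_le_of_le_ofReal (by positivity) ?_
    have e : ∑ g ∈ ball S (K * n), Gr μ 1 g =
        ∑' i, P {ω | walkPos i ω ∈ {g | wd S 1 g ≤ K * n}} := by
      simp_rw [law_set hP]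
      rw [ENNReal.tsum_comm, tsum_eq_sum (s := ball S (K * n))]
      · refine Finset.sum_congr rfl fun g hg => ?_
        rw [mem_ball hS] at hg
        refine tsum_congr fun i => ?_
        rw [indicator_of_mem]
        change wd S 1 g ≤ _
        rwa [wd_one_left]
      · intro g hg
        rw [mem_ball hS] at hg
        refine ENNReal.tsum_eq_zero.2 fun i => indicator_of_notMem ?_ _
        intro h'
        change wd S 1 g ≤ _ at h'
        rw [wd_one_left] at h'
        exact hg h'
    rw [e]
    set D : ℝ≥0∞ := ((growthD S ^ (K * n) : ℕ) : ℝ≥0∞) with hD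
    have b : ∀ i, P {ω | walkPos i ω ∈ {g | wd S 1 g ≤ K * n}} ≤
        (if i ∈ Finset.range (A * n) then 1 else 0) +
          D * (if A * n ≤ i then ENNReal.ofReal lam ^ i else 0) := by
      intro i
      by_cases hi : A * n ≤ i
      · rw [if_neg (by simpa using hi), if_pos hi, zero_add]
        have := hw.P_ball hS hP i (K * n) 1
        rwa [if_pos (by rw [wl_one]; omega)] at this
      · rw [if_pos (by simpa using hi), if_neg hi, mul_zero, add_zero]
        exact prob_le_one
    refine (ENNReal.tsum_le_tsum b).trans ?_
    rw [ENNReal.tsum_add, ENNReal.tsum_mul_left, hw.tail,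
      tsum_eq_sum (s := Finset.range (A * n)) (by intro i hi; rw [if_neg hi]),
      Finset.sum_ite_mem, Finset.inter_self, Finset.sum_const, Finset.card_range, nsmul_one,
      ENNReal.ofReal_add (by positivity) hcp.le, hD, ← ENNReal.ofReal_natCast,
      ← ENNReal.ofReal_natCast, ← ENNReal.ofReal_mul (by positivity)]
    gcongr
    · push_cast; exact le_rfl
    · push_cast
      rw [pow_mul, pow_mul lam, ← mul_div_assoc, ← mul_pow, hc]
      have : 0 < 1 - lam := by linarith [hw.lam_lt]
      gcongr
      exact pow_le_one₀ (by have := hw.lam_pos; positivity) hA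
  have lo : ∀ n : ℕ, entropyAt μ n - Real.log (A * n + c) ≤ Ex μ n (XG μ) := by
    intro n
    have hNp : 0 < A * n + c := by positivity
    rw [hen, hw.Ex_eq hS le_rfl]
    have h1 := hw.Ex_one hS n
    rw [hw.Ex_eq hS le_rfl] at h1
    simp only [mul_one] at h1
    set N := A * n + c with hNdef
    have pt : ∀ g, -(convPow μ n g * Real.log (convPow μ n g)) - convPow μ n g * Real.log N
        - convPow μ n g * XG μ g ≤ greenFn μ 1 g / N - convPow μ n g := by
      intro g
      have gp0 := hw.green_pos 1 g
      rcases (convPow_nonneg hw.prob n g).eq_or_lt with e | e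
      · simp [← e]; positivity
      · have := Real.log_le_sub_one_of_pos (show 0 < greenFn μ 1 g / (N * convPow μ n g) by positivity)
        rw [Real.log_div gp0.ne' (by positivity), Real.log_mul hNp.ne' e.ne'] at this
        have t := mul_le_mul_of_nonneg_left this e.le
        have e4 : convPow μ n g * (greenFn μ 1 g / (N * convPow μ n g) - 1) =
          greenFn μ 1 g / N - convPow μ n g := by field_simp
        rw [e4] at t
        unfold XG
        linarith
    have tot := Finset.sum_le_sum (s := ball S (K * n)) fun g _ => pt g
    rw [Finset.sum_sub_distrib, Finset.sum_sub_distrib, Finset.sum_sub_distrib, ← Finset.sum_mul,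
      ← Finset.sum_div, h1, one_mul] at tot
    have := (div_le_one hNp).2 (hN n)
    linarith
  have hlog : Tendsto (fun n : ℕ => Real.log (A * n + c) / n) atTop (𝓝 0) := by
    have hA' : (1 : ℝ) ≤ A := by exact_mod_cast hA1
    have t1 : Tendsto (fun n : ℕ => (A : ℝ) * n + c) atTop atTop :=
      tendsto_atTop_add_const_right _ _
        (tendsto_natCast_atTop_atTop.const_mul_atTop (by linarith : (0 : ℝ) < A))
    have t2 := (Real.isLittleO_log_id_atTop.comp_tendsto t1).tendsto_div_nhds_zero
    have t3 : Tendsto (fun n : ℕ => (A : ℝ) + c / n) atTop (𝓝 (A + 0)) :=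
      tendsto_const_nhds.add (tendsto_const_div_atTop_nhds_zero_nat c)
    have t4 := t2.mul t3
    rw [zero_mul] at t4
    refine t4.congr' ?_
    filter_upwards [eventually_ge_atTop 1] with n hn
    have hn' : (0 : ℝ) < n := by exact_mod_cast hn
    simp only [Function.comp, id]
    have : (A : ℝ) * n + c ≠ 0 := by positivity
    field_simp
  have l1 := hh.sub hlog
  rw [sub_zero] at l1
  refine tendsto_of_tendsto_of_tendsto_of_le_of_le l1 hh (fun n => ?_) (fun n => ?_)
  · rw [← sub_div]
    exact div_le_div_of_nonneg_right (lo n) (Nat.cast_nonneg n)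
  · exact div_le_div_of_nonneg_right (up n) (Nat.cast_nonneg n)

end

/-! ## M9 -/
set_option linter.unusedSectionVars false
set_option linter.unusedVariables false
section
variable {S : Finset G} {δ : ℕ} {μ : G → ℝ} {K : ℕ} {lam : ℝ}

def shd (S : Finset G) (c : ℝ) (y : G) : Set G := {z | len S y - c ≤ gp S y z}

def stay (S : Finset G) (c : ℝ) (Λ : Set G) : Set (ℕ → G) :=
  {ω | ∃ n, walkPos n ω ∈ Λ ∧ ∀ k, walkPos (n + k) ω ∈ shd S c (walkPos n ω)}

theorem shd_mul (hS : Generates S) {c : ℝ} {y w : G} : y * w ∈ shd S c y ↔ gp S y⁻¹ w ≤ c := by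
  have := gp_ident hS y w
  change len S y - c ≤ gp S y (y * w) ↔ _
  constructor <;> intro h <;> linarith

theorem shd_len (hS : Generates S) {c : ℝ} {y z : G} (h : z ∈ shd S c y) : len S y - c ≤ len S z :=
  (show len S y - c ≤ gp S y z from h).trans (gp_le_right hS y z)

theorem shd_trans (hg : Geo S δ) {c c' : ℝ} (hc : 0 ≤ c) (hc' : 0 ≤ c') {y z w : G} (h : z ∈ shd S c y)
    (h' : w ∈ shd S c' z) : w ∈ shd S (c + c' + δ) y := by
  have h1 : len S y - c ≤ gp S y z := h
  have h2 : len S z - c' ≤ gp S z w := h'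
  have h3 := shd_len hg.gen h
  have h4 := hg.hyp y z w
  have : len S y - c - c' ≤ min (gp S y z) (gp S z w) := le_min (by linarith) (by linarith)
  change len S y - (c + c' + δ) ≤ gp S y w
  linarith

variable [Countable G] [MeasurableSpace G] [MeasurableSingletonClass G] {P : Measure (ℕ → G)}

theorem ms_all (T : Set G) : MeasurableSet {ω : ℕ → G | ∀ k, walkPos k ω ∈ T} := by
  have : {ω : ℕ → G | ∀ k, walkPos k ω ∈ T} = ⋂ k, {ω | walkPos k ω ∈ T} := by ext; simp
  rw [this]; exact MeasurableSet.iInter fun k => ms_pos k T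

theorem ms_stay (c : ℝ) (Λ : Set G) : MeasurableSet (stay S c Λ) := by
  have : stay S c Λ = ⋃ n, ⋃ b : G, {ω | walkPos n ω ∈ Λ ∩ {b}} ∩ ⋂ k, {ω | walkPos (n + k) ω ∈ shd S c b} := by
    ext ω
    simp only [stay, mem_ofPred_eq, mem_iUnion, mem_inter_iff, mem_iInter, mem_singleton_iff]
    constructor
    · rintro ⟨n, h1, h2⟩; exact ⟨n, _, ⟨h1, rfl⟩, h2⟩
    · rintro ⟨n, b, ⟨h1, h3⟩, h2⟩; subst h3; exact ⟨n, h1, h2⟩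
  rw [this]
  exact MeasurableSet.iUnion fun n => MeasurableSet.iUnion fun b =>
    (ms_pos _ _).inter (MeasurableSet.iInter fun k => ms_pos _ _)

theorem half_compl [IsProbabilityMeasure P] {A : Set (ℕ → G)} (hA : MeasurableSet A) (h : P Aᶜ ≤ 1 / 2) :
    1 / 2 ≤ P A := by
  have h1 := prob_add_prob_compl (μ := P) hA
  by_contra h2
  push Not at h2
  have : P A + P Aᶜ < 1 / 2 + 1 / 2 := ENNReal.add_lt_add_of_lt_of_le (by finiteness) h2 h
  rw [h1, ENNReal.add_halves] at this
  exact lt_irrefl _ this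

/-- half-probability deviation constant -/
def Half (S : Finset G) (P : Measure (ℕ → G)) (c : ℝ) : Prop :=
  0 ≤ c ∧ ∀ a : G, P (hit {g | c ≤ gp S a g}) ≤ 1 / 2

theorem Half.mono {c c' : ℝ} (h : Half S P c) (hc : c ≤ c') : Half S P c' :=
  ⟨h.1.trans hc, fun a => (measure_mono (hit_mono fun g hg => hc.trans hg)).trans (h.2 a)⟩

theorem Half.stay_prob (hg : Geo S δ) (hP : IsWalkMeasure μ P) {c : ℝ} (h : Half S P c) (z : G) :
    1 / 2 ≤ P {ω | ∀ k, walkPos k ω ∈ {g | z * g ∈ shd S c z}} := by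
  have := hP.1
  refine half_compl (ms_all _) ((measure_mono ?_).trans (h.2 z⁻¹))
  intro ω hω
  simp only [mem_compl_iff, mem_ofPred_eq, not_forall, shd_mul hg.gen] at hω
  obtain ⟨k, hk⟩ := hω
  exact ⟨k, (not_le.1 hk).le⟩

theorem Half.SL (hg : Geo S δ) (hP : IsWalkMeasure μ P) {c : ℝ} (h : Half S P c) (Λ : Set G) :
    P (hit Λ) ≤ 2 * P (stay S c Λ) := by
  have := strong_markov hP Λ (fun z => {ω | ∀ k, walkPos k ω ∈ {g | z * g ∈ shd S c z}})
    (fun z => ms_all _) (1 / 2) fun z _ => h.stay_prob hg hP z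
  have e : {ω : ℕ → G | ∃ n, walkPos n ω ∈ Λ ∧ sh n ω ∈ {ω' : ℕ → G | ∀ k, walkPos k ω' ∈
      {g | walkPos n ω * g ∈ shd S c (walkPos n ω)}}} ⊆ stay S c Λ := by
    rintro ω ⟨n, h1, h2⟩
    exact ⟨n, h1, fun k => by rw [walkPos_add]; exact h2 k⟩
  have h3 := mul_le_mul_right (this.trans (measure_mono e)) 2
  rwa [← mul_assoc, one_div, ENNReal.mul_inv_cancel (by norm_num) (by norm_num), one_mul] at h3

theorem exit_sum (hP : IsWalkMeasure μ P) (A : G → Set (ℕ → G)) (hA : ∀ z, MeasurableSet (A z))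
    (hd : ∀ ω : ℕ → G, ∀ n m, n < m → sh n ω ∈ A (walkPos n ω) → sh m ω ∉ A (walkPos m ω)) :
    ∑' z, Gr μ 1 z * P (A z) ≤ 1 := by
  have := hP.1
  have e : ∀ p : ℕ × G, q μ ∅ p.1 1 p.2 * P (A p.2) =
      P ({ω | walkPos p.1 ω ∈ ({p.2} : Set G)} ∩ sh p.1 ⁻¹' (A p.2)) := by
    intro p
    rw [markov hP (dep_pos le_rfl _) (hA _), ← law hP]; rfl
  have : ∑' z, Gr μ 1 z * P (A z) = ∑' p : ℕ × G, q μ ∅ p.1 1 p.2 * P (A p.2) := by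
    rw [ENNReal.tsum_prod (f := fun n z => q μ ∅ n 1 z * P (A z)), ENNReal.tsum_comm]
    simp_rw [ENNReal.tsum_mul_right]
    rfl
  rw [this]
  simp_rw [e]
  rw [← measure_iUnion]
  · exact prob_le_one
  · rintro ⟨n, z⟩ ⟨m, y⟩ hne
    refine Set.disjoint_left.2 ?_
    rintro ω ⟨a1, a2⟩ ⟨b1, b2⟩
    simp only [mem_ofPred_eq, mem_singleton_iff, mem_preimage] at a1 a2 b1 b2
    subst a1; subst b1
    rcases lt_trichotomy n m with h | h | h
    · exact hd ω n m h a2 b2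
    · subst h; exact hne rfl
    · exact hd ω m n h b2 a2
  · intro p; exact (ms_pos _ _).inter (meas_sh _ (hA _))

theorem WalkOK.Gr_exp (hw : WalkOK S μ K lam) (y : G) : Gr μ 1 y = ENNReal.ofReal (Real.exp (-XG μ y)) := by
  rw [← hw.green_eq_exp, hw.greenFn_eq, ENNReal.ofReal_toReal (hw.Gr_ne_top _ _)]

theorem WalkOK.SU (hw : WalkOK S μ K lam) (hg : Geo S δ) (hP : IsWalkMeasure μ P) {c : ℝ} (hc : 0 ≤ c) :
    ∃ D : ℝ≥0∞, D ≠ ⊤ ∧ ∀ y, P (hit (shd S c y)) ≤ D * Gr μ 1 y := by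
  have hS := hg.gen
  have := hP.1
  obtain ⟨c2, hc2⟩ := hw.dev_small hg hP (1 / 2) (by norm_num)
  have hH : Half S P c2 := ⟨Nat.cast_nonneg _, hc2⟩
  obtain ⟨C, hC, -, hX2, hX3⟩ := hw.X_props hg
  set c' : ℝ := c + c2 + δ with hc'
  have hc'0 : 0 ≤ c' := by positivity
  set D0 := ENNReal.ofReal (Real.exp (C * (1 + (c' + K)))) with hD0
  refine ⟨2 * D0, by finiteness, fun y => ?_⟩
  set A := shd S c' y with hA
  have s1 : P (hit (shd S c y)) ≤ 2 * P {ω | ∃ n, ∀ k, walkPos (n + k) ω ∈ A} := by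
    have := strong_markov hP (shd S c y) (fun z => {ω | ∀ k, walkPos k ω ∈ {g | z * g ∈ shd S c2 z}})
      (fun z => ms_all _) (1 / 2) fun z _ => hH.stay_prob hg hP z
    have e : {ω : ℕ → G | ∃ n, walkPos n ω ∈ shd S c y ∧ sh n ω ∈ {ω' : ℕ → G | ∀ k, walkPos k ω' ∈
        {g | walkPos n ω * g ∈ shd S c2 (walkPos n ω)}}} ⊆ {ω | ∃ n, ∀ k, walkPos (n + k) ω ∈ A} := by
      rintro ω ⟨n, h1, h2⟩
      exact ⟨n, fun k => by rw [walkPos_add]; exact shd_trans hg hc hH.1 h1 (h2 k)⟩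
    have h3 := mul_le_mul_right (this.trans (measure_mono e)) 2
    rwa [← mul_assoc, one_div, ENNReal.mul_inv_cancel (by norm_num) (by norm_num), one_mul] at h3
  refine s1.trans ?_
  rw [mul_assoc]
  refine mul_le_mul_right ?_ _
  by_cases h1 : (1 : G) ∈ A
  · have l : len S y ≤ c' := by
      have : len S y - c' ≤ gp S y 1 := h1
      rw [gp_comm hS, gp_one_left hS] at this
      linarith
    refine prob_le_one.trans ?_
    rw [hw.Gr_exp, hD0, ← ENNReal.ofReal_mul (Real.exp_pos _).le, ← Real.exp_add, ENNReal.one_le_ofReal]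
    refine Real.one_le_exp ?_
    have a1 := (abs_le.1 (hX3 y)).2
    have a2 : C * (1 + len S y) ≤ C * (1 + (c' + K)) := by
      gcongr; exact l.trans (le_add_of_nonneg_right (Nat.cast_nonneg K))
    linarith
  · set E : G → Set (ℕ → G) := fun z => {ω | z ∉ A ∧ ∀ k, z * walkPos (k + 1) ω ∈ A} with hE
    have mE' : ∀ z, MeasurableSet (E z) := by
      intro z
      have : E z = {ω : ℕ → G | z ∉ A} ∩ ⋂ k, {ω | walkPos (k + 1) ω ∈ {g | z * g ∈ A}} := by
        ext ω; simp [hE]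
      rw [this]
      exact (MeasurableSet.const _).inter (MeasurableSet.iInter fun k => ms_pos _ _)
    have s2 : {ω : ℕ → G | ∃ n, ∀ k, walkPos (n + k) ω ∈ A} ⊆ {ω | ∃ n, sh n ω ∈ E (walkPos n ω)} := by
      classical
      intro ω hω
      have hn := Nat.find_spec hω
      have hmin := fun m hm => Nat.find_min hω (m := m) hm
      change ∃ n, ∀ k, walkPos (n + k) ω ∈ A at hω
      set n := Nat.find hω
      obtain ⟨m, hm⟩ : ∃ m, n = m + 1 := by
        refine Nat.exists_eq_succ_of_ne_zero fun h0 => h1 ?_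
        have := hn 0
        rw [h0] at this; exact this
      refine ⟨m, fun hmA => hmin m (by omega) fun k => ?_, fun k => ?_⟩
      · cases k with
        | zero => exact hmA
        | succ k => have := hn k; rw [hm] at this; rwa [show m + (k + 1) = m + 1 + k by ring]
      · rw [← walkPos_add]
        have := hn k; rw [hm] at this; rwa [show m + (k + 1) = m + 1 + k by ring]
    refine ((measure_mono s2).trans (union_markov hP E mE')).trans ?_
    have pt : ∀ z, Gr μ 1 z * P (E z) ≤ D0 * Gr μ 1 y * (Gr μ y z * P (E z)) := by
      intro z
      by_cases hz : P (E z) = 0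
      · simp [hz]
      rw [← mul_assoc]
      refine mul_le_mul_left ?_ _
      obtain ⟨b, hb, hbA⟩ : ∃ b, wordLength S b ≤ K ∧ z * b ∈ A := by
        by_contra hcon
        push Not at hcon
        apply hz
        have := hw.ae_len hS hP 1
        rw [ae_iff] at this
        refine measure_mono_null (fun ω hω => ?_) this
        intro hl
        exact hcon _ (by simpa using hl) (hω.2 0)
      have g1 := gp_lip hS y (z * b) z
      have g2 : len S y - c' ≤ gp S y (z * b) := hbA
      have g3 : len S ((z * b)⁻¹ * z) ≤ K := by
        rw [show (z * b)⁻¹ * z = b⁻¹ by group, len_inv hS]; unfold len; exact_mod_cast hb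
      have g4 := gp_ident hS y (y⁻¹ * z)
      rw [mul_inv_cancel_left] at g4
      have x := hX2 y (y⁻¹ * z)
      rw [mul_inv_cancel_left] at x
      rw [Gr_eq_one μ y z, hw.Gr_exp, hw.Gr_exp, hw.Gr_exp, hD0, ← ENNReal.ofReal_mul (Real.exp_pos _).le,
        ← Real.exp_add, ← ENNReal.ofReal_mul (Real.exp_pos _).le, ← Real.exp_add]
      refine ENNReal.ofReal_le_ofReal (Real.exp_le_exp.2 ?_)
      have : C * (1 + gp S y⁻¹ (y⁻¹ * z)) ≤ C * (1 + (c' + K)) := by gcongr; linarith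
      linarith
    refine (ENNReal.tsum_le_tsum pt).trans ?_
    rw [ENNReal.tsum_mul_left]
    refine (mul_le_mul_right ?_ _).trans (mul_one _).le
    rw [← (Equiv.mulLeft y).tsum_eq]
    simp only [Equiv.coe_mulLeft]
    have := exit_sum hP (fun z => E (y * z)) (fun z => mE' _) ?_
    · refine le_trans (ENNReal.tsum_le_tsum fun z => ?_) this
      rw [Gr_eq_one μ y, inv_mul_cancel_left]
    · intro ω n m hnm h2 h3
      obtain ⟨k, rfl⟩ := Nat.exists_eq_add_of_lt hnm
      apply h3.1
      have := h2.2 k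
      rwa [mul_assoc, ← walkPos_add, ← add_assoc] at this

theorem hit_sub_vit (hg : Geo S δ) {c c2 : ℝ} (hc : 0 ≤ c) (hc2 : 0 ≤ c2) {a b w z : G}
    (h1 : w ∈ shd S c2 a) (h2 : w ∈ shd S c2 b) (hl : len S b ≤ len S a + 1) (hz : z ∈ shd S c a) :
    z ∈ shd S (c + c2 + 1 + 2 * δ) b := by
  have h1' : len S a - c2 ≤ gp S a w := h1
  have h2' : len S b - c2 ≤ gp S b w := h2
  have h3' : len S a - c ≤ gp S a z := hz
  have e1 := hg.hyp b w a
  rw [gp_comm hg.gen w a] at e1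
  have e2 := hg.hyp b a z
  have m1 : len S b - c2 - 1 ≤ min (gp S b w) (gp S a w) := le_min (by linarith) (by linarith)
  have m2 : len S b - c2 - 1 - c - δ ≤ min (gp S b a) (gp S a z) :=
    le_min (by linarith) (by have : (0:ℝ) ≤ δ := Nat.cast_nonneg _; linarith)
  change len S b - _ ≤ gp S b z
  linarith

theorem vitali (hg : Geo S δ) (hw : WalkOK S μ K lam) (hP : IsWalkMeasure μ P)
    {μ' : G → ℝ} {K' : ℕ} {lam' : ℝ} {P' : Measure (ℕ → G)} (hw' : WalkOK S μ' K' lam')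
    (hP' : IsWalkMeasure μ' P') {c c2 : ℝ} (hc : 0 ≤ c) (h2 : Half S P' c2) :
    ∃ D : ℝ≥0∞, D ≠ ⊤ ∧ ∀ (Λ : Set G) (κ : ℝ≥0∞), (∀ y ∈ Λ, Gr μ 1 y ≤ κ * Gr μ' 1 y) →
      P {ω | ∃ n, ∃ a ∈ Λ, walkPos n ω ∈ shd S c a} ≤ D * κ * P' (stay S c2 Λ) := by
  have hS := hg.gen
  obtain ⟨D, hD, hSU⟩ := hw.SU hg hP (c := c + c2 + 1 + 2 * δ) (by have := h2.1; positivity)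
  refine ⟨2 * D * Gr μ' 1 1, by have := hw'.Gr_ne_top 1 1; finiteness, fun Λ κ hκ => ?_⟩
  obtain ⟨u, huΛ, hdis, hcov⟩ := Vitali.exists_disjoint_subfamily_covering_enlargement
    (shd S c2) Λ (fun y => Real.exp (-len S y)) 2 one_lt_two (fun a _ => (Real.exp_pos _).le) 1
    (fun a _ => by rw [Real.exp_le_one_iff]; linarith [len_nonneg S a])
    (fun a _ => ⟨a, by
      change len S a - c2 ≤ gp S a a
      rw [gp_self]; linarith [h2.1]⟩)
  have hsub : {ω : ℕ → G | ∃ n, ∃ a ∈ Λ, walkPos n ω ∈ shd S c a} ⊆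
      ⋃ b ∈ u, hit (shd S (c + c2 + 1 + 2 * δ) b) := by
    rintro ω ⟨n, a, ha, hn⟩
    obtain ⟨b, hb, ⟨w, hwa, hwb⟩, hab⟩ := hcov a ha
    refine mem_biUnion hb ⟨n, hit_sub_vit hg hc h2.1 hwa hwb ?_ hn⟩
    have : Real.exp (-len S a) ≤ Real.exp (1 - len S b) := by
      refine hab.trans ?_
      rw [sub_eq_add_neg, Real.exp_add]
      gcongr
      linarith [Real.add_one_le_exp (1 : ℝ)]
    rw [Real.exp_le_exp] at this
    linarith
  have hdj : u.PairwiseDisjoint fun b => stay S c2 {b} := by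
    intro b hb b' hb' hne
    refine Set.disjoint_left.2 ?_
    rintro ω ⟨n, h1, h2⟩ ⟨m, h3, h4⟩
    rw [mem_singleton_iff] at h1 h3
    rw [h1] at h2; rw [h3] at h4
    have := h4 n
    rw [add_comm] at this
    exact Set.disjoint_left.1 (hdis hb hb' hne) (h2 m) this
  calc P {ω | ∃ n, ∃ a ∈ Λ, walkPos n ω ∈ shd S c a}
      ≤ ∑' b : u, P (hit (shd S (c + c2 + 1 + 2 * δ) (b : G))) :=
        (measure_mono hsub).trans (measure_biUnion_le _ (to_countable u) _)
    _ ≤ ∑' b : u, 2 * D * Gr μ' 1 1 * κ * P' (stay S c2 {(b : G)}) := by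
        refine ENNReal.tsum_le_tsum fun b => ?_
        calc P (hit (shd S (c + c2 + 1 + 2 * δ) (b : G))) ≤ D * Gr μ 1 b := hSU b
          _ ≤ D * (κ * Gr μ' 1 b) := mul_le_mul_right (hκ b (huΛ b.2)) _
          _ ≤ D * (κ * (Gr μ' 1 1 * P' (hit {(b : G)}))) := by gcongr; exact Gr_le_hit hP' b
          _ ≤ D * (κ * (Gr μ' 1 1 * (2 * P' (stay S c2 {(b : G)})))) := by gcongr; exact h2.SL hg hP' _
          _ = _ := by ring
    _ = 2 * D * Gr μ' 1 1 * κ * P' (⋃ b ∈ u, stay S c2 {b}) := by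
        rw [ENNReal.tsum_mul_left, measure_biUnion (to_countable u) hdj fun b _ => ms_stay _ _]
    _ ≤ _ := by
        refine mul_le_mul_right (measure_mono ?_) _
        refine iUnion₂_subset fun b hb => ?_
        rintro ω ⟨n, h1, h2⟩
        exact ⟨n, by rw [mem_singleton_iff.1 h1]; exact huΛ hb, h2⟩

end

/-! ## M10 -/
set_option linter.unusedSectionVars false
set_option linter.unusedVariables false
section
variable {S : Finset G} {δ : ℕ} {μ μ' : G → ℝ} {K K' : ℕ} {lam lam' : ℝ}
variable [Countable G] [MeasurableSpace G] [MeasurableSingletonClass G] {P P' : Measure (ℕ → G)}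

theorem pos_sub_hit (n : ℕ) (A : Set G) : {ω : ℕ → G | walkPos n ω ∈ A} ⊆ hit A :=
  fun ω h => ⟨n, h⟩

theorem WalkOK.flex (hw : WalkOK S μ K lam) (hg : Geo S δ) (hP : IsWalkMeasure μ P) :
    ∃ c : ℝ, 0 ≤ c ∧ ∃ T : Finset G, ∀ y g : G, ∃ t ∈ T, gp S y (t * g) ≤ c := by
  have hS := hg.gen
  have := hP.1
  obtain ⟨r, hr⟩ := hw.dev_small hg hP (1 / 4) (by norm_num)
  set L := 2 * r + δ with hL
  obtain ⟨m, hm⟩ : ∃ m, P {ω | walkPos m ω ∈ {g | wd S 1 g ≤ L}} ≤ 1 / 4 := by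
    have t : Tendsto (fun m : ℕ => ((growthD S ^ L : ℕ) : ℝ≥0∞) * ENNReal.ofReal lam ^ m) atTop
        (𝓝 (((growthD S ^ L : ℕ) : ℝ≥0∞) * 0)) :=
      ENNReal.Tendsto.const_mul (ENNReal.tendsto_pow_atTop_nhds_zero_of_lt_one
        (by rw [ENNReal.ofReal_lt_one]; exact hw.lam_lt)) (Or.inr (ENNReal.natCast_ne_top _))
    rw [mul_zero] at t
    obtain ⟨m, hm⟩ := (t.eventually_le_const (show (0 : ℝ≥0∞) < 1 / 4 by norm_num)).exists
    refine ⟨m, (hw.P_ball hS hP m L 1).trans ?_⟩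
    rwa [if_pos (by rw [wl_one]; omega)]
  refine ⟨r + δ, by positivity, ball S (K * m), fun y g => ?_⟩
  by_contra hcon
  push Not at hcon
  have hsym : P {ω | walkPos m ω ∈ {h | (r : ℝ) ≤ gp S g h⁻¹}} = P {ω | walkPos m ω ∈ {h | (r : ℝ) ≤ gp S g h}} := by
    rw [law_set hP, law_set hP, ← (Equiv.inv G).tsum_eq]
    refine tsum_congr fun h => ?_
    have e : q μ ∅ m 1 h⁻¹ = q μ ∅ m 1 h := by
      rw [← q_shift μ m h 1 h⁻¹, mul_one, mul_inv_cancel, q_symm hw.symm]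
    simp only [indicator, mem_ofPred_eq, Equiv.inv_apply, inv_inv, e]
  have cov : ∀ᵐ ω ∂P, ω ∈ (({ω | walkPos m ω ∈ {h | (r : ℝ) ≤ gp S y h}} ∪
      {ω | walkPos m ω ∈ {h | (r : ℝ) ≤ gp S g h⁻¹}}) ∪ {ω | walkPos m ω ∈ {g | wd S 1 g ≤ L}} : Set (ℕ → G)) := by
    filter_upwards [hw.ae_len hS hP m] with ω hω
    set w := walkPos m ω with hwdef
    by_contra hno
    simp only [mem_union, mem_ofPred_eq, not_or, not_le, ← hwdef] at hno
    obtain ⟨⟨n1, n2⟩, n3⟩ := hno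
    have h0 := hcon w ((mem_ball hS).2 hω)
    have h1 := gp_ident hS w g
    rw [gp_comm hS w⁻¹ g] at h1
    have h2 := hg.hyp y (w * g) w
    rw [gp_comm hS (w * g) w] at h2
    rw [wd_one_left] at n3
    have n3' : (2 * r + δ : ℝ) < len S w := by unfold len; exact_mod_cast n3
    have : (r : ℝ) + δ < min (gp S y (w * g)) (gp S w (w * g)) := lt_min h0 (by linarith)
    linarith
  have b := measure_mono_ae (μ := P) (s := univ) (cov.mono fun ω h _ => h)
  rw [measure_univ] at b
  have i1 : P {ω | walkPos m ω ∈ {h | (r : ℝ) ≤ gp S y h}} ≤ 1 / 4 :=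
    (measure_mono (pos_sub_hit m _)).trans (hr y)
  have i2 : P {ω | walkPos m ω ∈ {h | (r : ℝ) ≤ gp S g h⁻¹}} ≤ 1 / 4 := by
    rw [hsym]; exact (measure_mono (pos_sub_hit m _)).trans (hr g)
  have b2 : (1 : ℝ≥0∞) ≤ 1 / 4 + 1 / 4 + 1 / 4 := b.trans ((measure_union_le _ _).trans
    (add_le_add ((measure_union_le _ _).trans (add_le_add i1 i2)) hm))
  have b3 := ENNReal.toReal_mono (by finiteness) b2
  rw [ENNReal.toReal_add (by finiteness) (by finiteness), ENNReal.toReal_add (by finiteness) (by finiteness)] at b3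
  norm_num at b3

theorem WalkOK.X_abs (hw : WalkOK S μ K lam) (hg : Geo S δ) :
    ∃ C : ℝ, 0 ≤ C ∧ (∀ a b, |XG μ (a * b) - XG μ a - XG μ b| ≤ C * (1 + gp S a⁻¹ b)) ∧
      (∀ g, |XG μ g| ≤ C * (1 + len S g)) := by
  obtain ⟨C, h0, h1, h2, h3⟩ := hw.X_props hg
  refine ⟨C, h0, fun a b => abs_le.2 ⟨by linarith [h2 a b], ?_⟩, h3⟩
  have := mul_nonneg h0 (gp_nonneg hg.gen a⁻¹ b)
  linarith [h1 a b]

/-- two walks on the same hyperbolic group -/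
structure Two (S : Finset G) (δ : ℕ) (μ μ' : G → ℝ) (K K' : ℕ) (lam lam' : ℝ) (P P' : Measure (ℕ → G)) :
    Prop where
  g : Geo S δ
  w : WalkOK S μ K lam
  w' : WalkOK S μ' K' lam'
  p : IsWalkMeasure μ P
  p' : IsWalkMeasure μ' P'

theorem Two.symm (T : Two S δ μ μ' K K' lam lam' P P') : Two S δ μ' μ K' K lam' lam P' P :=
  ⟨T.g, T.w', T.w, T.p', T.p⟩

def psi (μ μ' : G → ℝ) (g : G) : ℝ := XG μ' g - XG μ g

theorem Two.psi_props (T : Two S δ μ μ' K K' lam lam' P P') :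
    ∃ C : ℝ, 0 ≤ C ∧ (∀ a b, |psi μ μ' (a * b) - psi μ μ' a - psi μ μ' b| ≤ C * (1 + gp S a⁻¹ b)) ∧
      (∀ g, |psi μ μ' g| ≤ C * (1 + len S g)) := by
  obtain ⟨C, h0, h1, h2⟩ := T.w.X_abs T.g
  obtain ⟨C', h0', h1', h2'⟩ := T.w'.X_abs T.g
  refine ⟨C' + C, by linarith, fun a b => ?_, fun g => ?_⟩
  · rw [add_mul, show psi μ μ' (a * b) - psi μ μ' a - psi μ μ' b =
      (XG μ' (a * b) - XG μ' a - XG μ' b) - (XG μ (a * b) - XG μ a - XG μ b) by unfold psi; ring]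
    exact (abs_sub _ _).trans (add_le_add (h1' a b) (h1 a b))
  · rw [add_mul]
    exact (abs_sub _ _).trans (add_le_add (h2' g) (h2 g))

theorem Two.Gr_cmp (T : Two S δ μ μ' K K' lam lam' P P') {y : G} {b : ℝ} (h : psi μ μ' y ≤ b) :
    Gr μ 1 y ≤ ENNReal.ofReal (Real.exp b) * Gr μ' 1 y := by
  rw [T.w.Gr_exp, T.w'.Gr_exp, ← ENNReal.ofReal_mul (Real.exp_pos _).le, ← Real.exp_add]
  refine ENNReal.ofReal_le_ofReal (Real.exp_le_exp.2 ?_)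
  unfold psi at h; linarith

theorem Two.max (T : Two S δ μ μ' K K' lam lam' P P') :
    ∃ D : ℝ≥0∞, D ≠ ⊤ ∧ ∀ M : ℝ, P' (hit {g | M ≤ psi μ μ' g}) ≤ D * ENNReal.ofReal (Real.exp (-M)) := by
  have := T.p.1
  obtain ⟨c2, hc2⟩ := T.w.dev_small T.g T.p (1 / 2) (by norm_num)
  obtain ⟨D, hD, h⟩ := vitali T.g T.w' T.p' T.w T.p (c := 0) (c2 := c2) le_rfl ⟨Nat.cast_nonneg _, hc2⟩
  refine ⟨D, hD, fun M => ?_⟩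
  have h1 := h {g | M ≤ psi μ μ' g} (ENNReal.ofReal (Real.exp (-M))) fun y hy => T.symm.Gr_cmp (by
    have : M ≤ psi μ μ' y := hy
    unfold psi at this ⊢; linarith)
  refine (measure_mono ?_).trans (h1.trans ((mul_le_mul_right prob_le_one _).trans (mul_one _).le))
  rintro ω ⟨n, hn⟩
  refine ⟨n, _, hn, ?_⟩
  change len S (walkPos n ω) - 0 ≤ gp S (walkPos n ω) (walkPos n ω)
  rw [gp_self, sub_zero]

theorem Two.rigid (T : Two S δ μ μ' K K' lam lam' P P') (M : ℝ)
    (hpos : P' {ω | ∀ j, walkPos j ω ∈ {g | |psi μ μ' g| ≤ M}} ≠ 0) :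
    ∃ B : ℝ, ∀ g, |psi μ μ' g| ≤ B := by
  have hS := T.g.gen
  have := T.p'.1
  obtain ⟨C, hC, hψ, hψ2⟩ := T.psi_props
  obtain ⟨c, hc, F, hF⟩ := T.w'.flex T.g T.p'
  set R := ∑ t ∈ F, len S t with hR
  have hFR : ∀ t ∈ F, len S t ≤ R := fun t ht => Finset.single_le_sum (fun t _ => len_nonneg S t) ht
  refine ⟨2 * M + C * (1 + c) + 2 * (C * (1 + R)), fun g => ?_⟩
  suffices ∃ x : G, |psi μ μ' x| ≤ M ∧ ∃ t ∈ F, gp S x⁻¹ (t * g) ≤ c ∧ |psi μ μ' (x * (t * g))| ≤ M by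
    obtain ⟨x, h1, t, ht, h2, h3⟩ := this
    have a1 := hψ x (t * g)
    have a2 : C * (1 + gp S x⁻¹ (t * g)) ≤ C * (1 + c) := by gcongr
    have a3 := hψ t g
    have a4 : C * (1 + gp S t⁻¹ g) ≤ C * (1 + R) := by
      gcongr
      exact (gp_le_left hS _ _).trans (by rw [len_inv hS]; exact hFR t ht)
    have a5 := hψ2 t
    have a6 : C * (1 + len S t) ≤ C * (1 + R) := by gcongr; exact hFR t ht
    rw [abs_le] at *
    constructor <;> linarith
  by_contra hno
  push Not at hno
  obtain ⟨q0, hq0, hq⟩ : ∃ q0 : ℝ≥0∞, q0 ≠ 0 ∧ ∀ t ∈ F, q0 ≤ P' (hit {t * g}) := by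
    obtain ⟨t0, ht0, -⟩ := hF 1 1
    obtain ⟨t, ht, hmin⟩ := F.exists_min_image (fun t => P' (hit {t * g})) ⟨t0, ht0⟩
    refine ⟨_, fun h0 => ?_, hmin⟩
    have := Gr_le_hit T.p' (t * g)
    rw [h0, mul_zero] at this
    exact T.w'.Gr_pos _ _ (nonpos_iff_eq_zero.1 this)
  set E : ℕ → Set (ℕ → G) := fun n => {ω | ∀ j ≤ n, walkPos j ω ∈ {g | |psi μ μ' g| ≤ M}} with hE
  have dE : ∀ n, Dep n (E n) := by
    intro n ω ω' hω
    have hco : ∀ j ≤ n, walkPos j ω = walkPos j ω' := fun j hj =>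
      walkPos_congr j ω ω' fun i hi => hω i (by omega)
    simp only [hE, mem_ofPred_eq]
    exact fun h j hj => by rw [← hco j hj]; exact h j hj
  have mE' : ∀ n, MeasurableSet (E n) := fun n => (dE n).meas
  set E0 := {ω : ℕ → G | ∀ j, walkPos j ω ∈ {g | |psi μ μ' g| ≤ M}} with hE0
  have hsub : ∀ n, E0 ⊆ E n := fun n ω hω j _ => hω j
  have hlim : Tendsto (fun n => P' (E n)) atTop (𝓝 (P' E0)) := by
    have e : E0 = ⋂ n, E n := by
      ext ω; simp only [mem_iInter]
      exact ⟨fun h n => hsub n h, fun h j => h j j le_rfl⟩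
    rw [e]
    exact tendsto_measure_iInter_atTop (fun n => (mE' n).nullMeasurableSet)
      (fun m n h ω hω j hj => hω j (hj.trans h)) ⟨0, by finiteness⟩
  have step : ∀ n, q0 * P' E0 + P' E0 ≤ P' (E n) := by
    intro n
    choose t ht1 ht2 using fun x : G => hF x⁻¹ g
    set V : G → Set (ℕ → G) := fun x => (E n ∩ {ω | walkPos n ω ∈ ({x} : Set G)}) ∩ sh n ⁻¹' (hit {t x * g}) with hV
    have dV : ∀ x, Dep n (E n ∩ {ω | walkPos n ω ∈ ({x} : Set G)}) := fun x => (dE n).inter (dep_pos le_rfl _)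
    have mV : ∀ x, MeasurableSet (V x) := fun x => (dV x).meas.inter (meas_sh n (ms_hit _))
    have dis : Pairwise (Function.onFun Disjoint fun x => E n ∩ {ω : ℕ → G | walkPos n ω ∈ ({x} : Set G)}) := by
      intro x y hne
      refine Set.disjoint_left.2 ?_
      rintro ω ⟨-, h1⟩ ⟨-, h2⟩
      exact hne ((mem_singleton_iff.1 h1).symm.trans (mem_singleton_iff.1 h2))
    have eE : E n = ⋃ x, (E n ∩ {ω : ℕ → G | walkPos n ω ∈ ({x} : Set G)}) := by
      ext ω; simp
    have h1 : q0 * P' (E n) ≤ P' (⋃ x, V x) := by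
      rw [measure_iUnion (fun x y h => (dis h).mono inter_subset_left inter_subset_left) mV]
      conv_lhs => rw [eE, measure_iUnion dis fun x => (dV x).meas, ← ENNReal.tsum_mul_left]
      refine ENNReal.tsum_le_tsum fun x => ?_
      rw [markov T.p' (dV x) (ms_hit _), mul_comm]
      exact mul_le_mul_right (hq _ (ht1 x)) _
    have h2 : Disjoint (⋃ x, V x) E0 := by
      refine Set.disjoint_left.2 fun ω hω h0 => ?_
      obtain ⟨x, ⟨_, hx⟩, k, hk⟩ := mem_iUnion.1 hω
      rw [mem_ofPred_eq, mem_singleton_iff] at hx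
      have hk' : walkPos k (sh n ω) = t x * g := hk
      have a := h0 n
      have b := h0 (n + k)
      rw [walkPos_add, hk', hx] at b
      rw [hx] at a
      exact absurd b (not_le.2 (hno x a (t x) (ht1 x) (ht2 x)))
    calc q0 * P' E0 + P' E0 ≤ P' (⋃ x, V x) + P' E0 := by
          gcongr; exact (mul_le_mul_right (measure_mono (hsub n)) _).trans h1
      _ = P' ((⋃ x, V x) ∪ E0) := (measure_union h2 (ms_all _)).symm
      _ ≤ _ := measure_mono (union_subset (iUnion_subset fun x ω hω => hω.1.1) (hsub n))
  have hfin := ge_of_tendsto' hlim step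
  have : q0 * P' E0 ≤ 0 := by
    refine (ENNReal.add_le_add_iff_right (a := P' E0) (by finiteness)).1 ?_
    rwa [zero_add]
  rcases mul_eq_zero.1 (nonpos_iff_eq_zero.1 this) with h | h
  · exact hq0 h
  · exact hpos h

theorem Two.rigid2 (T : Two S δ μ μ' K K' lam lam' P P')
    (h : ∃ M0 : ℝ, ∀ M ≥ M0, P' (hit {g | psi μ μ' g < -M}) ≤ 1 / 2) : ∃ B : ℝ, ∀ g, |psi μ μ' g| ≤ B := by
  have := T.p'.1
  obtain ⟨M0, h⟩ := h
  obtain ⟨D, hD, hm⟩ := T.max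
  have t : Tendsto (fun M : ℝ => D * ENNReal.ofReal (Real.exp (-M))) atTop (𝓝 (D * ENNReal.ofReal 0)) :=
    ENNReal.Tendsto.const_mul (ENNReal.tendsto_ofReal (Real.tendsto_exp_neg_atTop_nhds_zero)) (Or.inr hD)
  rw [ENNReal.ofReal_zero, mul_zero] at t
  obtain ⟨M, h1, h2⟩ := ((t.eventually_lt_const (show (0 : ℝ≥0∞) < 1 / 2 by norm_num)).and
    (eventually_ge_atTop M0)).exists
  refine T.rigid M fun h0 => ?_
  have cov : (univ : Set (ℕ → G)) ⊆ ({ω | ∀ j, walkPos j ω ∈ {g | |psi μ μ' g| ≤ M}} ∪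
      hit {g | M ≤ psi μ μ' g}) ∪ hit {g | psi μ μ' g < -M} := by
    intro ω _
    by_contra hno
    simp only [mem_union, not_or, hit, mem_ofPred_eq, not_exists, not_le, not_lt] at hno
    exact hno.1.1 fun j => abs_le.2 ⟨hno.2 j, (hno.1.2 j).le⟩
  have b := measure_mono (μ := P') cov
  rw [measure_univ] at b
  have b2 := b.trans ((measure_union_le _ _).trans (add_le_add (measure_union_le _ _) le_rfl))
  rw [h0, zero_add] at b2
  have b3 : P' (hit {g | M ≤ psi μ μ' g}) + P' (hit {g | psi μ μ' g < -M}) < 1 / 2 + 1 / 2 :=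
    ENNReal.add_lt_add_of_lt_of_le (ne_top_of_le_ne_top (by norm_num) (h M h2)) ((hm M).trans_lt h1) (h M h2)
  rw [ENNReal.add_halves] at b3
  exact absurd b2 (not_le.2 b3)

theorem Two.of_drift (T : Two S δ μ μ' K K' lam lam' P P')
    (hlim : Tendsto (fun n : ℕ => Ex μ' n (psi μ μ') / n) atTop (𝓝 0)) : ∃ B : ℝ, ∀ g, |psi μ μ' g| ≤ B := by
  have hS := T.g.gen
  have hw := T.w'
  have hprob := T.p'.1
  set ψ := psi μ μ' with hψd
  obtain ⟨C, hC, hψ, hψ2⟩ := T.psi_props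
  rw [← hψd] at hψ hψ2
  obtain ⟨C1, hC1, hdev⟩ := hw.Ex_dev T.g T.p'
  obtain ⟨D, hD, hmax⟩ := T.max
  rw [← hψd] at hmax
  set C3 := C * (1 + C1) with hC3
  have hC30 : 0 ≤ C3 := by positivity
  have sub : ∀ n m, Ex μ' (n + m) ψ ≤ Ex μ' n ψ + Ex μ' m ψ + C3 := by
    intro n m
    rw [hw.Ex_conv hS]
    calc Ex μ' n (fun a => Ex μ' m (fun b => ψ (a * b)))
        ≤ Ex μ' n (fun a => ψ a + (Ex μ' m ψ + C3)) := by
          refine hw.Ex_mono hS fun a _ => ?_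
          calc Ex μ' m (fun b => ψ (a * b)) ≤ Ex μ' m (fun b => (ψ b + C * gp S a⁻¹ b) + (ψ a + C)) :=
                hw.Ex_mono hS fun b _ => by linarith [(abs_le.1 (hψ a b)).2]
            _ ≤ _ := by
                rw [hw.Ex_add hS, hw.Ex_add hS, hw.Ex_const hS, Ex_mul]
                have := mul_le_mul_of_nonneg_left (hdev a⁻¹ m) hC
                rw [hC3]; linarith
      _ = _ := by rw [hw.Ex_add hS, hw.Ex_const hS]; ring
  have low : ∀ n, -C3 ≤ Ex μ' n ψ := by
    intro n
    rcases Nat.eq_zero_or_pos n with rfl | hn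
    · have := sub 0 0; simp only [add_zero] at this; linarith
    have it : ∀ j : ℕ, Ex μ' (j * n + n) ψ + C3 ≤ (j + 1) * (Ex μ' n ψ + C3) := by
      intro j
      induction j with
      | zero => simp
      | succ j ih =>
        have := sub (j * n + n) n
        rw [show (j + 1) * n + n = j * n + n + n by ring]
        push_cast; linarith
    have hn' : (0 : ℝ) < n := by exact_mod_cast hn
    have t : Tendsto (fun j : ℕ => j * n + n) atTop atTop :=
      tendsto_atTop_mono (fun j => (Nat.le_mul_of_pos_right j hn).trans (Nat.le_add_right _ _)) tendsto_id
    have := le_of_tendsto' (hlim.comp t) (b := (Ex μ' n ψ + C3) / n) fun j => by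
      simp only [Function.comp]
      have e : ((j * n + n : ℕ) : ℝ) = (j + 1) * n := by push_cast; ring
      rw [e, div_le_div_iff₀ (by positivity) hn']
      have := mul_le_mul_of_nonneg_right (it j) hn'.le
      nlinarith
    rw [le_div_iff₀ hn', zero_mul] at this
    linarith
  obtain ⟨C5, hC5, hplus⟩ : ∃ C5 : ℝ, 0 ≤ C5 ∧ ∀ n, Ex μ' n (fun g => Max.max (ψ g) 0) ≤ C5 := by
    have hs : Summable fun r : ℕ => Real.exp (-(r : ℝ)) := by
      have := summable_geometric_of_lt_one (Real.exp_pos (-1)).le (by simp)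
      refine this.congr fun r => ?_
      rw [← Real.exp_nat_mul]; congr 1; ring
    refine ⟨(D * ∑' r : ℕ, ENNReal.ofReal (Real.exp (-(r : ℝ)))).toReal, ENNReal.toReal_nonneg, fun n => ?_⟩
    rw [← ENNReal.ofReal_le_iff_le_toReal (ENNReal.mul_ne_top hD hs.tsum_ofReal_ne_top),
      hw.Ex_ofReal hS n (fun g => le_max_right _ _)]
    calc ∑' g, ENNReal.ofReal (Max.max (ψ g) 0) * q μ' ∅ n 1 g
        ≤ ∑' g, ∑' r : ℕ, indicator {g | (r : ℝ) ≤ ψ g} (fun g => q μ' ∅ n 1 g) g := by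
          refine ENNReal.tsum_le_tsum fun g => ?_
          rcases le_or_gt (ψ g) 0 with h0 | h0
          · simp [h0]
          set m := ⌊ψ g⌋₊
          have h1 : ENNReal.ofReal (Max.max (ψ g) 0) ≤ ((m + 1 : ℕ) : ℝ≥0∞) := by
            rw [max_eq_left h0.le, ← ENNReal.ofReal_natCast]
            exact ENNReal.ofReal_le_ofReal (by push_cast; exact (Nat.lt_floor_add_one _).le)
          refine (mul_le_mul_left h1 _).trans ?_
          refine le_trans ?_ (ENNReal.sum_le_tsum (Finset.range (m + 1)))
          rw [Finset.sum_congr rfl (g := fun _ => q μ' ∅ n 1 g)]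
          · rw [Finset.sum_const, Finset.card_range, nsmul_eq_mul]
          · intro r hr
            refine indicator_of_mem ?_ _
            have h2 : r ≤ m := by have := Finset.mem_range.1 hr; omega
            have h3 : (r : ℝ) ≤ m := by exact_mod_cast h2
            exact h3.trans (Nat.floor_le h0.le)
      _ = ∑' r : ℕ, P' {ω | walkPos n ω ∈ {g | (r : ℝ) ≤ ψ g}} := by
          rw [ENNReal.tsum_comm]; simp_rw [law_set T.p']
      _ ≤ _ := by
          rw [← ENNReal.tsum_mul_left]
          refine ENNReal.tsum_le_tsum fun r => le_trans (measure_mono (pos_sub_hit n _)) (hmax r)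
  have hminus : ∀ n, Ex μ' n (fun g => Max.max (-ψ g) 0) ≤ C5 + C3 := by
    intro n
    have e : (fun g => Max.max (-ψ g) 0) = fun g => Max.max (ψ g) 0 + (-1) * ψ g := by
      funext g
      rcases le_total (ψ g) 0 with h | h
      · rw [max_eq_left (by linarith), max_eq_right h]; ring
      · rw [max_eq_right (by linarith), max_eq_left h]; ring
    rw [e, hw.Ex_add hS, Ex_mul]
    linarith [low n, hplus n]
  obtain ⟨r, hr⟩ := hw.dev_small T.g T.p' (1 / 4) (by norm_num)
  have t : Tendsto (fun M : ℝ => D * ENNReal.ofReal (Real.exp (-(M / 4)))) atTop (𝓝 (D * ENNReal.ofReal 0)) :=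
    ENNReal.Tendsto.const_mul (ENNReal.tendsto_ofReal (Real.tendsto_exp_neg_atTop_nhds_zero.comp
      (tendsto_id.atTop_div_const (by norm_num)))) (Or.inr hD)
  rw [ENNReal.ofReal_zero, mul_zero] at t
  obtain ⟨M0, hM0⟩ := eventually_atTop.1 ((t.eventually_le_const (show (0 : ℝ≥0∞) < 1 / 4 by norm_num)).and
    ((eventually_ge_atTop (4 * (C * (1 + r)))).and (eventually_ge_atTop (8 * (C5 + C3) + 1))))
  refine T.rigid2 ⟨M0, fun M hM => ?_⟩
  obtain ⟨m1, m2, m3⟩ := hM0 M hM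
  have hMp : 0 < M := by linarith
  set A : G → Set (ℕ → G) := fun a => {ω | ∀ k, walkPos k ω ∈ {g | ψ g + C * (1 + gp S a⁻¹ g) < M / 2}} with hA
  have pA : ∀ a, 1 / 2 ≤ P' (A a) := by
    intro a
    refine half_compl (ms_all _) ?_
    have c : (A a)ᶜ ⊆ hit {g | M / 4 ≤ ψ g} ∪ hit {g | (r : ℝ) ≤ gp S a⁻¹ g} := by
      intro ω hω
      simp only [hA, mem_compl_iff, mem_ofPred_eq, not_forall, not_lt] at hω
      obtain ⟨k, hk⟩ := hω
      rcases le_or_gt (M / 4) (ψ (walkPos k ω)) with h | h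
      · exact Or.inl ⟨k, h⟩
      · refine Or.inr ⟨k, ?_⟩
        by_contra hc
        have : gp S a⁻¹ (walkPos k ω) ≤ r := (not_le.1 hc).le
        have : C * (1 + gp S a⁻¹ (walkPos k ω)) ≤ C * (1 + r) := by gcongr
        linarith
    refine (measure_mono c).trans ((measure_union_le _ _).trans
      ((add_le_add ((hmax _).trans m1) (hr _)).trans ?_))
    rw [← ENNReal.toReal_le_toReal (by finiteness) (by finiteness), ENNReal.toReal_add (by finiteness) (by finiteness)]
    norm_num
  have sm := strong_markov T.p' {g | ψ g < -M} A (fun a => ms_all _) (1 / 2) fun a _ => pA a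
  have hsub : {ω : ℕ → G | ∃ n, walkPos n ω ∈ {g | ψ g < -M} ∧ sh n ω ∈ A (walkPos n ω)} ⊆
      ⋃ N, ⋂ j, {ω | walkPos (N + j) ω ∈ {g | ψ g < -(M / 2)}} := by
    rintro ω ⟨n, h1, h2⟩
    refine mem_iUnion.2 ⟨n, mem_iInter.2 fun j => ?_⟩
    have h3 : ψ (walkPos n ω) < -M := h1
    have h4 : ψ (walkPos j (sh n ω)) + C * (1 + gp S (walkPos n ω)⁻¹ (walkPos j (sh n ω))) < M / 2 := h2 j
    change ψ (walkPos (n + j) ω) < _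
    rw [walkPos_add]
    linarith [(abs_le.1 (hψ (walkPos n ω) (walkPos j (sh n ω)))).2]
  have mono : Monotone fun N => ⋂ j, {ω : ℕ → G | walkPos (N + j) ω ∈ {g | ψ g < -(M / 2)}} := by
    intro N N' hN ω hω
    obtain ⟨d, rfl⟩ := Nat.exists_eq_add_of_le hN
    refine mem_iInter.2 fun j => ?_
    rw [add_assoc]; exact mem_iInter.1 hω (d + j)
  have pt : ∀ N, P' {ω | walkPos N ω ∈ {g | ψ g < -(M / 2)}} ≤ 1 / 4 := by
    intro N
    refine (hw.P_le_Ex hS T.p' N (f := fun g => (2 / M) * Max.max (-ψ g) 0) (fun g => by positivity) ?_).trans ?_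
    · intro g hg
      have : M / 2 ≤ Max.max (-ψ g) 0 := le_max_of_le_left (by linarith [show ψ g < -(M / 2) from hg])
      calc (1 : ℝ) = (2 / M) * (M / 2) := by field_simp
        _ ≤ _ := by gcongr
    · rw [Ex_mul, show (1 / 4 : ℝ≥0∞) = ENNReal.ofReal (1 / 4) by
        rw [ENNReal.ofReal_div_of_pos (by norm_num)]; norm_num]
      refine ENNReal.ofReal_le_ofReal ?_
      have := hminus N
      rw [div_mul_eq_mul_div, div_le_iff₀ hMp]
      linarith
  have bnd := sm.trans (measure_mono hsub)
  rw [mono.measure_iUnion] at bnd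
  have b2 : 1 / 2 * P' (hit {g | ψ g < -M}) ≤ 1 / 4 :=
    bnd.trans (iSup_le fun N => (measure_mono (iInter_subset _ 0)).trans (pt N))
  have b3 := mul_le_mul_right b2 2
  rw [← mul_assoc, one_div, ENNReal.mul_inv_cancel (by norm_num) (by norm_num), one_mul] at b3
  refine b3.trans ?_
  rw [← ENNReal.toReal_le_toReal (by finiteness) (by finiteness)]
  norm_num

theorem Two.four (T : Two S δ μ μ' K K' lam lam' P P') (h : ∃ B : ℝ, ∀ g, |psi μ μ' g| ≤ B) :
    ∃ K : ℝ, 0 < K ∧ ∀ x y : G,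
        greenFn μ x y ≤ K * greenFn μ' x y ∧ greenFn μ' x y ≤ K * greenFn μ x y := by
  obtain ⟨B, hB⟩ := h
  refine ⟨Real.exp B, Real.exp_pos _, fun x y => ?_⟩
  rw [T.w.green_one, T.w'.green_one, T.w.green_eq_exp, T.w'.green_eq_exp, ← Real.exp_add, ← Real.exp_add,
    Real.exp_le_exp, Real.exp_le_exp]
  have := abs_le.1 (hB (x⁻¹ * y))
  unfold psi at this
  constructor <;> linarith

theorem Two.one_four (T : Two S δ μ μ' K K' lam lam' P P') {h' : ℝ} (hent' : HasEntropy μ' h')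
    (h : Tendsto (fun n : ℕ => ∫ ω, |(-Real.log (greenFn μ 1 (walkPos n ω)) / n) - h'| ∂P')
          atTop (𝓝 (0 : ℝ))) : ∃ B : ℝ, ∀ g, |psi μ μ' g| ≤ B := by
  have hS := T.g.gen
  have := T.p'.1
  apply T.of_drift
  have e1 := T.w'.entropy T.g T.p' hent'
  have e2 : Tendsto (fun n : ℕ => Ex μ' n (XG μ) / n) atTop (𝓝 h') := by
    rw [tendsto_iff_dist_tendsto_zero]
    refine squeeze_zero (fun n => dist_nonneg) (fun n => ?_) h
    obtain ⟨i1, i2⟩ := T.w'.Ex_int hS T.p' n (XG μ)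
    rw [Real.dist_eq, ← i2]
    have : (∫ ω, XG μ (walkPos n ω) ∂P') / n - h' = ∫ ω, (XG μ (walkPos n ω) / n - h') ∂P' := by
      rw [integral_sub (i1.div_const _) (integrable_const _), integral_div]; simp
    rw [this]
    exact abs_integral_le_integral_abs
  have e3 := e1.sub e2
  rw [sub_self] at e3
  refine e3.congr fun n => ?_
  rw [← sub_div]
  congr 1
  have := T.w'.Ex_add hS n (XG μ') (fun g => (-1) * XG μ g)
  rw [Ex_mul] at this
  have e : psi μ μ' = fun g => XG μ' g + (-1) * XG μ g := by funext g; unfold psi; ring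
  rw [e, this]; ring

theorem Two.four_one (T : Two S δ μ μ' K K' lam lam' P P') {h' : ℝ} (hent' : HasEntropy μ' h')
    (h : ∃ K : ℝ, 0 < K ∧ ∀ x y : G,
        greenFn μ x y ≤ K * greenFn μ' x y ∧ greenFn μ' x y ≤ K * greenFn μ x y) :
    (∀ᵐ ω ∂P', Tendsto (fun n : ℕ => -Real.log (greenFn μ 1 (walkPos n ω)) / n) atTop (𝓝 h')) ∧
    Tendsto (fun n : ℕ => ∫ ω, |(-Real.log (greenFn μ 1 (walkPos n ω)) / n) - h'| ∂P') atTop (𝓝 (0 : ℝ)) := by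
  have hS := T.g.gen
  obtain ⟨κ, hκ, hk⟩ := h
  obtain ⟨C, h0, h1, h2⟩ := T.w.X_abs T.g
  refine T.w'.conc_as T.g T.p' (Y := XG μ) h0 h1 h2 ?_
  have e1 := T.w'.entropy T.g T.p' hent'
  have hb : ∀ g, |XG μ g - XG μ' g| ≤ Real.log κ := by
    intro g
    have a := hk 1 g
    have p := T.w.green_pos 1 g
    have p' := T.w'.green_pos 1 g
    have l1 := Real.log_le_log p a.1
    have l2 := Real.log_le_log p' a.2
    rw [Real.log_mul hκ.ne' (by positivity)] at l1 l2
    unfold XG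
    rw [abs_le]; constructor <;> linarith
  have ub : ∀ n, |Ex μ' n (XG μ) - Ex μ' n (XG μ')| ≤ Real.log κ := by
    intro n
    have a1 : Ex μ' n (XG μ) ≤ Ex μ' n (fun g => XG μ' g + Real.log κ) :=
      T.w'.Ex_mono hS fun g _ => by linarith [(abs_le.1 (hb g)).2]
    have a2 : Ex μ' n (XG μ') ≤ Ex μ' n (fun g => XG μ g + Real.log κ) :=
      T.w'.Ex_mono hS fun g _ => by linarith [(abs_le.1 (hb g)).1]
    rw [T.w'.Ex_add hS, T.w'.Ex_const hS] at a1 a2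
    rw [abs_le]; constructor <;> linarith
  have z : Tendsto (fun n : ℕ => Ex μ' n (XG μ) / n - Ex μ' n (XG μ') / n) atTop (𝓝 0) := by
    refine squeeze_zero_norm (fun n => ?_) (tendsto_const_div_atTop_nhds_zero_nat (Real.log κ))
    rw [← sub_div, Real.norm_eq_abs, abs_div, Nat.abs_cast]
    exact div_le_div_of_nonneg_right (ub n) (Nat.cast_nonneg n)
  have := z.add e1
  simpa using this

end

/-! ## M11 -/
set_option linter.unusedSectionVars false
set_option linter.unusedVariables false
section
variable {S : Finset G} {δ : ℕ} {μ μ' : G → ℝ} {K K' : ℕ} {lam lam' : ℝ}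
variable [Countable G] [MeasurableSpace G] [MeasurableSingletonClass G] {P P' : Measure (ℕ → G)}
variable {B : Type*} [MetricSpace B] {bd : BoundaryData G (wordDist S) B} {ε C : ℝ}

theorem seqG_frequently (hS : Generates S) {u v : ℕ → G} {b b' : B} (hu : bd.conv u b) (hv : bd.conv v b')
    (hne : b ≠ b') : ∃ R : ℝ, ∃ᶠ n in atTop, gp S (u n) (v n) ≤ R := by
  by_contra hcon
  push Not at hcon
  refine hne (bd.conv_unique v b b' ((bd.conv_iff u v b hu).2 ?_) hv)
  rw [Filter.tendsto_atTop]
  intro R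
  filter_upwards [hcon R] with n hn
  rw [gp_gromov_one hS]; exact hn.le

theorem bd_dist_le (hS : Generates S) (hvis : IsVisualMetric (wordDist S) bd ε C) {u v : ℕ → G} {b b' : B}
    (hu : bd.conv u b) (hv : bd.conv v b') {R : ℝ} (hR : ∀ᶠ n in atTop, R ≤ gp S (u n) (v n)) :
    dist b b' ≤ C * Real.exp (-ε * R) := by
  obtain ⟨hε, hC, h⟩ := hvis
  by_cases hne : b = b'
  · rw [hne, dist_self]; positivity
  refine (h u v b b' hu hv hne).1.trans ?_
  obtain ⟨R', hR'⟩ := seqG_frequently hS hu hv hne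
  have : R ≤ seqGromov (wordDist S) u v := by
    unfold seqGromov
    simp_rw [gp_gromov_one hS]
    exact le_liminf_of_le (IsCoboundedUnder.of_frequently_le hR') hR
  refine mul_le_mul_of_nonneg_left (Real.exp_le_exp.2 ?_) hC.le
  nlinarith

theorem bd_gp_ge (hS : Generates S) (hvis : IsVisualMetric (wordDist S) bd ε C) {u v : ℕ → G} {b b' : B}
    (hu : bd.conv u b) (hv : bd.conv v b') {R : ℝ} (hR : C * dist b b' < Real.exp (-ε * R)) :
    ∀ᶠ n in atTop, R ≤ gp S (u n) (v n) := by
  obtain ⟨hε, hC, h⟩ := hvis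
  by_cases hne : b = b'
  · subst hne
    have := (bd.conv_iff u v b hu).1 hv
    simp_rw [gp_gromov_one hS] at this
    exact this.eventually_ge_atTop R
  have h1 := (h u v b b' hu hv hne).2.trans_lt hR
  have h2 : R < seqGromov (wordDist S) u v := by
    have := Real.exp_lt_exp.1 h1
    nlinarith
  unfold seqGromov at h2
  simp_rw [gp_gromov_one hS] at h2
  have hb : IsBoundedUnder (· ≥ ·) atTop fun n => gp S (u n) (v n) :=
    isBoundedUnder_of ⟨0, fun n => gp_nonneg hS _ _⟩
  exact (eventually_lt_of_lt_liminf h2 hb).mono fun n hn => hn.le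

theorem bd_shift (hS : Generates S) {u : ℕ → G} {b : B} (hu : bd.conv u b) (n : ℕ) :
    bd.conv (fun k => u (n + k)) b := by
  rw [bd.conv_iff u _ b hu]
  have h : Tendsto (fun p : ℕ × ℕ => gromov (wordDist S) 1 (u p.1) (u p.2)) atTop atTop :=
    bd.conv_tendstoInfinity u b hu
  have t : Tendsto (fun k : ℕ => (k, n + k)) atTop atTop := by
    rw [← prod_atTop_atTop_eq]
    exact tendsto_id.prodMk (tendsto_atTop_mono (fun k => Nat.le_add_left k n) tendsto_id)
  have h' := h.comp t
  simp only [Function.comp_def] at h'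
  exact h'

def bsh (bd : BoundaryData G (wordDist S) B) (c : ℝ) (y : G) : Set B :=
  {ξ | ∃ u, bd.conv u ξ ∧ ∀ n, u n ∈ shd S c y}

theorem stay_bsh (hS : Generates S) {c : ℝ} {Λ : Set G} {ω : ℕ → G} {b : B}
    (hω : bd.conv (fun n => walkPos n ω) b) (h : ω ∈ stay S c Λ) : ∃ y ∈ Λ, b ∈ bsh bd c y := by
  obtain ⟨n, hn, hk⟩ := h
  exact ⟨_, hn, _, bd_shift hS hω n, hk⟩

theorem near_bsh (hg : Geo S δ) (hvis : IsVisualMetric (wordDist S) bd ε C) {c : ℝ} {y : G} {ξ b : B}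
    (hξ : ξ ∈ bsh bd c y) (hc : 0 ≤ c) {ω : ℕ → G} (hω : bd.conv (fun n => walkPos n ω) b)
    (hb : C * dist ξ b < Real.exp (-ε * len S y)) : ∃ n, walkPos n ω ∈ shd S (c + δ) y := by
  obtain ⟨u, hu, huy⟩ := hξ
  obtain ⟨n, hn⟩ := (bd_gp_ge hg.gen hvis hu hω hb).exists
  refine ⟨n, ?_⟩
  have h1 : len S y - c ≤ gp S y (u n) := huy n
  have h2 := hg.hyp y (u n) (walkPos n ω)
  have h3 : len S y - c ≤ min (gp S y (u n)) (gp S (u n) (walkPos n ω)) := le_min h1 (by linarith)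
  change len S y - (c + δ) ≤ gp S y (walkPos n ω)
  linarith

theorem conv_bsh (hg : Geo S δ) (hvis : IsVisualMetric (wordDist S) bd ε C) {c : ℝ} (hc : 0 ≤ c)
    {ω : ℕ → G} {b : B} (hω : bd.conv (fun n => walkPos n ω) b) {O : Set B} (hO : IsOpen O) (hb : b ∈ O) :
    ∃ n, bsh bd c (walkPos n ω) ⊆ O := by
  have hS := hg.gen
  obtain ⟨r, hr, hrO⟩ := Metric.isOpen_iff.1 hO b hb
  obtain ⟨R, hR⟩ : ∃ R : ℝ, C * Real.exp (-ε * R) < r := by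
    have t : Tendsto (fun R : ℝ => C * Real.exp (-(ε * R))) atTop (𝓝 (C * 0)) :=
      (Real.tendsto_exp_neg_atTop_nhds_zero.comp (tendsto_id.const_mul_atTop hvis.1)).const_mul C
    rw [mul_zero] at t
    obtain ⟨R, h⟩ := (t.eventually_lt_const hr).exists
    exact ⟨R, by rwa [neg_mul]⟩
  have hinf := bd.conv_tendstoInfinity _ _ hω
  have h1 := Filter.tendsto_atTop.1 hinf (R + c + δ)
  rw [← prod_atTop_atTop_eq, eventually_prod_iff] at h1
  obtain ⟨p, hp, q, hq, hpq⟩ := h1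
  obtain ⟨n, hn⟩ := hp.exists
  refine ⟨n, ?_⟩
  rintro ξ ⟨v, hv, hvy⟩
  apply hrO
  rw [Metric.mem_ball]
  refine (bd_dist_le hS hvis hv hω ?_).trans_lt hR
  filter_upwards [hq] with k hk
  have h2 := hpq hn hk
  simp only [gp_gromov_one hS] at h2
  have h3 : len S (walkPos n ω) - c ≤ gp S (walkPos n ω) (v k) := hvy k
  have h4 := gp_le_left hS (walkPos n ω) (walkPos k ω)
  have h5 := hg.hyp (v k) (walkPos n ω) (walkPos k ω)
  rw [gp_comm hS (v k)] at h5
  have h6 : R + δ ≤ min (gp S (walkPos n ω) (v k)) (gp S (walkPos n ω) (walkPos k ω)) :=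
    le_min (by linarith) (by linarith)
  linarith

variable [MeasurableSpace B] [BorelSpace B] {ν ν' : Measure B}

theorem Two.three_four (T : Two S δ μ μ' K K' lam lam' P P') (hvis : IsVisualMetric (wordDist S) bd ε C)
    (hharm : IsHarmonicMeasure (wordDist S) bd μ P ν) (hharm' : IsHarmonicMeasure (wordDist S) bd μ' P' ν')
    (hac : ν' ≪ ν) : ∃ B : ℝ, ∀ g, |psi μ μ' g| ≤ B := by
  have hS := T.g.gen
  have := T.p.1
  have := T.p'.1
  obtain ⟨-, Z, hZm, hZ, hν⟩ := hharm
  obtain ⟨-, Z', hZm', hZ', hν'⟩ := hharm'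
  obtain ⟨c2, hc2⟩ := T.w'.dev_small T.g T.p' (1 / 2) (by norm_num)
  have H2 : Half S P' c2 := ⟨Nat.cast_nonneg _, hc2⟩
  obtain ⟨D, hD, hV⟩ := vitali T.g T.w T.p T.w' T.p' (c := (c2 : ℝ) + δ) (by positivity) H2
  set U : ℕ → Set B := fun M => ⋃ y ∈ {g | psi μ μ' g < -(M : ℝ)}, ⋃ ξ ∈ bsh bd c2 y,
    Metric.ball ξ (C⁻¹ * Real.exp (-ε * len S y)) with hU
  have Uo : ∀ M, IsOpen (U M) := fun M =>
    isOpen_biUnion fun y _ => isOpen_biUnion fun ξ _ => Metric.isOpen_ball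
  have Ua : Antitone U := by
    intro M N hMN
    refine biUnion_subset_biUnion_left fun g hg => ?_
    have h1 : psi μ μ' g < -(N : ℝ) := hg
    have h2 : (M : ℝ) ≤ N := by exact_mod_cast hMN
    change psi μ μ' g < -(M : ℝ)
    linarith
  have hνU : ∀ M : ℕ, ν (U M) ≤ D * ENNReal.ofReal (Real.exp (-(M : ℝ))) := by
    intro M
    rw [hν, Measure.map_apply hZm (Uo M).measurableSet]
    have h1 := hV {g | psi μ μ' g < -(M : ℝ)} (ENNReal.ofReal (Real.exp (-(M : ℝ)))) fun y hy =>
      T.Gr_cmp (le_of_lt hy)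
    refine (measure_mono_ae ?_).trans (h1.trans ((mul_le_mul_right prob_le_one _).trans (mul_one _).le))
    refine hZ.mono fun ω hω hU' => ?_
    have hU'' : Z ω ∈ U M := hU'
    simp only [hU, mem_iUnion] at hU''
    obtain ⟨y, hy, ξ, hξ, hb⟩ := hU''
    rw [Metric.mem_ball, dist_comm] at hb
    obtain ⟨n, hn⟩ := near_bsh T.g hvis hξ (Nat.cast_nonneg _) hω (by
      have h3 := mul_lt_mul_of_pos_left hb hvis.2.1
      rwa [mul_inv_cancel_left₀ hvis.2.1.ne'] at h3)
    exact ⟨n, y, hy, hn⟩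
  have hpν' : IsProbabilityMeasure ν' := by
    rw [hν']; exact Measure.isProbabilityMeasure_map hZm'.aemeasurable
  have h0 : ν (⋂ M, U M) = 0 := by
    have t : Tendsto (fun M : ℕ => D * ENNReal.ofReal (Real.exp (-(M : ℝ)))) atTop (𝓝 (D * ENNReal.ofReal 0)) :=
      ENNReal.Tendsto.const_mul (ENNReal.tendsto_ofReal
        (Real.tendsto_exp_neg_atTop_nhds_zero.comp tendsto_natCast_atTop_atTop)) (Or.inr hD)
    rw [ENNReal.ofReal_zero, mul_zero] at t
    exact nonpos_iff_eq_zero.1 (ge_of_tendsto' t fun M => (measure_mono (iInter_subset _ M)).trans (hνU M))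
  have t' := tendsto_measure_iInter_atTop (μ := ν') (fun M => (Uo M).measurableSet.nullMeasurableSet) Ua
    ⟨0, measure_ne_top _ _⟩
  rw [hac h0] at t'
  obtain ⟨M0, hM0⟩ := (t'.eventually_le_const (show (0 : ℝ≥0∞) < 1 / 4 by norm_num)).exists
  refine T.rigid2 ⟨M0, fun M hM => ?_⟩
  have e1 : P' (hit {g | psi μ μ' g < -M}) ≤ P' (hit {g | psi μ μ' g < -(M0 : ℝ)}) := by
    refine measure_mono (hit_mono fun g hg => ?_)
    have h1 : psi μ μ' g < -M := hg
    change psi μ μ' g < -(M0 : ℝ)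
    linarith
  have e2 := H2.SL T.g T.p' {g | psi μ μ' g < -(M0 : ℝ)}
  have e3 : P' (stay S c2 {g | psi μ μ' g < -(M0 : ℝ)}) ≤ ν' (U M0) := by
    rw [hν', Measure.map_apply hZm' (Uo M0).measurableSet]
    refine measure_mono_ae (hZ'.mono fun ω hω hs => ?_)
    obtain ⟨y, hy, hb⟩ := stay_bsh hS hω hs
    refine mem_biUnion hy (mem_biUnion hb (Metric.mem_ball_self ?_))
    have := hvis.2.1
    positivity
  calc _ ≤ _ := e1
    _ ≤ _ := e2
    _ ≤ 2 * (1 / 4) := mul_le_mul_right (e3.trans hM0) _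
    _ = 1 / 2 := by
      rw [← ENNReal.toReal_eq_toReal_iff' (by finiteness) (by finiteness)]
      norm_num

theorem Two.four_three (T : Two S δ μ μ' K K' lam lam' P P') (hvis : IsVisualMetric (wordDist S) bd ε C)
    (hharm : IsHarmonicMeasure (wordDist S) bd μ P ν) (hharm' : IsHarmonicMeasure (wordDist S) bd μ' P' ν')
    (h : ∃ K : ℝ, 0 < K ∧ ∀ x y : G,
        greenFn μ x y ≤ K * greenFn μ' x y ∧ greenFn μ' x y ≤ K * greenFn μ x y) : ν ≪ ν' := by
  have hS := T.g.gen
  have := T.p.1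
  have := T.p'.1
  obtain ⟨-, Z, hZm, hZ, hν⟩ := hharm
  obtain ⟨-, Z', hZm', hZ', hν'⟩ := hharm'
  obtain ⟨c2, hc2⟩ := T.w'.dev_small T.g T.p' (1 / 2) (by norm_num)
  have H2 : Half S P' c2 := ⟨Nat.cast_nonneg _, hc2⟩
  obtain ⟨D, hD, hV⟩ := vitali T.g T.w T.p T.w' T.p' (c := 0) le_rfl H2
  obtain ⟨κ, hκ, hk⟩ := h
  have hpν' : IsProbabilityMeasure ν' := by
    rw [hν']; exact Measure.isProbabilityMeasure_map hZm'.aemeasurable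
  have hGr : ∀ y, Gr μ 1 y ≤ ENNReal.ofReal κ * Gr μ' 1 y := by
    intro y
    rw [T.w.Gr_exp, T.w'.Gr_exp, ← ENNReal.ofReal_mul hκ.le, ← T.w.green_eq_exp, ← T.w'.green_eq_exp]
    exact ENNReal.ofReal_le_ofReal (hk 1 y).1
  have key : ∀ O : Set B, IsOpen O → ν O ≤ D * ENNReal.ofReal κ * ν' O := by
    intro O hO
    have h1 := hV {y | bsh bd c2 y ⊆ O} (ENNReal.ofReal κ) fun y _ => hGr y
    rw [hν, Measure.map_apply hZm hO.measurableSet]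
    refine (measure_mono_ae ?_).trans (h1.trans (mul_le_mul_right ?_ _))
    · refine hZ.mono fun ω hω hO' => ?_
      obtain ⟨n, hn⟩ := conv_bsh T.g hvis (Nat.cast_nonneg c2) hω hO hO'
      refine ⟨n, _, hn, ?_⟩
      change len S (walkPos n ω) - 0 ≤ gp S (walkPos n ω) (walkPos n ω)
      rw [gp_self, sub_zero]
    · rw [hν', Measure.map_apply hZm' hO.measurableSet]
      refine measure_mono_ae (hZ'.mono fun ω hω hs => ?_)
      obtain ⟨y, hy, hb⟩ := stay_bsh hS hω hs
      exact hy hb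
  intro A hA
  have hfinite : D * ENNReal.ofReal κ ≠ ⊤ := ENNReal.mul_ne_top hD ENNReal.ofReal_ne_top
  have t : Tendsto (fun n : ℕ => D * ENNReal.ofReal κ * (n : ℝ≥0∞)⁻¹) atTop (𝓝 (D * ENNReal.ofReal κ * 0)) :=
    ENNReal.Tendsto.const_mul ENNReal.tendsto_inv_nat_nhds_zero (Or.inr hfinite)
  rw [mul_zero] at t
  refine nonpos_iff_eq_zero.1 (ge_of_tendsto' t fun n => ?_)
  obtain ⟨O, hAO, hO, hlt⟩ := A.exists_isOpen_lt_of_lt (μ := ν') (n : ℝ≥0∞)⁻¹ (by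
    rw [hA]; exact ENNReal.inv_pos.2 (ENNReal.natCast_ne_top n))
  exact (measure_mono hAO).trans ((key O hO).trans (mul_le_mul_right hlt.le _))

end

/-- **Corollary 1.6.**  Comparison of two finitely supported symmetric random walks on a
non-elementary hyperbolic group: equality of the entropy of one walk with the exponential
decay rate of the Green function of the other along its paths, equivalence of the harmonic
measures, and uniform comparability of the Green functions are all equivalent. -/
theorem simultaneous_walks_TFAE
    {G : Type*} [Group G] [Countable G] [MeasurableSpace G] [MeasurableSingletonClass G]
    (hG : NonElemHyperbolic G)
    (μ μ' : G → ℝ)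
    (hprob : IsProbDensity μ) (hsymm : IsSymmetric μ)
    (hfin : {g : G | μ g ≠ 0}.Finite) (hgen : GeneratesSupp μ)
    (hprob' : IsProbDensity μ') (hsymm' : IsSymmetric μ')
    (hfin' : {g : G | μ' g ≠ 0}.Finite) (hgen' : GeneratesSupp μ')
    (S : Finset G) (hS : Generates S)
    {B : Type*} [MetricSpace B] [MeasurableSpace B] [BorelSpace B]
    (bd : BoundaryData G (wordDist S) B) (ε C : ℝ)
    (hvis : IsVisualMetric (wordDist S) bd ε C)
    (P P' : Measure (ℕ → G)) (ν ν' : Measure B)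
    (hharm : IsHarmonicMeasure (wordDist S) bd μ P ν)
    (hharm' : IsHarmonicMeasure (wordDist S) bd μ' P' ν')
    (h h' : ℝ) (hent : HasEntropy μ h) (hent' : HasEntropy μ' h') :
    [ (∀ᵐ ω ∂P', Tendsto (fun n : ℕ => -Real.log (greenFn μ 1 (walkPos n ω)) / n)
          atTop (𝓝 h')) ∧
        Tendsto (fun n : ℕ =>
            ∫ ω, |(-Real.log (greenFn μ 1 (walkPos n ω)) / n) - h'| ∂P')
          atTop (𝓝 (0 : ℝ)),
      (∀ᵐ ω ∂P, Tendsto (fun n : ℕ => -Real.log (greenFn μ' 1 (walkPos n ω)) / n)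
          atTop (𝓝 h)) ∧
        Tendsto (fun n : ℕ =>
            ∫ ω, |(-Real.log (greenFn μ' 1 (walkPos n ω)) / n) - h| ∂P)
          atTop (𝓝 (0 : ℝ)),
      ν ≪ ν' ∧ ν' ≪ ν,
      ∃ K : ℝ, 0 < K ∧ ∀ x y : G,
        greenFn μ x y ≤ K * greenFn μ' x y ∧ greenFn μ' x y ≤ K * greenFn μ x y ].TFAE := by
  obtain ⟨hinf, -, hhyp⟩ := hG
  obtain ⟨hH, hq⟩ := hhyp S hS
  obtain ⟨δ, hg⟩ := exists_geo hS hH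
  obtain ⟨K, lam, hw⟩ := exists_walkOK hg hq hprob hsymm hfin hgen
  obtain ⟨K', lam', hw'⟩ := exists_walkOK hg hq hprob' hsymm' hfin' hgen'
  have T : Two S δ μ μ' K K' lam lam' P P' := ⟨hg, hw, hw', hharm.1, hharm'.1⟩
  have sw : ∀ {a b : G → ℝ}, (∃ K : ℝ, 0 < K ∧ ∀ x y : G,
      greenFn a x y ≤ K * greenFn b x y ∧ greenFn b x y ≤ K * greenFn a x y) →
      (∃ K : ℝ, 0 < K ∧ ∀ x y : G,
      greenFn b x y ≤ K * greenFn a x y ∧ greenFn a x y ≤ K * greenFn b x y) :=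
    fun ⟨k, h0, h1⟩ => ⟨k, h0, fun x y => (h1 x y).symm⟩
  tfae_have 1 → 4 := fun H => T.four (T.one_four hent' H.2)
  tfae_have 2 → 4 := fun H => sw (T.symm.four (T.symm.one_four hent H.2))
  tfae_have 3 → 4 := fun H => T.four (T.three_four hvis hharm hharm' H.2)
  tfae_have 4 → 1 := fun H => T.four_one hent' H
  tfae_have 4 → 2 := fun H => T.symm.four_one hent (sw H)
  tfae_have 4 → 3 := fun H => ⟨T.four_three hvis hharm hharm' H, T.symm.four_three hvis hharm' hharm (sw H)⟩
  tfae_finish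

end GHM
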